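/- arXiv:2405.07953 — 2 statements merged into one kernel-verified Lean document; each statement's English description precedes it below -/
import Mathlib

section
/- Let u, v : ℕ → ℤ, and let c, c', ρ, σ be real algebraic numbers and θ, θ', C₀ real numbers with c > 0, c' > 0, ρ > 1, σ > 1, 0 ≤ θ < ρ, 0 ≤ θ' < σ, such that |u(n) − c·ρ^n| ≤ C₀·θ^n and |v(m) − c'·σ^m| ≤ C₀·θ'^m for all n, m ∈ ℕ. Assume the set {(n, m) ∈ ℕ × ℕ : c·ρ^n = c'·σ^m} is finite. Then for every real K there exists a real L such that for all n, m ∈ ℕ: if u(n) ≥ L, v(m) ≥ L and u(n) ≠ v(m), then |u(n) − v(m)| > K. -/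
lemma liouville_aux {ι : Type} [Fintype ι] (a : ι → ℝ) (ha : ∀ i, IsAlgebraic ℚ (a i)) :
    ∃ c : ℝ, 1 ≤ c ∧ ∀ {κ : Type} (T : Finset κ) (Z : κ → ℤ) (e : κ → ι → ℕ) (E : ℕ) (H : ℝ),
      1 ≤ H → (∀ t ∈ T, ∑ i, e t i ≤ E) → ∑ t ∈ T, |(Z t : ℝ)| ≤ H →
      ∑ t ∈ T, (Z t : ℝ) * ∏ i, a i ^ e t i ≠ 0 →
      Real.exp (-(c * (E + Real.log H))) ≤ |∑ t ∈ T, (Z t : ℝ) * ∏ i, a i ^ e t i| := by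
  classical
  let K := IntermediateField.adjoin ℚ (Set.range a)
  have : FiniteDimensional ℚ K := by
    apply IntermediateField.finiteDimensional_adjoin
    rintro x ⟨i, rfl⟩
    exact (ha i).isIntegral
  have : NumberField K := { to_charZero := inferInstance, to_finiteDimensional := inferInstance }
  let b : ι → K := fun i => ⟨a i, IntermediateField.subset_adjoin ℚ _ ⟨i, rfl⟩⟩
  obtain ⟨d, hd0, hd⟩ := exists_integral_multiples ℤ ℚ (Finset.univ.image b)
  have hdb : ∀ i, IsIntegral ℤ ((d : K) * b i) := by
    intro i
    have := hd (b i) (by simp)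
    rwa [zsmul_eq_mul] at this
  obtain ⟨B, hB1, hB⟩ : ∃ B : ℝ, 1 ≤ B ∧ ∀ (φ : K →ₐ[ℚ] ℂ) i, ‖φ (b i)‖ ≤ B := by
    refine ⟨1 + ∑ φ : K →ₐ[ℚ] ℂ, ∑ i, ‖φ (b i)‖, ?_, ?_⟩
    · have : 0 ≤ ∑ φ : K →ₐ[ℚ] ℂ, ∑ i, ‖φ (b i)‖ := by positivity
      linarith
    · intro φ i
      have h1 : ‖φ (b i)‖ ≤ ∑ i, ‖φ (b i)‖ :=
        Finset.single_le_sum (f := fun i => ‖φ (b i)‖) (fun _ _ => norm_nonneg _) (Finset.mem_univ i)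
      have h2 : ∑ i, ‖φ (b i)‖ ≤ ∑ φ : K →ₐ[ℚ] ℂ, ∑ i, ‖φ (b i)‖ :=
        Finset.single_le_sum (f := fun φ : K →ₐ[ℚ] ℂ => ∑ i, ‖φ (b i)‖)
          (fun _ _ => by positivity) (Finset.mem_univ φ)
      linarith
  have hd1 : (1 : ℝ) ≤ |(d : ℝ)| := by
    have := Int.one_le_abs hd0
    exact_mod_cast this
  set M : ℝ := B * |(d : ℝ)| with hM
  have hM1 : 1 ≤ M := one_le_mul_of_one_le_of_one_le hB1 hd1
  have hlM : 0 ≤ Real.log M := Real.log_nonneg hM1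
  set n := Fintype.card (K →ₐ[ℚ] ℂ) with hn
  let φ₀ : K →ₐ[ℚ] ℂ := (Complex.ofRealAm.restrictScalars ℚ).comp K.val
  have hn1 : 1 ≤ n := Fintype.card_pos_iff.mpr ⟨φ₀⟩
  have hn1' : (1 : ℝ) ≤ n := by exact_mod_cast hn1
  refine ⟨n * (1 + Real.log M), by nlinarith, ?_⟩
  intro κ T Z e E H hH he hZ hne
  set γ : K := ∑ t ∈ T, (Z t : K) * ∏ i, b i ^ e t i with hγ
  have hγr : (γ : ℝ) = ∑ t ∈ T, (Z t : ℝ) * ∏ i, a i ^ e t i := by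
    have : (K.val γ : ℝ) = ∑ t ∈ T, (Z t : ℝ) * ∏ i, a i ^ e t i := by
      rw [hγ]
      simp only [map_sum, map_mul, map_prod, map_pow, map_intCast]
      rfl
    exact this
  rw [← hγr] at hne ⊢
  have hγ0 : γ ≠ 0 := by
    intro h; apply hne; rw [h]; rfl
  have hgint : IsIntegral ℤ ((d : K) ^ E * γ) := by
    rw [hγ, Finset.mul_sum]
    apply IsIntegral.sum
    intro t ht
    have : (d : K) ^ E * ((Z t : K) * ∏ i, b i ^ e t i) =
        (Z t : K) * ((d : K) ^ (E - ∑ i, e t i) * ∏ i, ((d : K) * b i) ^ e t i) := by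
      simp only [mul_pow]
      rw [Finset.prod_mul_distrib, Finset.prod_pow_eq_pow_sum]
      have h3 : (d : K) ^ E = (d : K) ^ (E - ∑ i, e t i) * (d : K) ^ (∑ i, e t i) := by
        rw [← pow_add, Nat.sub_add_cancel (he t ht)]
      rw [h3]; ring
    rw [this]
    have hI : ∀ z : ℤ, IsIntegral ℤ (z : K) := fun z => isIntegral_algebraMap (R := ℤ) (A := K) (x := z)
    refine (hI _).mul (((hI _).pow _).mul (IsIntegral.prod _ fun i _ => (hdb i).pow _))
  set δ : K := (d : K) ^ E * γ with hδ
  have hdK : (d : K) ≠ 0 := by exact_mod_cast hd0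
  have hδ0 : δ ≠ 0 := mul_ne_zero (pow_ne_zero _ hdK) hγ0
  have hnormint : IsIntegral ℤ (Algebra.norm ℚ δ) := Algebra.isIntegral_norm ℚ hgint
  obtain ⟨N, hN⟩ := IsIntegrallyClosed.isIntegral_iff.mp hnormint
  have hN0 : N ≠ 0 := by
    rintro rfl
    have : Algebra.norm ℚ δ = 0 := by rw [← hN]; simp
    exact hδ0 (Algebra.norm_eq_zero_iff.mp this)
  have hprod := Algebra.norm_eq_prod_embeddings ℚ ℂ δ
  have h1 : (1 : ℝ) ≤ ∏ φ : K →ₐ[ℚ] ℂ, ‖φ δ‖ := by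
    rw [← norm_prod, ← hprod, ← hN]
    have := Int.one_le_abs hN0
    simp
    exact_mod_cast this
  have hbd : ∀ φ : K →ₐ[ℚ] ℂ, ‖φ δ‖ ≤ H * M ^ E := by
    intro φ
    have hγφ : ‖φ γ‖ ≤ H * B ^ E := by
      rw [hγ, map_sum]
      calc ‖∑ t ∈ T, φ ((Z t : K) * ∏ i, b i ^ e t i)‖ ≤ ∑ t ∈ T, ‖φ ((Z t : K) * ∏ i, b i ^ e t i)‖ := norm_sum_le _ _
        _ ≤ ∑ t ∈ T, |(Z t : ℝ)| * B ^ E := by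
          apply Finset.sum_le_sum
          intro t ht
          rw [map_mul, map_intCast, norm_mul, map_prod, norm_prod]
          have : ‖((Z t : ℤ) : ℂ)‖ = |(Z t : ℝ)| := by simp
          rw [this]
          apply mul_le_mul_of_nonneg_left _ (abs_nonneg _)
          calc ∏ i, ‖φ (b i ^ e t i)‖ ≤ ∏ i, B ^ e t i := by
                apply Finset.prod_le_prod
                · intros; positivity
                · intro i _
                  rw [map_pow, norm_pow]
                  exact pow_le_pow_left₀ (norm_nonneg _) (hB φ i) _
            _ = B ^ (∑ i, e t i) := Finset.prod_pow_eq_pow_sum _ _ _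
            _ ≤ B ^ E := pow_le_pow_right₀ hB1 (he t ht)
        _ = (∑ t ∈ T, |(Z t : ℝ)|) * B ^ E := by rw [Finset.sum_mul]
        _ ≤ H * B ^ E := by gcongr
    rw [hδ, map_mul, map_pow, map_intCast, norm_mul, norm_pow]
    have : ‖(d : ℂ)‖ = |(d : ℝ)| := by simp
    rw [this, hM, mul_pow]
    calc |(d : ℝ)| ^ E * ‖φ γ‖ ≤ |(d : ℝ)| ^ E * (H * B ^ E) := by gcongr
      _ = _ := by ring
  have hA1 : 1 ≤ H * M ^ E := one_le_mul_of_one_le_of_one_le hH (one_le_pow₀ hM1)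
  have hφ₀ : ‖φ₀ δ‖ = |(d : ℝ)| ^ E * |(γ : ℝ)| := by
    have : φ₀ δ = (((d : ℝ) ^ E * (γ : ℝ) : ℝ) : ℂ) := by
      rw [hδ, map_mul, map_pow, map_intCast]
      push_cast
      rfl
    rw [this, Complex.norm_real, Real.norm_eq_abs, abs_mul, abs_pow]
  have h2 : 1 ≤ (|(d : ℝ)| ^ E * |(γ : ℝ)|) * (H * M ^ E) ^ (n - 1) := by
    calc (1 : ℝ) ≤ ∏ φ : K →ₐ[ℚ] ℂ, ‖φ δ‖ := h1
      _ = ‖φ₀ δ‖ * ∏ φ ∈ Finset.univ.erase φ₀, ‖φ δ‖ := (Finset.mul_prod_erase _ _ (Finset.mem_univ _)).symm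
      _ ≤ ‖φ₀ δ‖ * (H * M ^ E) ^ (n - 1) := by
        apply mul_le_mul_of_nonneg_left _ (norm_nonneg _)
        calc ∏ φ ∈ Finset.univ.erase φ₀, ‖φ δ‖ ≤ ∏ φ ∈ Finset.univ.erase φ₀, (H * M ^ E) :=
              Finset.prod_le_prod (fun _ _ => norm_nonneg _) (fun φ _ => hbd φ)
          _ = _ := by
            rw [Finset.prod_const, Finset.card_erase_of_mem (Finset.mem_univ _), Finset.card_univ]
      _ = _ := by rw [hφ₀]
  have h3 : |(d : ℝ)| ^ E ≤ H * M ^ E := by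
    have : |(d : ℝ)| ≤ M := by rw [hM]; nlinarith [abs_nonneg (d : ℝ)]
    calc |(d : ℝ)| ^ E ≤ M ^ E := by gcongr
      _ ≤ H * M ^ E := by nlinarith [one_le_pow₀ (n := E) hM1]
  have h4 : 1 ≤ |(γ : ℝ)| * (H * M ^ E) ^ n := by
    calc (1 : ℝ) ≤ _ := h2
      _ ≤ ((H * M ^ E) * |(γ : ℝ)|) * (H * M ^ E) ^ (n - 1) := by gcongr
      _ = |(γ : ℝ)| * ((H * M ^ E) ^ (n - 1) * (H * M ^ E)) := by ring
      _ = _ := by rw [← pow_succ, Nat.sub_add_cancel hn1]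
  have h5 : (H * M ^ E) ^ n = Real.exp (n * (Real.log H + E * Real.log M)) := by
    rw [Real.exp_nat_mul, Real.exp_add, Real.exp_log (by linarith), Real.exp_nat_mul, Real.exp_log (by linarith)]
  rw [h5] at h4
  have h6 : Real.exp (-(n * (Real.log H + E * Real.log M))) ≤ |(γ : ℝ)| := by
    rw [Real.exp_neg, inv_le_iff_one_le_mul₀ (Real.exp_pos _)]
    exact h4
  refine le_trans ?_ h6
  apply Real.exp_le_exp.mpr
  have hlH : 0 ≤ Real.log H := Real.log_nonneg hH
  have hE : (0 : ℝ) ≤ E := Nat.cast_nonneg _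
  have : Real.log H + E * Real.log M ≤ (1 + Real.log M) * (E + Real.log H) := by nlinarith [mul_nonneg hlM hlH]
  nlinarith

lemma rolle_aux (a b : ℝ) (n : ℕ) : ∀ (g : ℝ → ℝ), ContDiff ℝ ⊤ g → ∀ s : Finset ℝ, s.card = n + 1 →
    (∀ t ∈ s, a ≤ t ∧ t ≤ b) → (∀ t ∈ s, g t = 0) → ∃ η, a ≤ η ∧ η ≤ b ∧ iteratedDeriv n g η = 0 := by
  induction n with
  | zero =>
    intro g _ s hs hab hg
    obtain ⟨t, rfl⟩ := Finset.card_eq_one.mp hs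
    exact ⟨t, (hab t (by simp)).1, (hab t (by simp)).2, by simpa using hg t (by simp)⟩
  | succ n ih =>
    intro g hgc s hs hab hg
    let t := s.orderEmbOfFin hs
    have hts : ∀ i, t i ∈ s := fun i => Finset.orderEmbOfFin_mem s hs i
    have hlt : ∀ i : Fin (n + 1), t i.castSucc < t i.succ := fun i => t.strictMono (Fin.castSucc_lt_succ)
    have hex : ∀ i : Fin (n + 1), ∃ ξ ∈ Set.Ioo (t i.castSucc) (t i.succ), deriv g ξ = 0 := by
      intro i
      apply exists_deriv_eq_zero (hlt i) hgc.continuous.continuousOn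
      rw [hg _ (hts _), hg _ (hts _)]
    choose ξ hξ hξ0 using hex
    have hmono : StrictMono ξ := by
      intro i j hij
      have h1 := (hξ i).2
      have h2 := (hξ j).1
      have : t i.succ ≤ t j.castSucc := t.monotone (by
        rw [Fin.le_def]; simp; exact hij)
      linarith
    obtain ⟨η, h1, h2, h3⟩ := ih (deriv g) (ContDiff.deriv' (hgc)) (Finset.univ.image ξ)
      (by rw [Finset.card_image_of_injective _ hmono.injective]; simp)
      (by
        intro x hx
        obtain ⟨i, _, rfl⟩ := Finset.mem_image.mp hx
        exact ⟨(hab _ (hts _)).1.trans (hξ i).1.le, (hξ i).2.le.trans (hab _ (hts _)).2⟩)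
      (by
        intro x hx
        obtain ⟨i, _, rfl⟩ := Finset.mem_image.mp hx
        exact hξ0 i)
    exact ⟨η, h1, h2, by rw [iteratedDeriv_succ']; exact h3⟩

open Polynomial in
lemma dd_exp_bound {κ : Type} [DecidableEq κ] (s : Finset κ) (v : κ → ℝ) (hv : Set.InjOn v s) (n : ℕ) (hs : s.card = n + 1)
    (a b : ℝ) (hab : ∀ t ∈ s, a ≤ v t ∧ v t ≤ b) (lam : ℝ) :
    ∃ η, a ≤ η ∧ η ≤ b ∧ ∑ t ∈ s, Real.exp (lam * v t) / ∏ r ∈ s.erase t, (v t - v r) =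
      lam ^ n * Real.exp (lam * η) / n.factorial := by
  set p := Lagrange.interpolate s v (fun t => Real.exp (lam * v t)) with hp
  have hdeg : p.degree < s.card := Lagrange.degree_interpolate_lt _ hv
  have hnd : p.natDegree ≤ n := by
    rw [hs] at hdeg
    rw [Polynomial.degree_lt_iff_coeff_zero] at hdeg
    rw [Polynomial.natDegree_le_iff_coeff_eq_zero]
    intro m hm
    exact hdeg m hm
  have hpc : ContDiff ℝ ⊤ (fun t => p.eval t) := by
    simpa using p.contDiff_aeval (𝕜 := ℝ) ⊤
  have hev : ∀ t ∈ s, p.eval (v t) = Real.exp (lam * v t) := fun t ht =>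
    Lagrange.eval_interpolate_at_node _ hv ht
  have hcoeff : p.coeff n = ∑ t ∈ s, Real.exp (lam * v t) / ∏ r ∈ s.erase t, (v t - v r) := by
    have := Lagrange.coeff_eq_sum hv hdeg
    rw [hs] at this
    simp only [Nat.add_sub_cancel] at this
    rw [this]
    exact Finset.sum_congr rfl fun t ht => by rw [hev t ht]
  obtain ⟨η, h1, h2, h3⟩ := rolle_aux a b n (fun t => Real.exp (lam * t) - p.eval t)
    (by
      apply ContDiff.sub
      · fun_prop
      · exact hpc) (s.image v) (by rw [Finset.card_image_of_injOn hv, hs])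
    (by intro x hx; obtain ⟨t, ht, rfl⟩ := Finset.mem_image.mp hx; exact hab t ht)
    (by intro x hx; obtain ⟨t, ht, rfl⟩ := Finset.mem_image.mp hx; simp [hev t ht])
  refine ⟨η, h1, h2, ?_⟩
  have hd1 : iteratedDeriv n (fun t => Real.exp (lam * t) - p.eval t) η =
      lam ^ n * Real.exp (lam * η) - n.factorial * p.coeff n := by
    have hA : iteratedDeriv n (fun t => Real.exp (lam * t)) η = lam ^ n * Real.exp (lam * η) := by
      rw [iteratedDeriv_exp_const_mul]
    have hB : iteratedDeriv n (fun t => p.eval t) η = n.factorial * p.coeff n := by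
      have h5 : ∀ m, iteratedDeriv m (fun t => p.eval t) = fun t => (derivative^[m] p).eval t := by
        intro m
        induction m with
        | zero => simp
        | succ m ih =>
          rw [iteratedDeriv_succ, ih]
          funext t
          rw [Polynomial.deriv, Function.iterate_succ_apply']
      rw [h5]
      have h6 : (derivative^[n] p).natDegree ≤ 0 := by
        have := Polynomial.natDegree_iterate_derivative p n
        omega
      rw [Polynomial.eq_C_of_natDegree_le_zero h6]
      simp [Polynomial.coeff_iterate_derivative, Nat.descFactorial_self]
    rw [← hA, ← hB]
    exact iteratedDeriv_fun_sub (by fun_prop) ((hpc.of_le le_top).contDiffAt)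
  rw [hd1] at h3
  rw [← hcoeff]
  have : (n.factorial : ℝ) ≠ 0 := by positivity
  field_simp
  linarith

open Polynomial in
lemma zero_est (q ℓ k : ℕ) (hℓ : ℓ < q) (hk : 1 ≤ k) (x : ℝ) (hx : x ≠ 1) (f : (Σ _ : ℕ, ℕ) → ℝ)
    (hf : ∀ j h, f ⟨j, h + 1⟩ = x * f ⟨j, h⟩) (hf0 : f ⟨0, 0⟩ ≠ 0) (v : (Σ _ : ℕ, ℕ) → ℝ) (hv : ∀ s, v s = q * s.2 + s.1)
    (hinj : ∀ K : ℕ → ℕ, Set.InjOn v ((Finset.range (ℓ + 1)).sigma (fun j => Finset.range (K j)) : Finset (Σ _ : ℕ, ℕ)))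
    (T : ℕ → Finset (Σ _ : ℕ, ℕ)) (hT : ∀ i, T i = (Finset.range (ℓ + 1)).sigma (fun j => Finset.range (if j = i then k + 1 else k))) :
    ∃ i ≤ ℓ, ∑ t ∈ T i, f t / ∏ r ∈ (T i).erase t, (v t - v r) ≠ 0 := by
  by_contra! hcon
  set S : Finset (Σ _ : ℕ, ℕ) := (Finset.range (ℓ + 1)).sigma (fun j => Finset.range k) with hS
  have hcS : S.card = (ℓ + 1) * k := by simp [hS]
  have hinjS : Set.InjOn v S := hinj (fun _ => k)
  set p := Lagrange.interpolate S v f with hp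
  have hdegp : p.degree < S.card := Lagrange.degree_interpolate_lt _ hinjS
  have hevS : ∀ t ∈ S, p.eval (v t) = f t := fun t ht => Lagrange.eval_interpolate_at_node _ hinjS ht
  have hST : ∀ i, S ⊆ T i := by
    intro i t ht
    rw [hT]
    simp only [hS, Finset.mem_sigma, Finset.mem_range] at ht ⊢
    refine ⟨ht.1, ?_⟩
    split_ifs <;> omega
  have hevT : ∀ i ≤ ℓ, p.eval (v ⟨i, k⟩) = f ⟨i, k⟩ := by
    intro i hi
    have hinjT : Set.InjOn v (T i) := by rw [hT]; exact hinj _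
    have hcT : (T i).card = (ℓ + 1) * k + 1 := by
      rw [hT, Finset.card_sigma]
      simp only [Finset.card_range]
      have : ∀ j, (if j = i then k + 1 else k) = k + (if j = i then 1 else 0) := by intro j; split_ifs <;> rfl
      simp only [this, Finset.sum_add_distrib]
      rw [Finset.sum_ite_eq']
      simp [hi]
    set P := Lagrange.interpolate (T i) v f with hP
    have hdegP : P.degree < (T i).card := Lagrange.degree_interpolate_lt _ hinjT
    have hevT : ∀ t ∈ T i, P.eval (v t) = f t := fun t ht => Lagrange.eval_interpolate_at_node _ hinjT ht
    have hc : P.coeff ((ℓ + 1) * k) = 0 := by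
      have := Lagrange.coeff_eq_sum hinjT hdegP
      rw [hcT] at this
      simp only [Nat.add_sub_cancel] at this
      rw [this, ← hcon i hi]
      exact Finset.sum_congr rfl fun t ht => by rw [hevT t ht]
    have hdegP' : P.degree < S.card := by
      rw [hcS]
      rw [hcT] at hdegP
      rw [Polynomial.degree_lt_iff_coeff_zero] at hdegP ⊢
      intro m hm
      rcases Nat.eq_or_lt_of_le hm with h | h
      · rw [← h]; exact hc
      · exact hdegP m h
    have hPp : P = p := Lagrange.eq_interpolate_of_eval_eq _ hinjS hdegP' (fun t ht => hevT t (hST i ht))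
    rw [← hPp]
    apply hevT
    rw [hT]
    simp [hi]
  have hshift : ∀ t ∈ S, p.eval (v t + q) = x * p.eval (v t) := by
    rintro ⟨j, h⟩ ht
    have ht' := ht
    simp only [hS, Finset.mem_sigma, Finset.mem_range] at ht'
    have e1 : v ⟨j, h⟩ + q = v ⟨j, h + 1⟩ := by rw [hv, hv]; push_cast; ring
    rw [e1, hevS _ ht, ← hf]
    by_cases hh : h + 1 < k
    · exact hevS _ (by simp [hS]; omega)
    · have : h + 1 = k := by omega
      rw [this]
      exact hevT j (by omega)
  have hdc : (p.comp (X + C (q : ℝ))).degree = p.degree := by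
    have : p.comp (X + C (q : ℝ)) = Polynomial.taylor (q : ℝ) p := rfl
    rw [this, Polynomial.degree_taylor]
  have hz : p.comp (X + C (q : ℝ)) = C x * p := by
    refine Polynomial.eq_of_degrees_lt_of_eval_index_eq (s := S) (v := v) hinjS ?_ ?_ ?_
    · rw [hdc]; exact hdegp
    · exact lt_of_le_of_lt (by rw [← Polynomial.smul_eq_C_mul]; exact Polynomial.degree_smul_le _ _) hdegp
    · intro t ht
      simp only [eval_comp, eval_add, eval_X, eval_C, eval_mul]
      exact hshift t ht
  have hlc : p.leadingCoeff = x * p.leadingCoeff := by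
    have h1 : (Polynomial.taylor (q : ℝ) p).leadingCoeff = p.leadingCoeff := Polynomial.leadingCoeff_taylor _ _
    have h2 : Polynomial.taylor (q : ℝ) p = C x * p := hz
    rw [h2] at h1
    rw [Polynomial.leadingCoeff_mul, Polynomial.leadingCoeff_C] at h1
    exact h1.symm
  have hp0 : p = 0 := by
    rw [← Polynomial.leadingCoeff_eq_zero]
    have : (1 - x) * p.leadingCoeff = 0 := by linarith
    rcases mul_eq_zero.mp this with h | h
    · exact absurd (by linarith) hx
    · exact h
  have := hevS ⟨0, 0⟩ (by simp [hS]; omega)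
  rw [hp0] at this
  simp at this
  exact hf0 this.symm

open Nat Chebyshev in
lemma blk_diff (q M : ℕ) (K : ℕ) : ∀ A : ℤ, (∀ h < K + 1, A - q * (h : ℕ) ≠ 0 ∧ |A - q * (h : ℕ)| ≤ M) →
    ∃ z : ℤ, |z| ≤ 2 ^ K * lcmUpto M ∧
      z * ∏ h ∈ Finset.range (K + 1), (A - q * (h : ℕ)) = K.factorial * q ^ K * lcmUpto M := by
  induction K with
  | zero =>
    intro A hA
    have h0 := hA 0 (by norm_num)
    simp only [Nat.cast_zero, mul_zero, sub_zero] at h0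
    have hdvd : A ∣ (lcmUpto M : ℤ) := by
      rw [← Int.natAbs_dvd, Int.natCast_dvd_natCast]
      apply Finset.dvd_lcm (f := id) (b := A.natAbs)
      rw [Finset.mem_Icc]
      have := h0.1
      have h02 := h0.2
      rw [abs_le] at h02
      constructor <;> omega
    obtain ⟨z, hz⟩ := hdvd
    refine ⟨z, ?_, ?_⟩
    · simp only [pow_zero, one_mul]
      have h1 : (lcmUpto M : ℤ) = |A| * |z| := by
        rw [← abs_mul, ← hz]; simp
      rw [h1]
      have := Int.one_le_abs h0.1
      nlinarith [abs_nonneg z]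
    · simp [hz, mul_comm]
  | succ K ih =>
    intro A hA
    obtain ⟨z1, hz1, e1⟩ := ih A (fun h hh => hA h (by omega))
    obtain ⟨z2, hz2, e2⟩ := ih (A - q) (fun h hh => by
      have := hA (h + 1) (by omega)
      have e : A - q - q * (h : ℤ) = A - q * ((h + 1 : ℕ) : ℤ) := by push_cast; ring
      rw [e]; exact this)
    refine ⟨z2 - z1, ?_, ?_⟩
    · calc |z2 - z1| ≤ |z2| + |z1| := abs_sub _ _
        _ ≤ 2 ^ K * lcmUpto M + 2 ^ K * lcmUpto M := add_le_add hz2 hz1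
        _ = _ := by ring
    · have p1 : ∏ h ∈ Finset.range (K + 1 + 1), (A - q * (h : ℕ)) =
          (∏ h ∈ Finset.range (K + 1), (A - q * (h : ℕ))) * (A - q * (K + 1 : ℕ)) :=
        Finset.prod_range_succ _ _
      have p2 : ∏ h ∈ Finset.range (K + 1 + 1), (A - q * (h : ℕ)) =
          (∏ h ∈ Finset.range (K + 1), (A - q - q * (h : ℕ))) * A := by
        rw [Finset.prod_range_succ']
        simp only [Nat.cast_zero, mul_zero, sub_zero]
        congr 1
        apply Finset.prod_congr rfl
        intros; push_cast; ring
      rw [sub_mul]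
      nth_rewrite 1 [p2]
      rw [p1, ← mul_assoc, ← mul_assoc, e1, e2, Nat.factorial_succ]
      push_cast
      ring

lemma blk_same (q h : ℕ) (n : ℕ) : ∃ z : ℤ, |z| = (h + n).choose h ∧
      z * ∏ r ∈ Finset.range (h + n + 1), (if r = h then 1 else ((q : ℤ) * h - q * r)) =
        (h + n).factorial * q ^ (h + n) := by
  induction n with
  | zero =>
    refine ⟨1, by simp, ?_⟩
    rw [add_zero, Finset.prod_range_succ]
    simp only [if_true, mul_one, one_mul]
    have h1 : ∀ r ∈ Finset.range h, (if r = h then (1 : ℤ) else ((q : ℤ) * h - q * r)) = q * ((h - r : ℕ) : ℤ) := by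
      intro r hr
      rw [Finset.mem_range] at hr
      rw [if_neg (by omega)]
      push_cast [hr.le]
      ring
    rw [Finset.prod_congr rfl h1, Finset.prod_mul_distrib]
    simp only [Finset.prod_const, Finset.card_range]
    have : ∏ r ∈ Finset.range h, (((h - r : ℕ)) : ℤ) = (h.factorial : ℤ) := by
      rw [← Finset.prod_range_reflect, ← Finset.prod_range_add_one_eq_factorial]
      push_cast
      apply Finset.prod_congr rfl
      intro r hr
      rw [Finset.mem_range] at hr
      have : h - (h - 1 - r) = r + 1 := by omega
      rw [this]; push_cast; ring
    rw [this]; ring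
  | succ n ih =>
    obtain ⟨z, hz, e⟩ := ih
    have hc := Nat.choose_mul_succ_eq (h + n) h
    have hsub : h + n + 1 - h = n + 1 := by omega
    rw [hsub] at hc
    have hfull : ∃ z' : ℤ, |z'| = (h + n + 1).choose h ∧ z' * (n + 1) = - (z * (h + n + 1)) := by
      rcases abs_choice z with hh | hh
      · refine ⟨-((h + n + 1).choose h), by simp, ?_⟩
        rw [hh] at hz
        rw [hz]
        have : (((h + n).choose h : ℕ) : ℤ) * (h + n + 1) = ((h + n + 1).choose h : ℕ) * (n + 1) := by exact_mod_cast hc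
        linarith
      · refine ⟨((h + n + 1).choose h), by simp, ?_⟩
        rw [hh] at hz
        have hz' : z = -((h + n).choose h : ℕ) := by linarith
        rw [hz']
        have : (((h + n).choose h : ℕ) : ℤ) * (h + n + 1) = ((h + n + 1).choose h : ℕ) * (n + 1) := by exact_mod_cast hc
        linarith
    obtain ⟨z', hz', e'⟩ := hfull
    refine ⟨z', hz', ?_⟩
    rw [show h + (n + 1) + 1 = (h + n + 1) + 1 by ring, Finset.prod_range_succ, if_neg (by omega)]
    have e3 : ((q : ℤ) * h - q * ((h + n + 1 : ℕ) : ℤ)) = - (q * (n + 1)) := by push_cast; ring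
    rw [e3, show h + (n + 1) = (h + n) + 1 by ring, Nat.factorial_succ]
    set P := ∏ r ∈ Finset.range (h + n + 1), (if r = h then 1 else ((q : ℤ) * h - q * r))
    calc z' * (P * -(q * (n + 1))) = - (z' * (n + 1)) * P * q := by ring
      _ = (z * P) * (h + n + 1) * q := by rw [e']; ring
      _ = _ := by rw [e]; push_cast; ring

open Nat Chebyshev in
lemma blk_lift (q k K Lc : ℕ) (hq : 1 ≤ q) (hk : 1 ≤ k) (hK : K = k ∨ K + 1 = k) (P : ℤ)
    (hz : ∃ z : ℤ, |z| ≤ 2 ^ K * Lc ∧ z * P = K.factorial * q ^ K * Lc) :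
    ∃ z : ℤ, |z| ≤ 4 ^ k * q * Lc ∧ z * P = k.factorial * q ^ k * Lc := by
  obtain ⟨z, hz, e⟩ := hz
  have hq' : (1 : ℤ) ≤ q := by exact_mod_cast hq
  have hL : (0 : ℤ) ≤ Lc := by positivity
  rcases hK with rfl | rfl
  · refine ⟨z, hz.trans ?_, e⟩
    have : (2 : ℤ) ^ K ≤ 4 ^ K := pow_le_pow_left₀ (by norm_num) (by norm_num) _
    have h2 : (2 : ℤ) ^ K ≤ 4 ^ K * q := by nlinarith [pow_pos (show (0:ℤ) < 4 by norm_num) K]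
    exact mul_le_mul_of_nonneg_right h2 hL
  · refine ⟨z * ((K + 1) * q), ?_, ?_⟩
    · rw [abs_mul, abs_of_nonneg (a := ((K : ℤ) + 1) * q) (by positivity)]
      have h1 : ((K : ℤ) + 1) ≤ 2 ^ (K + 1) := by exact_mod_cast Nat.lt_two_pow_self.le
      have h3 : (2 : ℤ) ^ K ≤ 2 ^ (K + 1) := pow_le_pow_right₀ (by norm_num) (by omega)
      calc |z| * (((K : ℤ) + 1) * q) ≤ (2 ^ (K + 1) * Lc) * (2 ^ (K + 1) * q) := by
            apply mul_le_mul
            · exact hz.trans (mul_le_mul_of_nonneg_right h3 hL)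
            · exact mul_le_mul_of_nonneg_right h1 (by positivity)
            · positivity
            · positivity
        _ = _ := by
          rw [show (4 : ℤ) = 2 * 2 by norm_num, mul_pow]; ring
    · rw [Nat.factorial_succ]
      push_cast
      calc z * ((K + 1) * q) * P = (z * P) * ((K + 1) * q) := by ring
        _ = _ := by rw [e]; ring

open Nat Chebyshev in
lemma weights (q ℓ k i : ℕ) (hℓ : ℓ < q) (hk : 1 ≤ k) (v : (Σ _ : ℕ, ℕ) → ℝ) (hv : ∀ s, v s = q * s.2 + s.1)
    (T : Finset (Σ _ : ℕ, ℕ)) (hT : T = (Finset.range (ℓ + 1)).sigma (fun j => Finset.range (if j = i then k + 1 else k)))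
    (s : Σ _ : ℕ, ℕ) (hs : s ∈ T) :
    ∃ z : ℤ, |(z : ℝ)| ≤ (4 ^ k * q * lcmUpto (q * (k + 1))) ^ (ℓ + 1) ∧
      (z : ℝ) * ∏ t ∈ T.erase s, (v s - v t) = (k.factorial * q ^ k * lcmUpto (q * (k + 1))) ^ (ℓ + 1) := by
  set Lc := lcmUpto (q * (k + 1)) with hLc
  have hLc1 : 1 ≤ Lc := lcmUpto_pos _
  have hs' : s.1 < ℓ + 1 ∧ s.2 < (if s.1 = i then k + 1 else k) := by
    rw [hT, Finset.mem_sigma] at hs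
    simpa using hs
  have hs2 : s.2 ≤ k := by have := hs'.2; split_ifs at this <;> omega
  have hblk : ∀ j < ℓ + 1, ∃ z : ℤ, |z| ≤ 4 ^ k * q * Lc ∧
      z * ∏ h ∈ Finset.range (if j = i then k + 1 else k),
        (if (⟨j, h⟩ : Σ _ : ℕ, ℕ) = s then 1 else ((q * s.2 + s.1 - (q * h + j) : ℤ))) = k.factorial * q ^ k * Lc := by
    intro j hj
    obtain ⟨K, hK, hKk⟩ : ∃ K, (if j = i then k + 1 else k) = K + 1 ∧ (K = k ∨ K + 1 = k) := by
      split_ifs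
      · exact ⟨k, rfl, Or.inl rfl⟩
      · exact ⟨k - 1, by omega, Or.inr (by omega)⟩
    rw [hK]
    apply blk_lift q k K Lc (by omega) hk hKk
    by_cases hjs : j = s.1
    · have hh : s.2 ≤ K := by
        have := hs'.2
        rw [← hjs, hK] at this
        omega
      obtain ⟨z, hz, e⟩ := blk_same q s.2 (K - s.2)
      rw [show s.2 + (K - s.2) = K by omega] at hz e
      refine ⟨z * Lc, ?_, ?_⟩
      · rw [abs_mul, hz]
        simp only [Nat.abs_cast]
        have : K.choose s.2 ≤ 2 ^ K := Nat.choose_le_two_pow _ _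
        have h2 : ((K.choose s.2 : ℕ) : ℤ) ≤ 2 ^ K := by exact_mod_cast this
        exact mul_le_mul_of_nonneg_right h2 (by positivity)
      · rw [← e]
        have : ∏ h ∈ Finset.range (K + 1), (if (⟨j, h⟩ : Σ _ : ℕ, ℕ) = s then 1 else ((q * s.2 + s.1 - (q * h + j) : ℤ)))
          = ∏ r ∈ Finset.range (K + 1), (if r = s.2 then 1 else ((q : ℤ) * s.2 - q * r)) := by
          apply Finset.prod_congr rfl
          intro r _
          have : ((⟨j, r⟩ : Σ _ : ℕ, ℕ) = s) ↔ r = s.2 := by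
            obtain ⟨s1, s2⟩ := s
            simp at hjs
            simp [hjs]
          by_cases hr : r = s.2
          · rw [if_pos (this.mpr hr), if_pos hr]
          · rw [if_neg (fun h => hr (this.mp h)), if_neg hr, hjs]
            ring
        rw [this]; ring
    · obtain ⟨z, hz, e⟩ := blk_diff q (q * (k + 1)) K (q * s.2 + s.1 - j) (by
        intro h hh
        have hhk : h ≤ k := by omega
        have hab : |(s.2 : ℤ) - h| ≤ k := by rw [abs_le]; constructor <;> omega
        have hne : (s.1 : ℤ) - j ≠ 0 := by omega
        have hjj : |(s.1 : ℤ) - j| < q := by rw [abs_lt]; constructor <;> omega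
        have e : (q * s.2 + s.1 - j : ℤ) - q * h = q * (s.2 - h) + (s.1 - j) := by ring
        rw [e]
        constructor
        · intro h0
          have hdvd : (q : ℤ) ∣ (s.1 : ℤ) - j := ⟨-(s.2 - h), by linarith⟩
          exact hne (Int.eq_zero_of_abs_lt_dvd hdvd hjj)
        · calc |(q : ℤ) * (s.2 - h) + (s.1 - j)| ≤ |(q : ℤ) * (s.2 - h)| + |(s.1 : ℤ) - j| := abs_add_le _ _
            _ ≤ q * k + q := by
              rw [abs_mul, Nat.abs_cast]
              have : (q : ℤ) * |(s.2 : ℤ) - h| ≤ q * k := mul_le_mul_of_nonneg_left hab (by positivity)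
              linarith
            _ = _ := by push_cast; ring)
      refine ⟨z, hz, ?_⟩
      rw [← e]
      congr 1
      apply Finset.prod_congr rfl
      intro r _
      rw [if_neg]
      · ring
      · rintro rfl; exact hjs rfl
  choose! z hz e using hblk
  refine ⟨∏ j ∈ Finset.range (ℓ + 1), z j, ?_, ?_⟩
  · push_cast
    rw [Finset.abs_prod]
    calc ∏ j ∈ Finset.range (ℓ + 1), |(z j : ℝ)| ≤ ∏ j ∈ Finset.range (ℓ + 1), (4 ^ k * q * Lc : ℝ) := by
          apply Finset.prod_le_prod
          · intros; positivity
          · intro j hj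
            have := hz j (Finset.mem_range.mp hj)
            exact_mod_cast this
      _ = _ := by simp
  · have h1 : ∏ t ∈ T.erase s, (v s - v t) = ∏ t ∈ T, (if t = s then 1 else (v s - v t)) := by
      rw [← Finset.mul_prod_erase T _ hs, if_pos rfl, one_mul]
      apply Finset.prod_congr rfl
      intro t ht
      rw [if_neg (Finset.ne_of_mem_erase ht)]
    have h2 : ∏ t ∈ T, (if t = s then 1 else (v s - v t)) = ((∏ j ∈ Finset.range (ℓ + 1),
        ∏ h ∈ Finset.range (if j = i then k + 1 else k),
        (if (⟨j, h⟩ : Σ _ : ℕ, ℕ) = s then 1 else ((q * s.2 + s.1 - (q * h + j) : ℤ))) : ℤ) : ℝ) := by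
      rw [hT, Finset.prod_sigma]
      push_cast
      apply Finset.prod_congr rfl
      intro j _
      apply Finset.prod_congr rfl
      intro h _
      split_ifs
      · rfl
      · rw [hv, hv]
    rw [h1, h2, ← Int.cast_mul, ← Finset.prod_mul_distrib]
    rw [Finset.prod_congr rfl (fun j hj => e j (Finset.mem_range.mp hj))]
    simp

lemma v_inj (q ℓ : ℕ) (hℓ : ℓ < q) (v : (Σ _ : ℕ, ℕ) → ℝ) (hv : ∀ s, v s = q * s.2 + s.1) (K : ℕ → ℕ) :
    Set.InjOn v ((Finset.range (ℓ + 1)).sigma (fun j => Finset.range (K j)) : Finset (Σ _ : ℕ, ℕ)) := by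
  rintro ⟨j, h⟩ h1 ⟨j', h'⟩ h2 heq
  simp only [Finset.coe_sigma, Set.mem_sigma_iff, Finset.coe_range, Set.mem_Iio] at h1 h2
  rw [hv, hv] at heq
  have e : q * h + j = q * h' + j' := by exact_mod_cast heq
  have hj : j < q := by omega
  have hj' : j' < q := by omega
  have e1 : j = j' := by
    have := congrArg (· % q) e
    simpa [Nat.mul_add_mod, Nat.mod_eq_of_lt hj, Nat.mod_eq_of_lt hj'] using this
  subst e1
  have e2 : h = h' := by
    have : q * h = q * h' := by omega
    exact Nat.eq_of_mul_eq_mul_left (by omega) this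
  subst e2
  rfl

open Nat in
lemma pade (q ℓ : ℕ) (hℓ : ℓ < q) : ∃ C : ℝ, 0 ≤ C ∧ ∀ k : ℕ, 1 ≤ k → ∀ x w : ℝ, 0 < x → x ≠ 1 →
    |Real.log x| ≤ 1 → ∃ (T : Finset (Σ _ : ℕ, ℕ)) (Z : (Σ _ : ℕ, ℕ) → ℤ),
      (∀ s ∈ T, s.1 ≤ ℓ ∧ s.2 ≤ k) ∧ ∑ s ∈ T, |(Z s : ℝ)| ≤ Real.exp (C * k) ∧
      ∑ s ∈ T, (Z s : ℝ) * (x ^ s.2 * w ^ s.1) ≠ 0 ∧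
      |∑ s ∈ T, (Z s : ℝ) * Real.exp (Real.log x / q * (q * s.2 + s.1))| ≤
        Real.exp (C * k) * |Real.log x| ^ ((ℓ + 1) * k) := by
  set c0 : ℝ := Real.log 4 + 4 with hc0
  have hc0p : 0 ≤ c0 := by have := Real.log_nonneg (show (1 : ℝ) ≤ 4 by norm_num); linarith
  set g : ℝ := 2 + q + 2 * q * c0 with hg
  have hgp : 0 ≤ g := by positivity
  refine ⟨(ℓ + 1) * g + ((ℓ + 1) + 2), by positivity, ?_⟩
  intro k hk x w hx hx1 hlx
  have hq1 : 1 ≤ q := by omega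
  have hqR : (1 : ℝ) ≤ q := by exact_mod_cast hq1
  have hkR : (1 : ℝ) ≤ k := by exact_mod_cast hk
  set Lc := lcmUpto (q * (k + 1)) with hLc
  have hLcpos : (0 : ℝ) < Lc := by exact_mod_cast lcmUpto_pos _
  have hLcle : (Lc : ℝ) ≤ Real.exp (2 * q * c0 * k) := by
    have h1 := Chebyshev.psi_le_const_mul_self (x := ((q * (k + 1) : ℕ) : ℝ)) (by positivity)
    rw [Chebyshev.psi_eq_log_lcmUpto] at h1
    rw [← Real.exp_log hLcpos]
    apply Real.exp_le_exp.mpr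
    refine h1.trans ?_
    push_cast
    have : (q : ℝ) * (k + 1) ≤ q * (2 * k) := by
      apply mul_le_mul_of_nonneg_left _ (by positivity); linarith
    calc c0 * (q * (k + 1)) ≤ c0 * (q * (2 * k)) := mul_le_mul_of_nonneg_left this hc0p
      _ = _ := by ring
  set v : (Σ _ : ℕ, ℕ) → ℝ := fun s => q * s.2 + s.1 with hvdef
  have hv : ∀ s, v s = q * s.2 + s.1 := fun s => rfl
  set f : (Σ _ : ℕ, ℕ) → ℝ := fun s => x ^ s.2 * w ^ s.1 with hfdef
  set T : ℕ → Finset (Σ _ : ℕ, ℕ) := fun i =>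
    (Finset.range (ℓ + 1)).sigma (fun j => Finset.range (if j = i then k + 1 else k)) with hTdef
  obtain ⟨i, hi, hne⟩ := zero_est q ℓ k hℓ hk x hx1 f (by intro j h; simp only [hfdef]; ring) (by simp [hfdef])
    v hv (v_inj q ℓ hℓ v hv) T (fun i => rfl)
  have hwt := weights q ℓ k i hℓ hk v hv (T i) rfl
  choose! Z hZ1 hZ2 using hwt
  have hinjT : Set.InjOn v (T i) := v_inj q ℓ hℓ v hv _
  have hcT : (T i).card = (ℓ + 1) * k + 1 := by
    simp only [hTdef]
    rw [Finset.card_sigma]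
    simp only [Finset.card_range]
    have : ∀ j, (if j = i then k + 1 else k) = k + (if j = i then 1 else 0) := by intro j; split_ifs <;> rfl
    simp only [this, Finset.sum_add_distrib]
    rw [Finset.sum_ite_eq']
    simp [hi]
  have hmem : ∀ s ∈ T i, s.1 ≤ ℓ ∧ s.2 ≤ k := by
    intro s hs
    simp only [hTdef, Finset.mem_sigma, Finset.mem_range] at hs
    refine ⟨by omega, ?_⟩
    have := hs.2
    split_ifs at this <;> omega
  set D : ℝ := (k ! * q ^ k * Lc) ^ (ℓ + 1) with hD
  have hDpos : 0 < D := by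
    have : (0 : ℝ) < q := by linarith
    positivity
  have hkey : ∀ F : (Σ _ : ℕ, ℕ) → ℝ, ∑ s ∈ T i, (Z s : ℝ) * F s =
      D * ∑ s ∈ T i, F s / ∏ r ∈ (T i).erase s, (v s - v r) := by
    intro F
    rw [Finset.mul_sum]
    apply Finset.sum_congr rfl
    intro s hs
    have h2 := hZ2 s hs
    have hP : ∏ r ∈ (T i).erase s, (v s - v r) ≠ 0 := by
      intro h0
      rw [h0, mul_zero] at h2
      exact hDpos.ne h2
    rw [← h2]
    field_simp
  have h4 : (4 : ℝ) ≤ Real.exp 2 := by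
    have := Real.add_one_le_exp (1 : ℝ)
    have h2 : Real.exp 2 = Real.exp 1 * Real.exp 1 := by rw [← Real.exp_add]; norm_num
    rw [h2]; nlinarith
  have hqe : (q : ℝ) ≤ Real.exp q := by have := Real.add_one_le_exp (q : ℝ); linarith
  have hG : (4 ^ k * q * Lc : ℝ) ≤ Real.exp (g * k) := by
    calc (4 ^ k * q * Lc : ℝ) ≤ Real.exp 2 ^ k * Real.exp (q * k) * Real.exp (2 * q * c0 * k) := by
          have : Real.exp q ≤ Real.exp (q * k) := Real.exp_le_exp.mpr (by nlinarith)
          gcongr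
          exact hqe.trans this
      _ = _ := by
        rw [← Real.exp_nat_mul, ← Real.exp_add, ← Real.exp_add, hg]; congr 1; ring
  have hG2 : (q ^ k * Lc : ℝ) ≤ Real.exp (g * k) := by
    calc (q ^ k * Lc : ℝ) ≤ Real.exp q ^ k * Real.exp (2 * q * c0 * k) := by gcongr
      _ ≤ _ := by
        rw [← Real.exp_nat_mul, ← Real.exp_add, hg]
        apply Real.exp_le_exp.mpr; nlinarith
  refine ⟨T i, Z, hmem, ?_, ?_, ?_⟩
  · calc ∑ s ∈ T i, |(Z s : ℝ)| ≤ ∑ s ∈ T i, (Real.exp (g * k)) ^ (ℓ + 1) := by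
          apply Finset.sum_le_sum
          intro s hs
          exact (hZ1 s hs).trans (pow_le_pow_left₀ (by positivity) hG _)
      _ = (((ℓ + 1) * k + 1 : ℝ)) * (Real.exp (g * k)) ^ (ℓ + 1) := by
        rw [Finset.sum_const, hcT, nsmul_eq_mul]; push_cast; ring
      _ ≤ Real.exp ((ℓ + 1) * k) * (Real.exp (g * k)) ^ (ℓ + 1) := by
        gcongr
        exact Real.add_one_le_exp _
      _ ≤ _ := by
        rw [← Real.exp_nat_mul, ← Real.exp_add]
        apply Real.exp_le_exp.mpr
        push_cast
        nlinarith
  · change ∑ s ∈ T i, (Z s : ℝ) * f s ≠ 0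
    rw [hkey]
    exact mul_ne_zero hDpos.ne' hne
  · change |∑ s ∈ T i, (Z s : ℝ) * Real.exp (Real.log x / q * v s)| ≤ _
    rw [hkey (fun s => Real.exp (Real.log x / q * v s))]
    obtain ⟨η, hη0, hη1, he⟩ := dd_exp_bound (T i) v hinjT ((ℓ + 1) * k) hcT 0 (q * (k + 1)) (by
      intro s hs
      have h := hmem s hs
      rw [hv]
      have h1 : (s.1 : ℝ) ≤ q := by exact_mod_cast (by omega : s.1 ≤ q)
      have h2 : (s.2 : ℝ) ≤ k := by exact_mod_cast h.2
      constructor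
      · positivity
      · nlinarith) (Real.log x / q)
    rw [he]
    have hlam : |Real.log x / q| ≤ |Real.log x| := by
      rw [abs_div, Nat.abs_cast]
      exact div_le_self (abs_nonneg _) hqR
    have hexp : Real.exp (Real.log x / q * η) ≤ Real.exp (2 * k) := by
      apply Real.exp_le_exp.mpr
      have h1 : Real.log x / q * η ≤ |Real.log x| / q * η := by
        gcongr; exact le_abs_self _
      have h2 : |Real.log x| / q * η ≤ 1 / q * (q * (k + 1)) := by
        gcongr
      have h3 : 1 / (q : ℝ) * (q * (k + 1)) = k + 1 := by field_simp
      linarith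
    have hfac : ((k ! : ℕ) : ℝ) ^ (ℓ + 1) ≤ (((ℓ + 1) * k)! : ℕ) := by
      have h1 := Nat.prod_factorial_dvd_factorial_sum (Finset.range (ℓ + 1)) (fun _ => k)
      simp at h1
      exact_mod_cast Nat.le_of_dvd (Nat.factorial_pos _) h1
    rw [abs_mul, abs_of_pos hDpos, abs_div, abs_mul, abs_pow, Real.abs_exp, Nat.abs_cast]
    have hDle : D ≤ (((ℓ + 1) * k)! : ℕ) * Real.exp (g * k) ^ (ℓ + 1) := by
      calc D = ((k ! : ℕ) : ℝ) ^ (ℓ + 1) * (q ^ k * Lc) ^ (ℓ + 1) := by rw [hD, ← mul_pow]; ring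
        _ ≤ _ := by gcongr
    have hfp : (0 : ℝ) < (((ℓ + 1) * k)! : ℕ) := by exact_mod_cast Nat.factorial_pos _
    calc D * (|Real.log x / q| ^ ((ℓ + 1) * k) * Real.exp (Real.log x / q * η) / (((ℓ + 1) * k)! : ℕ))
        ≤ ((((ℓ + 1) * k)! : ℕ) * Real.exp (g * k) ^ (ℓ + 1)) *
          (|Real.log x| ^ ((ℓ + 1) * k) * Real.exp (2 * k) / (((ℓ + 1) * k)! : ℕ)) := by gcongr
      _ = (Real.exp (g * k) ^ (ℓ + 1) * Real.exp (2 * k)) * |Real.log x| ^ ((ℓ + 1) * k) := by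
        field_simp
      _ ≤ _ := by
        gcongr
        rw [← Real.exp_nat_mul, ← Real.exp_add]
        apply Real.exp_le_exp.mpr
        push_cast
        nlinarith

lemma abs_log_le_two_mul (y : ℝ) (hy : |y - 1| ≤ 1 / 2) : |Real.log y| ≤ 2 * |y - 1| := by
  have h := abs_le.mp hy
  have hy0 : 0 < y := by linarith
  have h1 := Real.log_le_sub_one_of_pos hy0
  have h2 := Real.log_le_sub_one_of_pos (inv_pos.mpr hy0)
  rw [Real.log_inv] at h2
  have h3 : y⁻¹ - 1 ≤ 2 * |y - 1| := by
    have : y⁻¹ - 1 = (1 - y) * y⁻¹ := by field_simp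
    rw [this]
    have h5 : y⁻¹ ≤ 2 := by
      rw [inv_le_comm₀ hy0 (by norm_num)]; linarith
    have h6 : 1 - y ≤ |y - 1| := by rw [abs_sub_comm]; exact le_abs_self _
    have h7 : 0 < y⁻¹ := inv_pos.mpr hy0
    nlinarith [abs_nonneg (y - 1)]
  rw [abs_le]
  have := le_abs_self (y - 1)
  have := abs_nonneg (y - 1)
  constructor <;> linarith

/-- The comparison step: two very good pairs contradict each other. -/
lemma two_solutions (α ρ σ : ℝ) (hα : 0 < α) (hρ : 1 < ρ) (hσ : 1 < σ) (cL : ℝ)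
    (hL : ∀ {κ : Type} (T : Finset κ) (Z : κ → ℤ) (e : κ → Fin 5 → ℕ) (E : ℕ) (H : ℝ),
      1 ≤ H → (∀ t ∈ T, ∑ i, e t i ≤ E) → ∑ t ∈ T, |(Z t : ℝ)| ≤ H →
      ∑ t ∈ T, (Z t : ℝ) * ∏ i, (![α⁻¹, ρ⁻¹, σ, ρ, σ⁻¹] : Fin 5 → ℝ) i ^ e t i ≠ 0 →
      Real.exp (-(cL * (E + Real.log H))) ≤
        |∑ t ∈ T, (Z t : ℝ) * ∏ i, (![α⁻¹, ρ⁻¹, σ, ρ, σ⁻¹] : Fin 5 → ℝ) i ^ e t i|)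
    (q ℓ : ℕ) (hℓ : ℓ < q) (C : ℝ) (hC : 0 ≤ C)
    (hP : ∀ k : ℕ, 1 ≤ k → ∀ x w : ℝ, 0 < x → x ≠ 1 →
    |Real.log x| ≤ 1 → ∃ (T : Finset (Σ _ : ℕ, ℕ)) (Z : (Σ _ : ℕ, ℕ) → ℤ),
      (∀ s ∈ T, s.1 ≤ ℓ ∧ s.2 ≤ k) ∧ ∑ s ∈ T, |(Z s : ℝ)| ≤ Real.exp (C * k) ∧
      ∑ s ∈ T, (Z s : ℝ) * (x ^ s.2 * w ^ s.1) ≠ 0 ∧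
      |∑ s ∈ T, (Z s : ℝ) * Real.exp (Real.log x / q * (q * s.2 + s.1))| ≤
        Real.exp (C * k) * |Real.log x| ^ ((ℓ + 1) * k))
    (n₁ m₁ a b k : ℕ) (hk : 1 ≤ k) (δ₁ δ₂ : ℝ)
    (hne : α * ρ ^ n₁ / σ ^ m₁ ≠ 1)
    (hδ₁ : 0 ≤ δ₁) (hδ₂ : 0 ≤ δ₂)
    (h1 : |Real.log (α * ρ ^ n₁ / σ ^ m₁)| ≤ Real.exp (-δ₁))
    (h2 : |Real.log (α * ρ ^ (n₁ + q * a) / σ ^ (m₁ + q * b))| ≤ Real.exp (-δ₂))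
    (hi : C * k - δ₁ * ((ℓ + 1) * k) ≤ -(cL * ((k * (1 + n₁ + m₁) + ℓ * (a + b) : ℕ) + C * k)) - 1)
    (hii : (C + 3) * k - δ₂ ≤ -(cL * ((k * (1 + n₁ + m₁) + ℓ * (a + b) : ℕ) + C * k)) - 1) : False := by
  have hρ0 : 0 < ρ := by linarith
  have hσ0 : 0 < σ := by linarith
  have hkR : (1 : ℝ) ≤ k := by exact_mod_cast hk
  have hqR : (0 : ℝ) < q := by exact_mod_cast (by omega : 0 < q)
  set y₁ := α * ρ ^ n₁ / σ ^ m₁ with hy₁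
  set y₂ := α * ρ ^ (n₁ + q * a) / σ ^ (m₁ + q * b) with hy₂
  have hy₁0 : 0 < y₁ := by positivity
  have hy₂0 : 0 < y₂ := by positivity
  set x := y₁⁻¹ with hx
  have hx0 : 0 < x := by positivity
  set w := ρ ^ a / σ ^ b with hw
  have hw0 : 0 < w := by positivity
  have hlogx : |Real.log x| = |Real.log y₁| := by rw [hx, Real.log_inv, abs_neg]
  have hlx : |Real.log x| ≤ Real.exp (-δ₁) := by rw [hlogx]; exact h1
  have hlx1 : |Real.log x| ≤ 1 := hlx.trans (by rw [Real.exp_le_one_iff]; linarith)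
  have hly1 : |Real.log y₂| ≤ 1 := h2.trans (by rw [Real.exp_le_one_iff]; linarith)
  obtain ⟨T, Z, hmem, hZ, hγ, hR⟩ := hP k hk x w hx0 (by
    intro h; apply hne; rw [hx] at h; exact inv_eq_one.mp h) hlx1
  set E : ℕ := k * (1 + n₁ + m₁) + ℓ * (a + b) with hE
  let e : (Σ _ : ℕ, ℕ) → Fin 5 → ℕ := fun s => ![s.2, s.2 * n₁, s.2 * m₁, s.1 * a, s.1 * b]
  have hmono : ∀ s : (Σ _ : ℕ, ℕ), ∏ i, (![α⁻¹, ρ⁻¹, σ, ρ, σ⁻¹] : Fin 5 → ℝ) i ^ e s i = x ^ s.2 * w ^ s.1 := by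
    intro s
    simp only [e, Fin.prod_univ_five]
    simp only [Matrix.cons_val, hx, hw, hy₁]
    rw [mul_comm s.2 n₁, mul_comm s.2 m₁, mul_comm s.1 a, mul_comm s.1 b]
    simp only [pow_mul, inv_pow, div_pow, mul_pow, inv_div]
    field_simp
  have hlow := hL T Z e E (Real.exp (C * k)) (Real.one_le_exp (by positivity)) (by
      intro s hs
      obtain ⟨hs1, hs2⟩ := hmem s hs
      simp only [e, Fin.sum_univ_five]
      simp only [Matrix.cons_val]
      have e1 : s.2 * (1 + n₁ + m₁) ≤ k * (1 + n₁ + m₁) := Nat.mul_le_mul_right _ hs2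
      have e2 : s.1 * (a + b) ≤ ℓ * (a + b) := Nat.mul_le_mul_right _ hs1
      rw [hE]
      nlinarith) hZ (by simp only [hmono]; exact hγ)
  simp only [hmono] at hlow
  rw [Real.log_exp] at hlow
  have hlogw : Real.log w = (Real.log x + Real.log y₂) / q := by
    have h3 : w ^ q = x * y₂ := by
      rw [hw, hx, hy₁, hy₂, div_pow, ← pow_mul, ← pow_mul, pow_add, pow_add, mul_comm a q, mul_comm b q]
      field_simp
    have h4 : Real.log (w ^ q) = Real.log (x * y₂) := by rw [h3]
    rw [Real.log_pow, Real.log_mul hx0.ne' hy₂0.ne'] at h4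
    field_simp
    linarith
  have hdiff : |∑ s ∈ T, (Z s : ℝ) * (x ^ s.2 * w ^ s.1) -
      ∑ s ∈ T, (Z s : ℝ) * Real.exp (Real.log x / q * (q * s.2 + s.1))| ≤
      Real.exp (C * k) * (Real.exp (2 * k) * (2 * Real.exp (-δ₂))) := by
    rw [← Finset.sum_sub_distrib]
    calc |∑ s ∈ T, ((Z s : ℝ) * (x ^ s.2 * w ^ s.1) - (Z s : ℝ) * Real.exp (Real.log x / q * (q * s.2 + s.1)))|
        ≤ ∑ s ∈ T, |(Z s : ℝ) * (x ^ s.2 * w ^ s.1) - (Z s : ℝ) * Real.exp (Real.log x / q * (q * s.2 + s.1))| :=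
          Finset.abs_sum_le_sum_abs _ _
      _ ≤ ∑ s ∈ T, |(Z s : ℝ)| * (Real.exp (2 * k) * (2 * Real.exp (-δ₂))) := by
        apply Finset.sum_le_sum
        intro s hs
        obtain ⟨hs1, hs2⟩ := hmem s hs
        have hs1q : (s.1 : ℝ) ≤ q := by exact_mod_cast (by omega : s.1 ≤ q)
        have hs2k : (s.2 : ℝ) ≤ k := by exact_mod_cast hs2
        rw [← mul_sub, abs_mul]
        apply mul_le_mul_of_nonneg_left _ (abs_nonneg _)
        set U := s.1 * Real.log y₂ / q with hU
        have hxw : x ^ s.2 * w ^ s.1 = Real.exp (Real.log x / q * (q * s.2 + s.1)) * Real.exp U := by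
          rw [← Real.exp_add]
          have h5 : x ^ s.2 * w ^ s.1 = Real.exp (s.2 * Real.log x + s.1 * Real.log w) := by
            rw [Real.exp_add, Real.exp_nat_mul, Real.exp_nat_mul, Real.exp_log hx0, Real.exp_log hw0]
          rw [h5, hlogw, hU]
          congr 1
          field_simp
          ring
        have hUle : |U| ≤ |Real.log y₂| := by
          rw [hU, abs_div, abs_mul, Nat.abs_cast, Nat.abs_cast, div_le_iff₀ hqR, mul_comm]
          exact mul_le_mul_of_nonneg_left hs1q (abs_nonneg _)
        have h6 : x ^ s.2 * w ^ s.1 - Real.exp (Real.log x / q * (q * s.2 + s.1)) =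
            Real.exp (Real.log x / q * (q * s.2 + s.1)) * (Real.exp U - 1) := by rw [hxw]; ring
        rw [h6, abs_mul, Real.abs_exp]
        apply mul_le_mul
        · apply Real.exp_le_exp.mpr
          have h7 : Real.log x / q * (q * s.2 + s.1) = Real.log x * (s.2 + s.1 / q) := by field_simp
          rw [h7]
          have h8 : (s.1 : ℝ) / q ≤ 1 := by rw [div_le_one hqR]; exact hs1q
          have h9 : 0 ≤ (s.2 : ℝ) + s.1 / q := by positivity
          have h10 : Real.log x ≤ 1 := (le_abs_self _).trans hlx1
          calc Real.log x * (s.2 + s.1 / q) ≤ 1 * (s.2 + s.1 / q) := mul_le_mul_of_nonneg_right h10 h9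
            _ ≤ 2 * k := by linarith
        · have := Real.abs_exp_sub_one_le (hUle.trans hly1)
          linarith
        · positivity
        · positivity
      _ = (∑ s ∈ T, |(Z s : ℝ)|) * (Real.exp (2 * k) * (2 * Real.exp (-δ₂))) := by rw [Finset.sum_mul]
      _ ≤ _ := by gcongr
  set γ := ∑ s ∈ T, (Z s : ℝ) * (x ^ s.2 * w ^ s.1) with hγdef
  set G := ∑ s ∈ T, (Z s : ℝ) * Real.exp (Real.log x / q * (q * s.2 + s.1)) with hG
  set X := Real.exp (-(cL * (E + C * k))) with hX
  have he1 : 2 < Real.exp 1 := by have := Real.exp_one_gt_d9; linarith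
  have hXp : 0 < X := Real.exp_pos _
  have hX1 : Real.exp (-(cL * (E + C * k)) - 1) < X / 2 := by
    rw [Real.exp_sub, ← hX]
    exact div_lt_div_of_pos_left hXp (by norm_num) he1
  have hb1 : |G| < X / 2 := by
    refine lt_of_le_of_lt ?_ hX1
    calc |G| ≤ Real.exp (C * k) * |Real.log x| ^ ((ℓ + 1) * k) := hR
      _ ≤ Real.exp (C * k) * Real.exp (-δ₁) ^ ((ℓ + 1) * k) := by gcongr
      _ = Real.exp (C * k - δ₁ * ((ℓ + 1) * k)) := by
        rw [← Real.exp_nat_mul, ← Real.exp_add]; congr 1; push_cast; ring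
      _ ≤ _ := Real.exp_le_exp.mpr hi
  have hb2 : |γ - G| < X / 2 := by
    refine lt_of_le_of_lt ?_ hX1
    calc |γ - G| ≤ Real.exp (C * k) * (Real.exp (2 * k) * (2 * Real.exp (-δ₂))) := hdiff
      _ ≤ Real.exp (C * k) * (Real.exp (2 * k) * (Real.exp k * Real.exp (-δ₂))) := by
        have : 2 ≤ Real.exp k := he1.le.trans (Real.exp_le_exp.mpr hkR)
        gcongr
      _ = Real.exp ((C + 3) * k - δ₂) := by
        rw [← Real.exp_add, ← Real.exp_add, ← Real.exp_add]; congr 1; ring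
      _ ≤ _ := Real.exp_le_exp.mpr hii
  have : |γ| ≤ |γ - G| + |G| := by
    have := abs_add_le (γ - G) G
    simpa using this
  linarith

set_option maxHeartbeats 4000000 in
lemma gelfond (α ρ σ : ℝ) (hα : 0 < α) (hρ : 1 < ρ) (hσ : 1 < σ) (hαa : IsAlgebraic ℚ α)
    (hρa : IsAlgebraic ℚ ρ) (hσa : IsAlgebraic ℚ σ) (ε : ℝ) (hε : 0 < ε) :
    ∃ n₀ : ℕ, ∀ n ≥ n₀, ∀ m : ℕ, α * ρ ^ n / σ ^ m ≠ 1 → Real.exp (-(ε * n)) < |α * ρ ^ n / σ ^ m - 1| := by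
  by_contra! hcon
  have hρ0 : 0 < ρ := by linarith
  have hσ0 : 0 < σ := by linarith
  obtain ⟨cL, hcL, hL⟩ := liouville_aux (![α⁻¹, ρ⁻¹, σ, ρ, σ⁻¹] : Fin 5 → ℝ) (by
    intro i
    fin_cases i
    · exact hαa.inv
    · exact hρa.inv
    · exact hσa
    · exact hρa
    · exact hσa.inv)
  have hlρ : 0 < Real.log ρ := Real.log_pos hρ
  have hlσ : 0 < Real.log σ := Real.log_pos hσ
  set C1 : ℝ := (|Real.log α| + 1 + Real.log ρ) / Real.log σ with hC1
  have hC1p : 0 ≤ C1 := by positivity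
  set c1 : ℝ := cL * (2 + C1) with hc1
  have hc1p : 0 < c1 := by positivity
  set ε' := ε / 2 with hε'
  have hε'p : 0 < ε' := by positivity
  obtain ⟨ℓ, hℓ⟩ := exists_nat_ge (4 * c1 / ε' + 1)
  have hℓ1 : (1 : ℝ) ≤ ℓ := by
    have : 0 ≤ 4 * c1 / ε' := by positivity
    linarith
  have hℓ2 : 4 * c1 ≤ ε' * (ℓ + 1) := by
    have : 4 * c1 / ε' ≤ ℓ + 1 := by linarith
    rw [div_le_iff₀ hε'p] at this
    linarith
  obtain ⟨q, hq⟩ := exists_nat_ge (6 * c1 * ℓ / ε' + ℓ + 1)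
  have hq0 : 0 ≤ 6 * c1 * ℓ / ε' := by positivity
  have hqℓ : ℓ < q := by
    have : (ℓ : ℝ) < q := by linarith
    exact_mod_cast this
  have hqR : (0 : ℝ) < q := by linarith
  have hq2 : 6 * c1 * ℓ ≤ ε' * q := by
    have : 6 * c1 * ℓ / ε' ≤ q := by linarith
    rw [div_le_iff₀ hε'p] at this
    linarith
  obtain ⟨C, hC, hP⟩ := pade q ℓ hqℓ
  -- pigeonhole on residues
  have hpig : ∃ r s : ℕ, ∀ n₀ : ℕ, ∃ n ≥ n₀, ∃ m : ℕ, n % q = r ∧ m % q = s ∧ α * ρ ^ n / σ ^ m ≠ 1 ∧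
      |α * ρ ^ n / σ ^ m - 1| ≤ Real.exp (-(ε * n)) := by
    by_contra! hno
    choose N hN using hno
    obtain ⟨n, hn, m, h1, h2⟩ := hcon (∑ r ∈ Finset.range q, ∑ s ∈ Finset.range q, N r s)
    have hqn : 0 < q := by omega
    have hle : N (n % q) (m % q) ≤ ∑ r ∈ Finset.range q, ∑ s ∈ Finset.range q, N r s := by
      calc N (n % q) (m % q) ≤ ∑ s ∈ Finset.range q, N (n % q) s :=
            Finset.single_le_sum (f := fun s => N (n % q) s) (fun _ _ => Nat.zero_le _)
              (Finset.mem_range.mpr (Nat.mod_lt _ hqn))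
        _ ≤ _ := Finset.single_le_sum (f := fun r => ∑ s ∈ Finset.range q, N r s) (fun _ _ => Nat.zero_le _)
              (Finset.mem_range.mpr (Nat.mod_lt _ hqn))
    have := hN (n % q) (m % q) n (hle.trans hn) m rfl rfl h1
    linarith
  obtain ⟨r, s, hrs⟩ := hpig
  have hl2 : Real.log 2 ≤ 1 := by have := Real.log_two_lt_d9; linarith
  -- properties of good pairs
  have hgood : ∀ n m : ℕ, 1 ≤ n → 1 ≤ ε' * n → |α * ρ ^ n / σ ^ m - 1| ≤ Real.exp (-(ε * n)) →
      |Real.log (α * ρ ^ n / σ ^ m)| ≤ Real.exp (-(ε' * n)) ∧ (m : ℝ) ≤ C1 * n ∧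
      Real.log α + n * Real.log ρ - 1 ≤ m * Real.log σ := by
    intro n m hn hεn h
    have hn' : (1 : ℝ) ≤ n := by exact_mod_cast hn
    have he1 : 2 < Real.exp 1 := by have := Real.exp_one_gt_d9; linarith
    have hA : 2 * Real.exp (-(ε' * n)) ≤ 1 := by
      have h3 : Real.exp (-(ε' * n)) ≤ Real.exp (-1) := Real.exp_le_exp.mpr (by linarith)
      have h4 : Real.exp (-1) * Real.exp 1 = 1 := by rw [← Real.exp_add]; simp
      nlinarith [Real.exp_pos (-1)]
    have hB : Real.exp (-(ε * n)) = Real.exp (-(ε' * n)) * Real.exp (-(ε' * n)) := by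
      rw [← Real.exp_add]; congr 1; rw [hε']; ring
    have hp := Real.exp_pos (-(ε' * n))
    have hle : |α * ρ ^ n / σ ^ m - 1| ≤ 1 / 2 := by rw [hB] at h; nlinarith
    have hlog := abs_log_le_two_mul _ hle
    have hlog2 : |Real.log (α * ρ ^ n / σ ^ m)| ≤ Real.exp (-(ε' * n)) := by rw [hB] at h; nlinarith
    have hexp : Real.log (α * ρ ^ n / σ ^ m) = Real.log α + n * Real.log ρ - m * Real.log σ := by
      rw [Real.log_div (by positivity) (by positivity), Real.log_mul (by positivity) (by positivity),
        Real.log_pow, Real.log_pow]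
    have hone : |Real.log (α * ρ ^ n / σ ^ m)| ≤ 1 := by linarith
    rw [hexp] at hone
    have h5 := abs_le.mp hone
    refine ⟨hlog2, ?_, by linarith⟩
    rw [hC1, div_mul_eq_mul_div, le_div_iff₀ hlσ]
    have := le_abs_self (Real.log α)
    have := abs_nonneg (Real.log α)
    nlinarith
  set Q : ℝ := C + 3 + cL * C + 1 with hQ
  have hQp : 0 ≤ Q := by positivity
  obtain ⟨N1, hN1⟩ := exists_nat_ge (1 + 1 / ε' + Q / c1)
  obtain ⟨n₁, hn₁, m₁, hr₁, hs₁, hne₁, hb₁⟩ := hrs N1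
  have hn₁R : 1 + 1 / ε' + Q / c1 ≤ n₁ := hN1.trans (by exact_mod_cast hn₁)
  have p1 : 0 ≤ 1 / ε' := by positivity
  have p2 : 0 ≤ Q / c1 := by positivity
  have hn₁1 : (1 : ℝ) ≤ n₁ := by linarith
  have hεn₁ : 1 ≤ ε' * n₁ := by
    have : 1 / ε' ≤ n₁ := by linarith
    rw [div_le_iff₀ hε'p] at this; linarith
  have hQn₁ : Q ≤ c1 * n₁ := by
    have : Q / c1 ≤ n₁ := by linarith
    rw [div_le_iff₀ hc1p] at this; linarith
  obtain ⟨hl₁, hm₁, _⟩ := hgood n₁ m₁ (by exact_mod_cast hn₁1) hεn₁ hb₁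
  obtain ⟨N2, hN2⟩ := exists_nat_ge ((m₁ * Real.log σ - Real.log α + 1) / Real.log ρ)
  obtain ⟨n₂, hn₂, m₂, hr₂, hs₂, hne₂, hb₂⟩ := hrs (q * n₁ + n₁ + N2)
  have hn₂a : n₁ ≤ n₂ := by have := Nat.zero_le (q * n₁); omega
  have hn₂b : q * n₁ ≤ n₂ := by omega
  have hn₂c : N2 ≤ n₂ := by have := Nat.zero_le (q * n₁); omega
  have hn₂R : (n₁ : ℝ) ≤ n₂ := by exact_mod_cast hn₂a
  obtain ⟨hl₂, hm₂, hm₂'⟩ := hgood n₂ m₂ (by exact_mod_cast hn₁1.trans hn₂R)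
    (hεn₁.trans (mul_le_mul_of_nonneg_left hn₂R hε'p.le)) hb₂
  have hmm : m₁ ≤ m₂ := by
    have h3 : (m₁ * Real.log σ - Real.log α + 1) / Real.log ρ ≤ n₂ := hN2.trans (by exact_mod_cast hn₂c)
    rw [div_le_iff₀ hlρ] at h3
    have : (m₁ : ℝ) * Real.log σ ≤ m₂ * Real.log σ := by linarith
    exact_mod_cast le_of_mul_le_mul_right this hlσ
  obtain ⟨a, ha⟩ : ∃ a, n₂ = n₁ + q * a := by
    have : q ∣ n₂ - n₁ := (Nat.modEq_iff_dvd' hn₂a).mp (by rw [Nat.ModEq, hr₁, hr₂])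
    obtain ⟨a, ha⟩ := this
    exact ⟨a, by omega⟩
  obtain ⟨b, hb⟩ : ∃ b, m₂ = m₁ + q * b := by
    have : q ∣ m₂ - m₁ := (Nat.modEq_iff_dvd' hmm).mp (by rw [Nat.ModEq, hs₁, hs₂])
    obtain ⟨b, hb⟩ := this
    exact ⟨b, by omega⟩
  set k : ℕ := ⌈(ℓ * n₂ / (q * n₁) : ℝ)⌉₊ with hk
  have hqn : (0 : ℝ) < q * n₁ := by positivity
  have hratio : 1 ≤ (ℓ * n₂ / (q * n₁) : ℝ) := by
    rw [le_div_iff₀ hqn]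
    have : ((q * n₁ : ℕ) : ℝ) ≤ n₂ := by exact_mod_cast hn₂b
    push_cast at this
    nlinarith
  have hk1 : (ℓ * n₂ / (q * n₁) : ℝ) ≤ k := Nat.le_ceil _
  have hk2 : (k : ℝ) ≤ 2 * (ℓ * n₂ / (q * n₁)) := by
    have := (Nat.ceil_lt_add_one (by linarith : (0 : ℝ) ≤ ℓ * n₂ / (q * n₁))).le
    linarith
  have hkR : (1 : ℝ) ≤ k := hratio.trans hk1
  have hk1' : (ℓ : ℝ) * n₂ ≤ (k * n₁) * q := by
    rw [div_le_iff₀ hqn] at hk1; linarith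
  have hk2' : (k * n₁ : ℝ) * q ≤ 2 * (ℓ * n₂) := by
    rw [mul_div_assoc', le_div_iff₀ hqn] at hk2; linarith
  have haR : (q : ℝ) * a ≤ n₂ := by exact_mod_cast (by omega : q * a ≤ n₂)
  have hbR : (q : ℝ) * b ≤ C1 * n₂ := by
    refine le_trans ?_ hm₂
    exact_mod_cast (by omega : q * b ≤ m₂)
  -- degree bound
  have hE : cL * ((k * (1 + n₁ + m₁) + ℓ * (a + b) : ℕ) : ℝ) ≤ 2 * c1 * (k * n₁) := by
    have h1 : ((1 : ℝ) + n₁ + m₁) ≤ (2 + C1) * n₁ := by linarith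
    have h2 : (ℓ : ℝ) * (a + b) ≤ (2 + C1) * (k * n₁) := by
      have h3 : (q : ℝ) * (a + b) ≤ (2 + C1) * n₂ := by
        have : (0 : ℝ) ≤ n₂ := by positivity
        linarith
      have h4 : q * ((ℓ : ℝ) * (a + b)) ≤ q * ((2 + C1) * (k * n₁)) := by
        calc q * ((ℓ : ℝ) * (a + b)) = ℓ * (q * (a + b)) := by ring
          _ ≤ ℓ * ((2 + C1) * n₂) := by gcongr
          _ = (2 + C1) * (ℓ * n₂) := by ring
          _ ≤ (2 + C1) * ((k * n₁) * q) := by gcongr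
          _ = _ := by ring
      exact le_of_mul_le_mul_left h4 hqR
    have h5 : (k : ℝ) * (1 + n₁ + m₁) ≤ (2 + C1) * (k * n₁) := by
      calc (k : ℝ) * (1 + n₁ + m₁) ≤ k * ((2 + C1) * n₁) := by gcongr
        _ = _ := by ring
    push_cast
    calc cL * ((k : ℝ) * (1 + n₁ + m₁) + ℓ * (a + b)) ≤ cL * ((2 + C1) * (k * n₁) + (2 + C1) * (k * n₁)) := by
          gcongr
      _ = _ := by rw [hc1]; ring
  have hQk : Q * k ≤ c1 * (k * n₁) := by
    calc Q * k ≤ c1 * n₁ * k := by gcongr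
      _ = _ := by ring
  have hQe : Q * k = C * k + 3 * k + cL * (C * k) + k := by rw [hQ]; ring
  have hCk : 0 ≤ C * k := by positivity
  have hcCk : 0 ≤ cL * (C * k) := by positivity
  have hkn : 0 ≤ c1 * (k * n₁) := by positivity
  refine two_solutions α ρ σ hα hρ hσ cL hL q ℓ hqℓ C hC hP n₁ m₁ a b k (by exact_mod_cast hkR)
    (ε' * n₁) (ε' * n₂) hne₁ (by positivity) (by positivity) hl₁ (by rw [← ha, ← hb]; exact hl₂) ?_ ?_
  · have h6 : 4 * c1 * (k * n₁) ≤ ε' * n₁ * ((ℓ + 1) * k) := by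
      calc 4 * c1 * (k * n₁) ≤ (ε' * (ℓ + 1)) * (k * n₁) := by gcongr
        _ = _ := by ring
    rw [mul_add]
    linarith
  · have h7 : 3 * (c1 * (k * n₁)) ≤ ε' * n₂ := by
      have : q * (3 * (c1 * (k * n₁))) ≤ q * (ε' * n₂) := by
        calc q * (3 * (c1 * (k * n₁))) = 3 * c1 * ((k * n₁) * q) := by ring
          _ ≤ 3 * c1 * (2 * (ℓ * n₂)) := by gcongr
          _ = (6 * c1 * ℓ) * n₂ := by ring
          _ ≤ (ε' * q) * n₂ := by gcongr
          _ = _ := by ring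
      exact le_of_mul_le_mul_left this hqR
    rw [mul_add]
    linarith

set_option maxHeartbeats 4000000 in
/-- Sparsity lemma: if `u`, `v` are integer sequences with single simple
dominant exponential parts `c·ρ^n` and `c'·σ^m` (real algebraic data) whose
dominant parts coincide for at most finitely many index pairs, then distinct
large values of `u` and `v` are separated by gaps exceeding any bound. -/
theorem sparsity_of_dominant_root_sequences
    (u v : ℕ → ℤ) (c c' ρ σ : ℝ) (θ θ' C₀ : ℝ)
    (hcalg : IsAlgebraic ℚ c) (hc'alg : IsAlgebraic ℚ c')
    (hρalg : IsAlgebraic ℚ ρ) (hσalg : IsAlgebraic ℚ σ)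
    (hc : 0 < c) (hc' : 0 < c') (hρ : 1 < ρ) (hσ : 1 < σ)
    (hθ0 : 0 ≤ θ) (hθ : θ < ρ) (hθ'0 : 0 ≤ θ') (hθ' : θ' < σ)
    (hu : ∀ n : ℕ, |(u n : ℝ) - c * ρ ^ n| ≤ C₀ * θ ^ n)
    (hv : ∀ m : ℕ, |(v m : ℝ) - c' * σ ^ m| ≤ C₀ * θ' ^ m)
    (hfin : {p : ℕ × ℕ | c * ρ ^ p.1 = c' * σ ^ p.2}.Finite) :
    ∀ K : ℝ, ∃ L : ℝ, ∀ n m : ℕ,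
      L ≤ (u n : ℝ) → L ≤ (v m : ℝ) → u n ≠ v m →
      K < |(u n : ℝ) - (v m : ℝ)| := by
  intro K
  have hρ0 : 0 < ρ := by linarith
  have hσ0 : 0 < σ := by linarith
  have hlρ : 0 < Real.log ρ := Real.log_pos hρ
  have hlσ : 0 < Real.log σ := Real.log_pos hσ
  have hC₀ : 0 ≤ C₀ := by
    have := (abs_nonneg _).trans (hu 0)
    simpa using this
  -- enlarge the remainders' rates to be at least `1`
  set t := max θ 1 with ht
  set t' := max θ' 1 with ht'
  have ht1 : 1 ≤ t := le_max_right _ _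
  have ht'1 : 1 ≤ t' := le_max_right _ _
  have htρ : t < ρ := max_lt hθ hρ
  have ht'σ : t' < σ := max_lt hθ' hσ
  have ht0 : 0 < t := by linarith
  have ht'0 : 0 < t' := by linarith
  have hut : ∀ n : ℕ, |(u n : ℝ) - c * ρ ^ n| ≤ C₀ * t ^ n := fun n =>
    (hu n).trans (by gcongr; exact le_max_left _ _)
  have hvt : ∀ n : ℕ, |(v n : ℝ) - c' * σ ^ n| ≤ C₀ * t' ^ n := fun n =>
    (hv n).trans (by gcongr; exact le_max_left _ _)
  set δ := Real.log ρ - Real.log t with hδ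
  set δ' := Real.log σ - Real.log t' with hδ'
  have hδp : 0 < δ := sub_pos.mpr (Real.log_lt_log ht0 htρ)
  have hδ'p : 0 < δ' := sub_pos.mpr (Real.log_lt_log ht'0 ht'σ)
  have hpowt : ∀ n : ℕ, t ^ n = ρ ^ n * Real.exp (-(δ * n)) := by
    intro n
    rw [← Real.exp_log ht0, ← Real.exp_log hρ0, ← Real.exp_nat_mul, ← Real.exp_nat_mul, ← Real.exp_add]
    congr 1; rw [hδ]; ring
  have hpowt' : ∀ n : ℕ, t' ^ n = σ ^ n * Real.exp (-(δ' * n)) := by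
    intro n
    rw [← Real.exp_log ht'0, ← Real.exp_log hσ0, ← Real.exp_nat_mul, ← Real.exp_nat_mul, ← Real.exp_add]
    congr 1; rw [hδ']; ring
  set ε := min δ (δ' * (Real.log ρ / Real.log σ)) / 2 with hε
  have hεp : 0 < ε := by
    have : 0 < min δ (δ' * (Real.log ρ / Real.log σ)) := lt_min hδp (by positivity)
    positivity
  have hε1 : 2 * ε ≤ δ := by rw [hε]; linarith [min_le_left δ (δ' * (Real.log ρ / Real.log σ))]
  have hε2 : 2 * ε ≤ δ' * (Real.log ρ / Real.log σ) := by
    rw [hε]; linarith [min_le_right δ (δ' * (Real.log ρ / Real.log σ))]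
  set α := c / c' with hα
  have hαp : 0 < α := by positivity
  obtain ⟨n₀, hn₀⟩ := gelfond α ρ σ hαp hρ hσ (by rw [hα, div_eq_mul_inv]; exact hcalg.mul hc'alg.inv)
    hρalg hσalg ε hεp
  -- the coincidences have bounded first index
  obtain ⟨n₃, hn₃⟩ : ∃ n₃ : ℕ, ∀ n ≥ n₃, ∀ m : ℕ, c * ρ ^ n ≠ c' * σ ^ m := by
    obtain ⟨M, hM⟩ := (hfin.image Prod.fst).bddAbove
    refine ⟨M + 1, fun n hn m h => ?_⟩
    have : n ≤ M := hM ⟨(n, m), h, rfl⟩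
    omega
  set C4 := Real.log (2 * c' / c) with hC4
  set C5 : ℝ := (|K| + C₀) / c' * Real.exp (δ' / Real.log σ * C4) + 2 * C₀ / c with hC5
  have hC5p : 0 ≤ C5 := by positivity
  -- eventual bounds
  have hten : ∀ d : ℝ, 0 < d → Filter.Tendsto (fun n : ℕ => Real.exp (-(d * n))) Filter.atTop (nhds 0) := by
    intro d hd
    have h1 : Filter.Tendsto (fun n : ℕ => d * (n : ℝ)) Filter.atTop Filter.atTop :=
      Filter.Tendsto.const_mul_atTop hd tendsto_natCast_atTop_atTop
    exact Real.tendsto_exp_neg_atTop_nhds_zero.comp h1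
  have hev : ∀ A B d : ℝ, 0 < d → 0 < B → ∃ N : ℕ, ∀ n ≥ N, A * Real.exp (-(d * (n : ℕ))) ≤ B := by
    intro A B d hd hB
    have h1 := (hten d hd).const_mul A
    rw [mul_zero] at h1
    exact Filter.eventually_atTop.mp (h1.eventually (Iic_mem_nhds hB))
  obtain ⟨N1, hN1⟩ := hev C5 1 ε hεp one_pos
  obtain ⟨N2, hN2⟩ := hev (|K| + C₀) (c / 4) δ hδp (by positivity)
  obtain ⟨N3, hN3⟩ := hev C₀ (c' / 4) δ' hδ'p (by positivity)
  set N := n₀ + n₃ + N1 + N2 with hN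
  refine ⟨1 + ∑ n ∈ Finset.range N, |(u n : ℝ)| + ∑ m ∈ Finset.range N3, |(v m : ℝ)|, ?_⟩
  intro n m hun hvm _
  by_contra! hK
  have hs1 : 0 ≤ ∑ n ∈ Finset.range N, |(u n : ℝ)| := by positivity
  have hs2 : 0 ≤ ∑ m ∈ Finset.range N3, |(v m : ℝ)| := by positivity
  have hnN : N ≤ n := by
    by_contra! hlt
    have := Finset.single_le_sum (f := fun n => |(u n : ℝ)|) (fun _ _ => abs_nonneg _) (Finset.mem_range.mpr hlt)
    have := le_abs_self (u n : ℝ)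
    linarith
  have hmN : N3 ≤ m := by
    by_contra! hlt
    have := Finset.single_le_sum (f := fun n => |(v n : ℝ)|) (fun _ _ => abs_nonneg _) (Finset.mem_range.mpr hlt)
    have := le_abs_self (v m : ℝ)
    linarith
  have hρn : 0 < ρ ^ n := by positivity
  have hσm : 0 < σ ^ m := by positivity
  have hAB : |c * ρ ^ n - c' * σ ^ m| ≤ |K| + C₀ * t ^ n + C₀ * t' ^ m := by
    have h1 := hut n
    have h2 := hvt m
    have h3 := le_abs_self K
    rw [abs_le] at *
    constructor <;> linarith [h1.1, h1.2, h2.1, h2.2, hK.1, hK.2]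
  have htn1 : 1 ≤ t ^ n := one_le_pow₀ ht1
  have ht'm1 : 1 ≤ t' ^ m := one_le_pow₀ ht'1
  have hA2B : c * ρ ^ n ≤ 2 * (c' * σ ^ m) := by
    have h1 : |K| + C₀ * t ^ n ≤ c * ρ ^ n / 4 := by
      have h2 := hN2 n (by omega)
      calc |K| + C₀ * t ^ n ≤ |K| * t ^ n + C₀ * t ^ n := by nlinarith [abs_nonneg K]
        _ = ((|K| + C₀) * Real.exp (-(δ * n))) * ρ ^ n := by rw [hpowt]; ring
        _ ≤ (c / 4) * ρ ^ n := by gcongr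
        _ = _ := by ring
    have h3 : C₀ * t' ^ m ≤ c' * σ ^ m / 4 := by
      have h2 := hN3 m hmN
      calc C₀ * t' ^ m = (C₀ * Real.exp (-(δ' * m))) * σ ^ m := by rw [hpowt']; ring
        _ ≤ (c' / 4) * σ ^ m := by gcongr
        _ = _ := by ring
    have h4 := (abs_le.mp hAB).2
    have : 0 < c * ρ ^ n := by positivity
    have : 0 < c' * σ ^ m := by positivity
    linarith
  -- lower bound for `m`
  have hmlow : n * Real.log ρ - C4 ≤ m * Real.log σ := by
    have h1 : ρ ^ n ≤ (2 * c' / c) * σ ^ m := by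
      rw [div_mul_eq_mul_div, le_div_iff₀ hc]; linarith
    have h2 := Real.log_le_log hρn h1
    rw [Real.log_mul (by positivity) (by positivity), Real.log_pow, Real.log_pow] at h2
    linarith
  have hexpm : Real.exp (-(δ' * m)) ≤ Real.exp (δ' / Real.log σ * C4) * Real.exp (-(2 * ε * n)) := by
    rw [← Real.exp_add]
    apply Real.exp_le_exp.mpr
    have h1 : δ' / Real.log σ * (n * Real.log ρ - C4) ≤ δ' / Real.log σ * (m * Real.log σ) := by gcongr
    have h2 : δ' / Real.log σ * (m * Real.log σ) = δ' * m := by field_simp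
    have h3 : δ' / Real.log σ * (n * Real.log ρ - C4) = δ' * (Real.log ρ / Real.log σ) * n - δ' / Real.log σ * C4 := by
      ring
    have h4 : 2 * ε * n ≤ δ' * (Real.log ρ / Real.log σ) * n := by gcongr
    linarith
  have hexpn : Real.exp (-(δ * n)) ≤ Real.exp (-(2 * ε * n)) := by
    apply Real.exp_le_exp.mpr
    have : 2 * ε * n ≤ δ * n := by gcongr
    linarith
  have hyne : α * ρ ^ n / σ ^ m ≠ 1 := by
    intro h
    apply hn₃ n (by omega) m
    rw [hα] at h
    field_simp at h
    linarith
  have hlow := hn₀ n (by omega) m hyne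
  have hy : α * ρ ^ n / σ ^ m - 1 = (c * ρ ^ n - c' * σ ^ m) / (c' * σ ^ m) := by
    rw [hα]; field_simp
  have hup : |α * ρ ^ n / σ ^ m - 1| ≤ C5 * Real.exp (-(2 * ε * n)) := by
    rw [hy, abs_div, abs_of_pos (by positivity : 0 < c' * σ ^ m), div_le_iff₀ (by positivity)]
    refine hAB.trans ?_
    have h1 : |K| + C₀ * t' ^ m ≤ ((|K| + C₀) / c' * Real.exp (δ' / Real.log σ * C4)) *
        Real.exp (-(2 * ε * n)) * (c' * σ ^ m) := by
      calc |K| + C₀ * t' ^ m ≤ |K| * t' ^ m + C₀ * t' ^ m := by nlinarith [abs_nonneg K]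
        _ = (|K| + C₀) * σ ^ m * Real.exp (-(δ' * m)) := by rw [hpowt']; ring
        _ ≤ (|K| + C₀) * σ ^ m * (Real.exp (δ' / Real.log σ * C4) * Real.exp (-(2 * ε * n))) := by gcongr
        _ = _ := by field_simp
    have h2 : C₀ * t ^ n ≤ (2 * C₀ / c) * Real.exp (-(2 * ε * n)) * (c' * σ ^ m) := by
      calc C₀ * t ^ n = (C₀ / c) * Real.exp (-(δ * n)) * (c * ρ ^ n) := by rw [hpowt]; field_simp
        _ ≤ (C₀ / c) * Real.exp (-(2 * ε * n)) * (2 * (c' * σ ^ m)) := by gcongr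
        _ = _ := by ring
    rw [hC5]
    calc _ = (|K| + C₀ * t' ^ m) + C₀ * t ^ n := by ring
      _ ≤ _ := add_le_add h1 h2
      _ = _ := by ring
  have hfinal : C5 * Real.exp (-(2 * ε * n)) ≤ Real.exp (-(ε * n)) := by
    have h1 := hN1 n (by omega)
    have h2 : Real.exp (-(2 * ε * n)) = Real.exp (-(ε * n)) * Real.exp (-(ε * n)) := by
      rw [← Real.exp_add]; congr 1; ring
    rw [h2]
    nlinarith [Real.exp_pos (-(ε * n))]
  linarith
end

section
/- Let d ≥ 1 and, for each i ∈ Fin d, let uᵢ : ℕ → ℤ, let cᵢ, ρᵢ be real algebraic numbers with cᵢ > 0 and ρᵢ > 1, let θᵢ be real with 0 ≤ θᵢ < ρᵢ, and let C₀ ≥ 0 be real, such that |uᵢ(n) − cᵢ·ρᵢ^n| ≤ C₀·θᵢ^n for all n. Assume for all i ≠ j the set {(n, m) ∈ ℕ × ℕ : cᵢ·ρᵢ^n = cⱼ·ρⱼ^m} is finite. Then there exists an integer N such that, defining mᵢ as the least natural number with uᵢ(mᵢ) ≥ N (which exists since uᵢ(n) → ∞), the following hold: (a) for each i, the sequence n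 ↦ uᵢ(mᵢ + n) is strictly increasing; (b) for all i ≠ j, all n ≥ mᵢ and all m ∈ ℕ: cᵢ·ρᵢ^n ≠ cⱼ·ρⱼ^m, uᵢ(n) ≠ uⱼ(m), and uᵢ(n) > uⱼ(m) if and only if cᵢ·ρᵢ^n > cⱼ·ρⱼ^m; (c) for all i ≠ j and all n ≥ mᵢ there exists m ≥ mⱼ with cᵢ·ρᵢ^n ≤ cⱼ·ρⱼ^m < ρⱼ·(cᵢ·ρᵢ^n). -/
open Polynomial in
lemma hermite_inj (S T : ℕ) (p : ℂ[X]) (hdeg : p.natDegree < S * T)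
    (h : ∀ s < S, ∀ j < T, (derivative^[j] p).eval (s : ℂ) = 0) : p = 0 := by
  by_contra hp
  have hT : 0 < T := by
    rcases Nat.eq_zero_or_pos T with h | h
    · subst h; simp at hdeg
    · exact h
  have hdvd : ∀ s ∈ Finset.range S, (X - C (s : ℂ)) ^ T ∣ p := by
    intro s hs
    have : T - 1 < p.rootMultiplicity (s : ℂ) := by
      rw [lt_rootMultiplicity_iff_isRoot_iterate_derivative hp]
      intro m hm
      exact h s (Finset.mem_range.1 hs) m (by omega)
    exact (le_rootMultiplicity_iff hp).1 (by omega)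
  have hcop : ((Finset.range S : Finset ℕ) : Set ℕ).Pairwise
      (Function.onFun IsCoprime fun s : ℕ => (X - C (s : ℂ)) ^ T) := by
    intro a _ b _ hab
    apply IsCoprime.pow
    apply isCoprime_X_sub_C_of_isUnit_sub
    rw [isUnit_iff_ne_zero, sub_ne_zero]
    exact_mod_cast hab
  have h1 := Finset.prod_dvd_of_coprime hcop hdvd
  have h2 := natDegree_le_of_dvd h1 hp
  rw [natDegree_prod_of_monic _ _ (fun s _ => (monic_X_sub_C _).pow T)] at h2
  simp only [natDegree_pow, natDegree_X_sub_C, mul_one, Finset.sum_const, Finset.card_range, smul_eq_mul] at h2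
  omega

open Polynomial in
lemma hermite_exists (S T : ℕ) (hS : 1 ≤ S) (hT : 1 ≤ T) (dat : ℕ → ℕ → ℂ) (η : ℝ) (hη : 0 ≤ η)
    (hd : ∀ s < S, ∀ j < T, ‖dat s j‖ ≤ η) :
    ∃ p : ℂ[X], (∀ s < S, ∀ j < T, (derivative^[j] p).eval (s : ℂ) = dat s j) ∧
      ∀ R : ℝ, 1 ≤ R → ∀ z : ℂ, ‖z‖ ≤ R →
        ‖p.eval z‖ ≤ η * (((S * T : ℕ) : ℝ) ^ (5 * (S * T) ^ 2) * R ^ (S * T)) := by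
  set N := S * T with hN
  have hN1 : 1 ≤ N := Nat.mul_pos hS hT
  have hNr : (1 : ℝ) ≤ N := by exact_mod_cast hN1
  let ι := Fin S × Fin T
  have hcard : Fintype.card ι = N := by simp [ι, hN]
  let k : ι → ℕ := fun c => (finProdFinEquiv c : Fin (S * T))
  have hk : ∀ c, k c < N := fun c => (finProdFinEquiv c).2
  have hkinj : Function.Injective k := fun a b hab =>
    finProdFinEquiv.injective (Fin.ext hab)
  let A : Matrix ι ι ℤ := fun r c => ((k c).descFactorial r.2 : ℤ) * (r.1 : ℤ) ^ (k c - r.2)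
  let AC : Matrix ι ι ℂ := A.map (Int.cast)
  have hACe : ∀ r c, AC r c = ((k c).descFactorial r.2 : ℂ) * ((r.1 : ℕ) : ℂ) ^ (k c - r.2) := by
    intro r c
    change (((((k c).descFactorial r.2 : ℕ) : ℤ) * ((r.1 : ℕ) : ℤ) ^ (k c - r.2) : ℤ) : ℂ) = _
    push_cast; rfl
  let P : (ι → ℂ) → ℂ[X] := fun v => ∑ c, C (v c) * X ^ (k c)
  have hPev : ∀ v (r : ι), (derivative^[(r.2 : ℕ)] (P v)).eval ((r.1 : ℕ) : ℂ) = (AC.mulVec v) r := by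
    intro v r
    simp only [P, Matrix.mulVec, dotProduct]
    rw [iterate_derivative_sum, eval_finsetSum]
    refine Finset.sum_congr rfl fun c _ => ?_
    rw [iterate_derivative_C_mul, iterate_derivative_X_pow_eq_natCast_mul]
    rw [hACe]
    simp
    ring
  have hcoeff : ∀ v c, (P v).coeff (k c) = v c := by
    intro v c
    simp only [P, finsetSum_coeff, coeff_C_mul, coeff_X_pow]
    rw [Finset.sum_eq_single c]
    · simp
    · intro b _ hb
      have : k c ≠ k b := fun h => hb (hkinj h).symm
      simp [this]
    · simp
  have hdetC : AC.det ≠ 0 := by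
    intro h0
    obtain ⟨v, hv, hv0⟩ := Matrix.exists_mulVec_eq_zero_iff.2 h0
    apply hv
    have hP0 : P v = 0 := by
      apply hermite_inj S T
      · rw [← hN]
        apply Nat.lt_of_le_pred hN1
        apply natDegree_sum_le_of_forall_le
        intro c _
        refine (natDegree_C_mul_X_pow_le _ _).trans ?_
        have := hk c
        simp; omega
      · intro s hs j hj
        have := hPev v (⟨s, hs⟩, ⟨j, hj⟩)
        rw [hv0] at this
        simpa using this
    funext c
    rw [← hcoeff v c, hP0]; simp
  have hdet_eq : AC.det = ((A.det : ℤ) : ℂ) := by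
    have := (Int.castRingHom ℂ).map_det A
    simpa [AC] using this.symm
  have hdetZ : 1 ≤ ‖AC.det‖ := by
    rw [hdet_eq] at hdetC ⊢
    rw [Complex.norm_intCast]
    have : A.det ≠ 0 := by exact_mod_cast hdetC
    exact_mod_cast Int.one_le_abs this
  have hentry : ∀ r c, ‖AC r c‖ ≤ (N : ℝ) ^ (2 * N) := by
    intro r c
    have h1 : (k c).descFactorial r.2 ≤ N ^ N := by
      refine (Nat.descFactorial_le_pow _ _).trans ?_
      have h2 : (r.2 : ℕ) ≤ N := r.2.2.le.trans (Nat.le_mul_of_pos_left T hS)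
      exact (Nat.pow_le_pow_left (hk c).le _).trans (Nat.pow_le_pow_right hN1 h2)
    have h2 : (r.1 : ℕ) ^ (k c - r.2) ≤ N ^ N := by
      have h2 : (r.1 : ℕ) ≤ N := r.1.2.le.trans (Nat.le_mul_of_pos_right S hT)
      have := hk c
      exact (Nat.pow_le_pow_left h2 _).trans (Nat.pow_le_pow_right hN1 (by omega))
    have h3 : ‖AC r c‖ = (((k c).descFactorial r.2 * (r.1 : ℕ) ^ (k c - r.2) : ℕ) : ℝ) := by
      rw [hACe]; simp
    rw [h3, two_mul, pow_add]
    exact_mod_cast Nat.mul_le_mul h1 h2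
  have hY1 : (1 : ℝ) ≤ (N : ℝ) ^ (2 * N) := one_le_pow₀ hNr
  have hadj : ∀ r c, ‖AC.adjugate r c‖ ≤ (N : ℝ) ^ N * ((N : ℝ) ^ (2 * N)) ^ N := by
    intro r c
    rw [Matrix.adjugate_apply]
    have hx : ∀ i j, (NormedField.toAbsoluteValue ℂ) ((AC.updateRow c (Pi.single r 1)) i j) ≤ (N : ℝ) ^ (2 * N) := by
      intro i j
      change ‖(AC.updateRow c (Pi.single r 1)) i j‖ ≤ _
      rw [Matrix.updateRow_apply]
      split_ifs
      · by_cases hjr : j = r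
        · subst hjr; simpa using hY1
        · rw [Pi.single_eq_of_ne hjr]; simp
      · exact hentry i j
    have := Matrix.det_le hx
    rw [hcard] at this
    refine le_trans this ?_
    rw [nsmul_eq_mul]
    gcongr
    exact_mod_cast Nat.factorial_le_pow N
  let dv : ι → ℂ := fun r => dat r.1 r.2
  let v : ι → ℂ := AC⁻¹.mulVec dv
  have hu : IsUnit AC.det := isUnit_iff_ne_zero.2 hdetC
  have hAv : AC.mulVec v = dv := by
    simp only [v, Matrix.mulVec_mulVec, Matrix.mul_nonsing_inv _ hu, Matrix.one_mulVec]
  have hv : ∀ c, ‖v c‖ ≤ N * ((N : ℝ) ^ N * ((N : ℝ) ^ (2 * N)) ^ N * η) := by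
    intro c
    have hvc : v c = ∑ r, (AC.det)⁻¹ * AC.adjugate c r * dv r := by
      simp only [v, Matrix.mulVec, dotProduct, Matrix.inv_def, Ring.inverse_eq_inv', Matrix.smul_apply, smul_eq_mul]
    rw [hvc]
    refine (norm_sum_le _ _).trans ?_
    refine (Finset.sum_le_card_nsmul _ _ ((N : ℝ) ^ N * ((N : ℝ) ^ (2 * N)) ^ N * η) ?_).trans ?_
    · intro r _
      rw [norm_mul, norm_mul, norm_inv]
      have h1 : ‖AC.det‖⁻¹ ≤ 1 := inv_le_one_of_one_le₀ hdetZ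
      have h2 := hadj c r
      have h3 := hd r.1 r.1.2 r.2 r.2.2
      calc _ ≤ 1 * ((N : ℝ) ^ N * ((N : ℝ) ^ (2 * N)) ^ N) * η := by
            gcongr
        _ = _ := by ring
    · rw [Finset.card_univ, hcard, nsmul_eq_mul]
  refine ⟨P v, ?_, ?_⟩
  · intro s hs j hj
    have := hPev v (⟨s, hs⟩, ⟨j, hj⟩)
    rw [hAv] at this
    simpa [dv] using this
  · intro R hR z hz
    simp only [P, eval_finsetSum, eval_mul, eval_C, eval_pow, eval_X]
    refine (norm_sum_le _ _).trans ?_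
    refine (Finset.sum_le_card_nsmul _ _ (N * ((N : ℝ) ^ N * ((N : ℝ) ^ (2 * N)) ^ N * η) * R ^ N) ?_).trans ?_
    · intro c _
      rw [norm_mul, norm_pow]
      have h1 : ‖z‖ ^ k c ≤ R ^ N :=
        (pow_le_pow_left₀ (norm_nonneg _) hz _).trans (pow_le_pow_right₀ hR (hk c).le)
      have := hv c
      gcongr
    · rw [Finset.card_univ, hcard, nsmul_eq_mul]
      have : (N : ℝ) * (N * ((N : ℝ) ^ N * ((N : ℝ) ^ (2 * N)) ^ N * η) * R ^ N)
        = η * ((N : ℝ) ^ (1 + 1 + N + 2 * N * N) * R ^ N) := by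
        rw [← pow_mul]; simp only [pow_add]; ring
      rw [this]
      gcongr
      nlinarith

lemma entire_factor (g : ℂ → ℂ) (hg : Differentiable ℂ g) (a : ℂ) (T : ℕ)
    (h : (T : ℕ∞) ≤ analyticOrderAt g a) :
    ∃ q : ℂ → ℂ, Differentiable ℂ q ∧ ∀ z, g z = (z - a) ^ T * q z := by
  induction T with
  | zero => exact ⟨g, hg, by simp⟩
  | succ T ih =>
    obtain ⟨q, hq, hgq⟩ := ih (le_trans (by exact_mod_cast Nat.le_succ T) h)
    have hq0 : q a = 0 := by
      by_contra hne
      have h1 : analyticOrderAt g a = T := by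
        rw [(hg.analyticAt a).analyticOrderAt_eq_natCast]
        refine ⟨q, hq.analyticAt a, hne, ?_⟩
        filter_upwards with z
        simp [hgq z]
      rw [h1] at h
      have : T + 1 ≤ T := by exact_mod_cast h
      omega
    refine ⟨dslope q a, ?_, ?_⟩
    · rw [← differentiableOn_univ] at hq ⊢
      exact (Complex.differentiableOn_dslope Filter.univ_mem).2 hq
    · intro z
      have := sub_smul_dslope q a z
      rw [hq0, sub_zero, smul_eq_mul] at this
      rw [hgq z, pow_succ, mul_assoc, this]

lemma entire_factor_multi (T : ℕ) (F : Finset ℂ) (g : ℂ → ℂ) (hg : Differentiable ℂ g)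
    (h : ∀ a ∈ F, (T : ℕ∞) ≤ analyticOrderAt g a) :
    ∃ q : ℂ → ℂ, Differentiable ℂ q ∧ ∀ z, g z = (∏ a ∈ F, (z - a) ^ T) * q z := by
  classical
  induction F using Finset.induction_on generalizing g with
  | empty => exact ⟨g, hg, by simp⟩
  | insert a F ha ih =>
    obtain ⟨q, hq, hgq⟩ := entire_factor g hg a T (h a (by simp))
    obtain ⟨r, hr, hqr⟩ := ih q hq (by
      intro b hb
      have hab : b ≠ a := by rintro rfl; exact ha hb
      have h1 := h b (by simp [hb])
      have h2 : g = (fun z => (z - a) ^ T) * q := funext hgq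
      have h3 : AnalyticAt ℂ (fun z : ℂ => (z - a) ^ T) b := by fun_prop
      rw [h2, analyticOrderAt_mul h3 (hq.analyticAt b), h3.analyticOrderAt_eq_zero.2, zero_add] at h1
      · exact h1
      · exact pow_ne_zero _ (sub_ne_zero.2 hab))
    refine ⟨r, hr, fun z => ?_⟩
    rw [Finset.prod_insert ha, hgq, hqr, mul_assoc]


lemma approx_schwarz (S T S' : ℕ) (hS : 1 ≤ S) (hT : 1 ≤ T) (hSS : S ≤ S') (f : ℂ → ℂ)
    (hf : Differentiable ℂ f) (η Q : ℝ) (hη : 0 ≤ η)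
    (hd : ∀ s < S, ∀ j < T, ‖iteratedDeriv j f (s : ℂ)‖ ≤ η)
    (hQ : ∀ z : ℂ, ‖z‖ ≤ 4 * S' → ‖f z‖ ≤ Q) (x : ℂ) (hx : ‖x‖ ≤ S') :
    ‖f x‖ ≤ (2 / 3) ^ (S * T) * Q +
      2 * (η * (((S * T : ℕ) : ℝ) ^ (5 * (S * T) ^ 2) * (4 * S' : ℝ) ^ (S * T))) := by
  obtain ⟨p, hp, hpb⟩ := hermite_exists S T hS hT (fun s j => iteratedDeriv j f (s : ℂ)) η hη hd
  set E := η * (((S * T : ℕ) : ℝ) ^ (5 * (S * T) ^ 2) * (4 * S' : ℝ) ^ (S * T)) with hE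
  have hS'1 : (1 : ℝ) ≤ S' := by exact_mod_cast hS.trans hSS
  have hE0 : 0 ≤ E := by positivity
  have hpd : Differentiable ℂ (fun z => p.eval z) := p.differentiable
  have hitp : ∀ j, iteratedDeriv j (fun z => p.eval z) = fun z => (Polynomial.derivative^[j] p).eval z := by
    intro j
    induction j with
    | zero => simp
    | succ j ih =>
      rw [iteratedDeriv_succ, ih, Function.iterate_succ_apply']
      funext z
      simp
  have hgd : Differentiable ℂ (fun z => f z - p.eval z) := hf.sub hpd
  obtain ⟨q, hq, hgq⟩ := entire_factor_multi T ((Finset.range S).image (fun s : ℕ => (s : ℂ)))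
    (fun z => f z - p.eval z) hgd (by
      intro a ha
      obtain ⟨s, hs, rfl⟩ := Finset.mem_image.1 ha
      rw [natCast_le_analyticOrderAt_iff_iteratedDeriv_eq_zero (hgd.analyticAt _)]
      intro i hi
      rw [iteratedDeriv_fun_sub (hf.analyticAt _).contDiffAt (hpd.analyticAt _).contDiffAt, hitp]
      exact sub_eq_zero.2 (hp s (Finset.mem_range.1 hs) i hi).symm)
  have hgq' : ∀ z, f z - p.eval z = (∏ s ∈ Finset.range S, (z - (s : ℂ)) ^ T) * q z := by
    intro z
    rw [hgq z, Finset.prod_image]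
    intro a _ b _ hab
    exact Nat.cast_injective hab
  have hQ0 : 0 ≤ Q := (norm_nonneg _).trans (hQ 0 (by simp))
  have hqb : ∀ z ∈ frontier (Metric.ball (0 : ℂ) (4 * S')), ‖q z‖ ≤ (Q + E) / (3 * S') ^ (S * T) := by
    intro z hz
    rw [frontier_ball (0 : ℂ) (by positivity)] at hz
    have hz' : ‖z‖ = 4 * S' := by simpa using hz
    rw [le_div_iff₀ (by positivity)]
    have h1 : ‖f z - p.eval z‖ ≤ Q + E :=
      (norm_sub_le _ _).trans (add_le_add (hQ z hz'.le) (hpb _ (by linarith) z hz'.le))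
    rw [hgq' z, norm_mul, norm_prod] at h1
    refine le_trans ?_ h1
    rw [mul_comm]
    gcongr
    have : (3 * S' : ℝ) ^ (S * T) = ∏ s ∈ Finset.range S, (3 * S' : ℝ) ^ T := by
      simp [← pow_mul, mul_comm]
    rw [this]
    apply Finset.prod_le_prod
    · intros; positivity
    · intro s hs
      rw [norm_pow]
      gcongr
      have h2 : ‖(s : ℂ)‖ ≤ S' := by
        simp only [Complex.norm_natCast]
        exact_mod_cast (Finset.mem_range.1 hs).le.trans hSS
      have h3 := norm_sub_norm_le z (s : ℂ)
      linarith
  have hqx : ‖q x‖ ≤ (Q + E) / (3 * S') ^ (S * T) := by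
    apply Complex.norm_le_of_forall_mem_frontier_norm_le Metric.isBounded_ball
      (hq.diffContOnCl) hqb
    apply subset_closure
    simp only [Metric.mem_ball, dist_zero_right]
    linarith
  have hpr : ‖∏ s ∈ Finset.range S, (x - (s : ℂ)) ^ T‖ ≤ (2 * S' : ℝ) ^ (S * T) := by
    have : (2 * S' : ℝ) ^ (S * T) = ∏ s ∈ Finset.range S, (2 * S' : ℝ) ^ T := by
      simp [← pow_mul, mul_comm]
    rw [this, norm_prod]
    apply Finset.prod_le_prod
    · intros; positivity
    · intro s hs
      rw [norm_pow]
      gcongr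
      have h2 : ‖(s : ℂ)‖ ≤ S' := by
        simp only [Complex.norm_natCast]
        exact_mod_cast (Finset.mem_range.1 hs).le.trans hSS
      have h3 := norm_sub_le x (s : ℂ)
      linarith
  have hfx : f x = (∏ s ∈ Finset.range S, (x - (s : ℂ)) ^ T) * q x + p.eval x := by
    rw [← hgq' x]; ring
  have h1 : ‖p.eval x‖ ≤ E := hpb _ (by linarith) x (by linarith)
  have h2 : (2 * S' : ℝ) ^ (S * T) * ((Q + E) / (3 * S') ^ (S * T)) = (2 / 3) ^ (S * T) * (Q + E) := by
    rw [mul_pow, mul_pow, div_pow]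
    field_simp
  have h3 : (2 / 3 : ℝ) ^ (S * T) ≤ 1 := pow_le_one₀ (by norm_num) (by norm_num)
  have h4 : ‖f x‖ ≤ (2 / 3) ^ (S * T) * (Q + E) + E := by
    rw [hfx, ← h2]
    refine (norm_add_le _ _).trans (add_le_add ?_ h1)
    rw [norm_mul]
    gcongr
  nlinarith

open NumberField in
lemma siegel_const (K : Type) [Field K] [NumberField K] :
    ∃ c : ℝ, 1 ≤ c ∧ ∀ (α β : Type) [Fintype α] [Fintype β] (a : Matrix α β (𝓞 K)) (A : ℝ),
      1 ≤ A → 0 < Fintype.card α → 2 * Fintype.card α ≤ Fintype.card β →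
      (∀ k l, house ((algebraMap (𝓞 K) K) (a k l)) ≤ A) →
      ∃ ξ : β → 𝓞 K, ξ ≠ 0 ∧ a.mulVec ξ = 0 ∧
        ∀ l, house ((algebraMap (𝓞 K) K) (ξ l)) ≤ c * (Fintype.card β * A) := by
  classical
  have key : ∃ c₁ : ℝ, ∀ (α β : Type) [Fintype α] [Fintype β] (a : Matrix α β (𝓞 K)) (A : ℝ),
      0 < Fintype.card α → Fintype.card α < Fintype.card β → a ≠ 0 →
      (∀ k l, house ((algebraMap (𝓞 K) K) (a k l)) ≤ A) →
      ∃ ξ : β → 𝓞 K, ξ ≠ 0 ∧ a.mulVec ξ = 0 ∧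
        ∀ l, house (ξ l).1 ≤ c₁ * ((c₁ * (Fintype.card β : ℕ) * A) ^
          (((Fintype.card α : ℕ) : ℝ) / ((Fintype.card β : ℕ) - (Fintype.card α : ℕ)))) := by
    refine ⟨?_, ?_⟩
    swap
    · intro α β _ _ a A h0 h1 ha hA
      exact NumberField.house.exists_ne_zero_int_vec_house_le K a ha h0 h1 rfl hA rfl
  obtain ⟨c₁, hc₁⟩ := key
  refine ⟨(1 + |c₁|) ^ 2, by nlinarith [abs_nonneg c₁], ?_⟩
  intro α β _ _ a A hA1 h0 h1 hA
  have hq1 : (1 : ℝ) ≤ Fintype.card β := by exact_mod_cast (by omega : 1 ≤ Fintype.card β)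
  have hqA : 1 ≤ (Fintype.card β : ℝ) * A := by nlinarith
  by_cases ha : a = 0
  · refine ⟨fun _ => 1, ?_, by simp [ha], ?_⟩
    · intro h
      have : Nonempty β := Fintype.card_pos_iff.1 (by omega)
      obtain ⟨b⟩ := this
      have := congrFun h b
      simp at this
    · intro l
      have : house (1 : K) = 1 := by
        have := house_intCast (K := K) 1
        simpa using this
      simp only [map_one, this]
      nlinarith [abs_nonneg c₁]
  · obtain ⟨ξ, h2, h3, h4⟩ := hc₁ α β a A h0 (by omega) ha hA
    refine ⟨ξ, h2, h3, fun l => (h4 l).trans ?_⟩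
    set p : ℝ := (Fintype.card α : ℝ)
    set q : ℝ := (Fintype.card β : ℝ)
    have hp0 : 0 < p := by simpa [p] using h0
    have hpq : 2 * p ≤ q := by simp only [p, q]; exact_mod_cast h1
    set e := p / (q - p)
    have he0 : 0 ≤ e := div_nonneg hp0.le (by linarith)
    have he1 : e ≤ 1 := by rw [div_le_one (by linarith)]; linarith
    have h5 : |(c₁ * q * A) ^ e| ≤ (1 + |c₁|) * (q * A) := by
      refine (Real.abs_rpow_le_abs_rpow _ _).trans ?_
      have h6 : |c₁ * q * A| ≤ (1 + |c₁|) * (q * A) := by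
        rw [abs_mul, abs_mul, abs_of_nonneg (by linarith : 0 ≤ q), abs_of_nonneg (by linarith : 0 ≤ A)]
        nlinarith [abs_nonneg c₁]
      have h7 : 1 ≤ (1 + |c₁|) * (q * A) := by nlinarith [abs_nonneg c₁]
      calc |c₁ * q * A| ^ e ≤ ((1 + |c₁|) * (q * A)) ^ e := by gcongr
        _ ≤ ((1 + |c₁|) * (q * A)) ^ (1 : ℝ) := Real.rpow_le_rpow_of_exponent_le h7 he1
        _ = _ := by simp
    calc c₁ * (c₁ * q * A) ^ e ≤ |c₁ * (c₁ * q * A) ^ e| := le_abs_self _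
      _ = |c₁| * |(c₁ * q * A) ^ e| := abs_mul _ _
      _ ≤ (1 + |c₁|) * ((1 + |c₁|) * (q * A)) := by
        gcongr; linarith
      _ = _ := by ring

open NumberField in
lemma liouville_house (K : Type) [Field K] [NumberField K] (x : 𝓞 K) (hx : x ≠ 0) (ψ : K →+* ℂ)
    (H : ℝ) (hH : house ((algebraMap (𝓞 K) K) x) ≤ H) :
    1 ≤ ‖ψ (algebraMap (𝓞 K) K x)‖ * H ^ (Module.finrank ℚ K) := by
  have hx' : (algebraMap (𝓞 K) K x) ≠ 0 := by simpa using hx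
  have h1 := norm_norm_le_norm_mul_house_pow (algebraMap (𝓞 K) K x) ψ
  have hone := one_le_house_of_isIntegral (RingOfIntegers.isIntegral_coe x) hx'
  have h2 : 1 ≤ ‖Algebra.norm ℚ (algebraMap (𝓞 K) K x)‖ := by
    rw [← Algebra.coe_norm_int]
    have h3 : Algebra.norm ℤ x ≠ 0 := by
      rw [Algebra.norm_ne_zero_iff]; exact hx
    simp only [Int.norm_cast_rat, Int.norm_eq_abs]
    exact_mod_cast Int.one_le_abs h3
  refine h2.trans (h1.trans ?_)
  gcongr
  calc house ((algebraMap (𝓞 K) K) x) ^ (Module.finrank ℚ K - 1)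
      ≤ house ((algebraMap (𝓞 K) K) x) ^ (Module.finrank ℚ K) := pow_le_pow_right₀ hone (by omega)
    _ ≤ _ := by gcongr

lemma exp_diff_bound (h w W δ s : ℝ) (hh : |h| ≤ W) (hw : |w| ≤ W) (hd : |h - w| ≤ δ) (hs : 0 ≤ s) :
    |Real.exp (h * s) - Real.exp (w * s)| ≤ δ * s * Real.exp (W * s) := by
  have key : ∀ u v : ℝ, u ≤ W → v ≤ u → u - v ≤ δ →
      Real.exp (u * s) - Real.exp (v * s) ≤ δ * s * Real.exp (W * s) := by
    intro u v hu hvu huv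
    have h1 : Real.exp (v * s) = Real.exp (u * s) * Real.exp (-((u - v) * s)) := by
      rw [← Real.exp_add]; congr 1; ring
    have h2 := Real.add_one_le_exp (-((u - v) * s))
    have h3 : Real.exp (u * s) ≤ Real.exp (W * s) := by
      apply Real.exp_le_exp.2; gcongr
    have h4 := Real.exp_pos (u * s)
    have h5 : (u - v) * s ≤ δ * s := by gcongr
    have h6 : 0 ≤ (u - v) * s := mul_nonneg (by linarith) hs
    calc Real.exp (u * s) - Real.exp (v * s)
        = Real.exp (u * s) * (1 - Real.exp (-((u - v) * s))) := by rw [h1]; ring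
      _ ≤ Real.exp (u * s) * ((u - v) * s) := by gcongr; linarith
      _ ≤ Real.exp (W * s) * (δ * s) := by gcongr
      _ = _ := by ring
  rw [abs_le] at hh hw hd
  rcases le_total w h with hwh | hwh
  · have h1 : Real.exp (w * s) ≤ Real.exp (h * s) := by apply Real.exp_le_exp.2; gcongr
    rw [abs_of_nonneg (by linarith)]
    exact key h w hh.2 hwh (by linarith)
  · have h1 : Real.exp (h * s) ≤ Real.exp (w * s) := by apply Real.exp_le_exp.2; gcongr
    rw [abs_of_nonpos (by linarith)]
    have := key w h hw.2 hwh (by linarith)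
    linarith

lemma iteratedDeriv_expsum {ι : Type} [Fintype ι] (A w : ι → ℂ) (j : ℕ) :
    iteratedDeriv j (fun z : ℂ => ∑ i, A i * Complex.exp (w i * z)) =
      fun z => ∑ i, A i * w i ^ j * Complex.exp (w i * z) := by
  induction j with
  | zero => simp
  | succ j ih =>
    rw [iteratedDeriv_succ, ih]
    funext z
    apply HasDerivAt.deriv
    apply HasDerivAt.fun_sum
    intro i _
    have h1 : HasDerivAt (fun z : ℂ => w i * z) (w i) z := by
      simpa using (hasDerivAt_id z).const_mul (w i)
    have h2 := (h1.cexp).const_mul (A i * w i ^ j)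
    exact h2.congr_deriv (by ring)

open NumberField in
lemma baker_step (K : Type) [Field K] [NumberField K] (ψ : K →+* ℂ) {ι : Type} [Fintype ι]
    (p γ : ι → 𝓞 K) (x y : ι → ℤ) (h w : ι → ℝ) (b0 : ℤ) (hb0 : b0 ≠ 0) (l1 l2 : ℝ)
    (hw : ∀ i, w i = (x i * l1 + y i * l2) / b0)
    (G W δ P X c : ℝ) (hG : 1 ≤ G) (hGW : G ≤ Real.exp W) (hδ : 0 ≤ δ) (hX : 1 ≤ X) (hc1 : 1 ≤ c)
    (hc : |l1| + |l2| ≤ c) (hP : 1 ≤ P)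
    (hγ : ∀ i, ψ (algebraMap (𝓞 K) K (γ i)) = ((G * Real.exp (h i) : ℝ) : ℂ))
    (hhW : ∀ i, |h i| ≤ W) (hwW : ∀ i, |w i| ≤ W) (hhw : ∀ i, |h i - w i| ≤ δ)
    (hγh : ∀ i, house (algebraMap (𝓞 K) K (γ i)) ≤ Real.exp W)
    (hp : ∀ i, house (algebraMap (𝓞 K) K (p i)) ≤ P)
    (hx : ∀ i, |(x i : ℝ)| ≤ X) (hy : ∀ i, |(y i : ℝ)| ≤ X)
    (S T S' : ℕ) (hS : 1 ≤ S) (hT : 1 ≤ T) (hSS : S ≤ S')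
    (Z : ℝ) (hZ : Z = Fintype.card ι * (P * X ^ (4 * T)))
    (hnum : Real.exp (W * S') * ((2 / 3) ^ (S * T) * (Z * Real.exp (W * (4 * S')))
        + 2 * (c ^ T * (Z * (δ * S * Real.exp (W * S))) *
            (((S * T : ℕ) : ℝ) ^ (5 * (S * T) ^ 2) * (4 * S' : ℝ) ^ (S * T)))
        + Z * (δ * S' * Real.exp (W * S'))) * (Z * Real.exp (W * S')) ^ (Module.finrank ℚ K) < 1)
    (hvan : ∀ m1 < 2 * T, ∀ m2 < 2 * T, ∀ s < S,
      ∑ i, p i * (x i : 𝓞 K) ^ m1 * (y i : 𝓞 K) ^ m2 * γ i ^ s = 0) :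
    ∀ m1 < T, ∀ m2 < T, ∀ s < S',
      ∑ i, p i * (x i : 𝓞 K) ^ m1 * (y i : 𝓞 K) ^ m2 * γ i ^ s = 0 := by
  classical
  set φ : 𝓞 K → ℂ := fun t => ψ (algebraMap (𝓞 K) K t) with hφ
  have hφp : ∀ i, ‖φ (p i)‖ ≤ P := fun i => (norm_embedding_le_house _ ψ).trans (hp i)
  have hW0 : 0 ≤ W := by
    have := hG.trans hGW
    exact Real.one_le_exp_iff.1 this
  have hXpow : ∀ m1 < 2 * T, ∀ m2 < 2 * T, ∀ i,
      |(x i : ℝ)| ^ m1 * |(y i : ℝ)| ^ m2 ≤ X ^ (4 * T) := by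
    intro m1 h1 m2 h2 i
    calc |(x i : ℝ)| ^ m1 * |(y i : ℝ)| ^ m2 ≤ X ^ m1 * X ^ m2 := by
          gcongr
          · exact hx i
          · exact hy i
      _ = X ^ (m1 + m2) := by rw [pow_add]
      _ ≤ X ^ (4 * T) := pow_le_pow_right₀ hX (by omega)
  let co : ℕ → ℕ → ι → ℂ := fun m1 m2 i => φ (p i) * (x i : ℂ) ^ m1 * (y i : ℂ) ^ m2
  have hco : ∀ m1 < 2 * T, ∀ m2 < 2 * T, ∀ i, ‖co m1 m2 i‖ ≤ P * X ^ (4 * T) := by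
    intro m1 h1 m2 h2 i
    simp only [co, norm_mul, norm_pow, Complex.norm_intCast, mul_assoc]
    have := hXpow m1 h1 m2 h2 i
    gcongr
    exact hφp i
  have hsum : ∀ (v : ι → ℂ) (M : ℝ), 0 ≤ M → ∀ m1 < 2 * T, ∀ m2 < 2 * T, (∀ i, ‖v i‖ ≤ M) →
      ‖∑ i, co m1 m2 i * v i‖ ≤ Z * M := by
    intro v M hM m1 h1 m2 h2 hv
    refine (norm_sum_le _ _).trans ?_
    refine (Finset.sum_le_card_nsmul _ _ ((P * X ^ (4 * T)) * M) ?_).trans ?_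
    · intro i _
      rw [norm_mul]
      have := hco m1 h1 m2 h2 i
      have := hv i
      gcongr
    · exact le_of_eq (by rw [Finset.card_univ, nsmul_eq_mul, hZ]; ring)
  have hZ0 : 0 ≤ Z := by rw [hZ]; positivity
  let f : ℕ → ℕ → ℂ → ℂ := fun m1 m2 z => ∑ i, co m1 m2 i * Complex.exp ((w i : ℂ) * z)
  have hfd : ∀ m1 m2, Differentiable ℂ (f m1 m2) := by
    intro m1 m2
    simp only [f]
    fun_prop
  have hfb : ∀ m1 < 2 * T, ∀ m2 < 2 * T, ∀ z, ‖f m1 m2 z‖ ≤ Z * Real.exp (W * ‖z‖) := by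
    intro m1 h1 m2 h2 z
    apply hsum _ _ (Real.exp_pos _).le m1 h1 m2 h2
    intro i
    rw [Complex.norm_exp]
    apply Real.exp_le_exp.2
    refine (Complex.re_le_norm _).trans ?_
    rw [norm_mul]
    gcongr
    simpa using hwW i
  have hξ : ∀ (m1 m2 s : ℕ), φ (∑ i, p i * (x i : 𝓞 K) ^ m1 * (y i : 𝓞 K) ^ m2 * γ i ^ s)
      = (G : ℂ) ^ s * ∑ i, co m1 m2 i * ((Real.exp (h i * s) : ℝ) : ℂ) := by
    intro m1 m2 s
    simp only [hφ, map_sum, map_mul, map_pow, map_intCast, hγ]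
    rw [Finset.mul_sum]
    refine Finset.sum_congr rfl fun i _ => ?_
    have : ((Real.exp (h i * s) : ℝ) : ℂ) = ((Real.exp (h i) : ℝ) : ℂ) ^ s := by
      rw [mul_comm, Real.exp_nat_mul]; push_cast; rfl
    rw [this]
    simp only [co, hφ]
    push_cast
    ring
  have hdiff : ∀ m1 < 2 * T, ∀ m2 < 2 * T, ∀ s : ℕ, 
      ‖(∑ i, co m1 m2 i * ((Real.exp (h i * s) : ℝ) : ℂ)) - f m1 m2 s‖
        ≤ Z * (δ * s * Real.exp (W * s)) := by
    intro m1 h1 m2 h2 s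
    have h3 : (∑ i, co m1 m2 i * ((Real.exp (h i * s) : ℝ) : ℂ)) - f m1 m2 s =
        ∑ i, co m1 m2 i * ((Real.exp (h i * s) - Real.exp (w i * s) : ℝ) : ℂ) := by
      simp only [f]
      rw [← Finset.sum_sub_distrib]
      refine Finset.sum_congr rfl fun i _ => ?_
      push_cast
      ring
    rw [h3]
    apply hsum _ _ (by positivity) m1 h1 m2 h2
    intro i
    rw [Complex.norm_real, Real.norm_eq_abs]
    exact exp_diff_bound _ _ _ _ _ (hhW i) (hwW i) (hhw i) (Nat.cast_nonneg s)
  have hfs : ∀ m1 < 2 * T, ∀ m2 < 2 * T, ∀ s < S,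
      ‖f m1 m2 s‖ ≤ Z * (δ * S * Real.exp (W * S)) := by
    intro m1 h1 m2 h2 s hs
    have h3 := hξ m1 m2 s
    rw [hvan m1 h1 m2 h2 s hs] at h3
    have h4 : (G : ℂ) ^ s ≠ 0 := pow_ne_zero _ (by exact_mod_cast (by linarith : G ≠ 0))
    have h5 : ∑ i, co m1 m2 i * ((Real.exp (h i * s) : ℝ) : ℂ) = 0 := by
      simpa [hφ, h4] using h3
    have h6 := hdiff m1 h1 m2 h2 s
    rw [h5, zero_sub, norm_neg] at h6
    refine h6.trans ?_
    have : (s : ℝ) ≤ S := by exact_mod_cast hs.le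
    gcongr
  set η := c ^ T * (Z * (δ * S * Real.exp (W * S))) with hη
  have hη0 : 0 ≤ η := by positivity
  have hb0r : (1 : ℝ) ≤ |(b0 : ℝ)| := by exact_mod_cast Int.one_le_abs hb0
  have hder : ∀ m1 < T, ∀ m2 < T, ∀ s < S, ∀ j < T, ‖iteratedDeriv j (f m1 m2) (s : ℂ)‖ ≤ η := by
    intro m1 h1 m2 h2 s hs j hj
    have h3 : iteratedDeriv j (f m1 m2) (s : ℂ) = ∑ r ∈ Finset.range (j + 1),
        (((b0 : ℂ)⁻¹) ^ j * (l1 : ℂ) ^ r * (l2 : ℂ) ^ (j - r) * (j.choose r : ℂ)) *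
          f (m1 + r) (m2 + (j - r)) s := by
      simp only [f]
      rw [iteratedDeriv_expsum]
      simp only [Finset.mul_sum]
      rw [Finset.sum_comm]
      refine Finset.sum_congr rfl fun i _ => ?_
      have h4 : (w i : ℂ) ^ j = ((b0 : ℂ)⁻¹) ^ j * ((x i : ℂ) * l1 + y i * l2) ^ j := by
        rw [hw i]; push_cast; rw [div_eq_mul_inv, mul_pow]; ring
      rw [h4, add_pow, Finset.mul_sum, Finset.mul_sum, Finset.sum_mul]
      refine Finset.sum_congr rfl fun r _ => ?_
      simp only [co, mul_pow, pow_add]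
      ring
    rw [h3]
    have h5 : ∀ r ∈ Finset.range (j + 1), ‖(((b0 : ℂ)⁻¹) ^ j * (l1 : ℂ) ^ r * (l2 : ℂ) ^ (j - r) *
        (j.choose r : ℂ)) * f (m1 + r) (m2 + (j - r)) s‖ ≤
        (|l1| ^ r * |l2| ^ (j - r) * (j.choose r : ℝ)) * (Z * (δ * S * Real.exp (W * S))) := by
      intro r hr
      have hr' := Finset.mem_range.1 hr
      rw [norm_mul]
      have h6 := hfs (m1 + r) (by omega) (m2 + (j - r)) (by omega) s hs
      have h7 : ‖((b0 : ℂ)⁻¹) ^ j * (l1 : ℂ) ^ r * (l2 : ℂ) ^ (j - r) * (j.choose r : ℂ)‖ ≤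
          |l1| ^ r * |l2| ^ (j - r) * (j.choose r : ℝ) := by
        simp only [norm_mul, norm_pow, norm_inv, Complex.norm_intCast, Complex.norm_real,
          Complex.norm_natCast, Real.norm_eq_abs]
        have h8 : (|(b0 : ℝ)|⁻¹) ^ j ≤ 1 := pow_le_one₀ (by positivity) (inv_le_one_of_one_le₀ hb0r)
        calc _ ≤ 1 * |l1| ^ r * |l2| ^ (j - r) * (j.choose r : ℝ) := by gcongr
          _ = _ := by ring
      gcongr
    refine (norm_sum_le _ _).trans ((Finset.sum_le_sum h5).trans ?_)
    rw [← Finset.sum_mul, ← add_pow, hη]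
    gcongr
    calc (|l1| + |l2|) ^ j ≤ c ^ j := by gcongr
      _ ≤ c ^ T := pow_le_pow_right₀ hc1 hj.le
  intro m1 h1 m2 h2 s hs
  by_contra hne
  have hsS : (s : ℝ) ≤ S' := by exact_mod_cast hs.le
  have hfx := approx_schwarz S T S' hS hT hSS (f m1 m2) (hfd m1 m2) η (Z * Real.exp (W * (4 * S'))) hη0
    (hder m1 h1 m2 h2) (by
      intro z hz
      refine (hfb m1 (by omega) m2 (by omega) z).trans ?_
      gcongr) (s : ℂ) (by simpa using hsS)
  have hd2 := hdiff m1 (by omega) m2 (by omega) s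
  have hval : ‖φ (∑ i, p i * (x i : 𝓞 K) ^ m1 * (y i : 𝓞 K) ^ m2 * γ i ^ s)‖ ≤
      Real.exp (W * S') * ((2 / 3) ^ (S * T) * (Z * Real.exp (W * (4 * S')))
        + 2 * (η * (((S * T : ℕ) : ℝ) ^ (5 * (S * T) ^ 2) * (4 * S' : ℝ) ^ (S * T)))
        + Z * (δ * S' * Real.exp (W * S'))) := by
    rw [hξ, norm_mul, norm_pow, Complex.norm_real, Real.norm_eq_abs, abs_of_nonneg (by linarith)]
    have hGs : G ^ s ≤ Real.exp (W * S') := by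
      calc G ^ s ≤ Real.exp W ^ s := by gcongr
        _ = Real.exp (W * s) := by rw [mul_comm, Real.exp_nat_mul]
        _ ≤ _ := by gcongr
    have h5 : Z * (δ * s * Real.exp (W * s)) ≤ Z * (δ * S' * Real.exp (W * S')) := by gcongr
    apply mul_le_mul hGs _ (norm_nonneg _) (Real.exp_pos _).le
    have h6 := norm_le_insert' (∑ i, co m1 m2 i * ((Real.exp (h i * s) : ℝ) : ℂ)) (f m1 m2 s)
    linarith
  have hhouse : house (algebraMap (𝓞 K) K (∑ i, p i * (x i : 𝓞 K) ^ m1 * (y i : 𝓞 K) ^ m2 * γ i ^ s))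
      ≤ Z * Real.exp (W * S') := by
    rw [map_sum]
    refine (house_sum_le_sum_house _ _).trans ?_
    refine (Finset.sum_le_card_nsmul _ _ ((P * X ^ (4 * T)) * Real.exp (W * S')) ?_).trans ?_
    · intro i _
      simp only [map_mul, map_pow, map_intCast]
      have e1 : house ((x i : K) ^ m1) ≤ |(x i : ℝ)| ^ m1 :=
        (house_pow_le _ _).trans (by simp)
      have e2 : house ((y i : K) ^ m2) ≤ |(y i : ℝ)| ^ m2 :=
        (house_pow_le _ _).trans (by simp)
      have e3 : house ((algebraMap (𝓞 K) K (γ i)) ^ s) ≤ Real.exp (W * S') := by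
        refine (house_pow_le _ _).trans ?_
        calc house (algebraMap (𝓞 K) K (γ i)) ^ s ≤ Real.exp W ^ s := by
              gcongr
              · exact house_nonneg _
              · exact hγh i
          _ = Real.exp (W * s) := by rw [mul_comm, Real.exp_nat_mul]
          _ ≤ _ := by gcongr
      have e4 := hXpow m1 (by omega) m2 (by omega) i
      calc house (algebraMap (𝓞 K) K (p i) * (x i : K) ^ m1 * (y i : K) ^ m2 * algebraMap (𝓞 K) K (γ i) ^ s)
          ≤ house (algebraMap (𝓞 K) K (p i)) * house ((x i : K) ^ m1) * house ((y i : K) ^ m2) *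
            house (algebraMap (𝓞 K) K (γ i) ^ s) := by
            refine (house_mul_le _ _).trans ?_
            gcongr
            · exact house_nonneg _
            refine (house_mul_le _ _).trans ?_
            gcongr
            · exact house_nonneg _
            exact house_mul_le _ _
        _ ≤ P * |(x i : ℝ)| ^ m1 * |(y i : ℝ)| ^ m2 * Real.exp (W * S') := by
            have := hp i
            have n1 := house_nonneg (algebraMap (𝓞 K) K (p i))
            have n2 := house_nonneg ((x i : K) ^ m1)
            have n3 := house_nonneg ((y i : K) ^ m2)
            have n4 := house_nonneg (algebraMap (𝓞 K) K (γ i) ^ s)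
            gcongr
        _ = P * (|(x i : ℝ)| ^ m1 * |(y i : ℝ)| ^ m2) * Real.exp (W * S') := by ring
        _ ≤ _ := by gcongr
    · exact le_of_eq (by rw [Finset.card_univ, nsmul_eq_mul, hZ]; ring)
  have hl := liouville_house K _ hne ψ _ hhouse
  have hfin : (1 : ℝ) < 1 := by
    refine lt_of_le_of_lt (hl.trans ?_) hnum
    gcongr
  exact lt_irrefl _ hfin

lemma hnum_aux (D N S S' T : ℕ) (W Z δ c a b g R : ℝ) (ha : 0 ≤ a) (hδ0 : 0 ≤ δ) (hZ0 : 0 ≤ Z)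
    (hW0 : 0 ≤ W) (hc0 : 0 ≤ c) (hR0 : 0 ≤ R) (hSS : S ≤ S')
    (hW : W * (4 * S') ≤ a) (hZ : Z ≤ Real.exp a) (hδ : δ ≤ Real.exp (-g))
    (hb : c ^ T * S * R ≤ Real.exp b) (hb' : (S' : ℝ) ≤ Real.exp b)
    (h1 : (4 + 2 * D) * a + 2 ≤ N / 3) (h2 : (4 + 2 * D) * a + b + 2 ≤ g) :
    Real.exp (W * S') * ((2 / 3) ^ N * (Z * Real.exp (W * (4 * S')))
        + 2 * (c ^ T * (Z * (δ * S * Real.exp (W * S))) * R)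
        + Z * (δ * S' * Real.exp (W * S'))) * (Z * Real.exp (W * S')) ^ D < 1 := by
  have hWS' : W * S' ≤ a := by
    have : 0 ≤ W * S' := by positivity
    linarith
  have hWS : W * S ≤ a := by
    have : (S : ℝ) ≤ S' := by exact_mod_cast hSS
    have : W * S ≤ W * S' := by gcongr
    linarith
  have e1 : Real.exp (W * S') ≤ Real.exp a := Real.exp_le_exp.2 hWS'
  have e2 : Real.exp (W * S) ≤ Real.exp a := Real.exp_le_exp.2 hWS
  have e3 : Real.exp (W * (4 * S')) ≤ Real.exp a := Real.exp_le_exp.2 hW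
  have e4 : ((2 : ℝ) / 3) ^ N ≤ Real.exp (-(N / 3)) := by
    have : (2 : ℝ) / 3 ≤ Real.exp (-(1 / 3)) := by
      have := Real.add_one_le_exp (-(1 / 3) : ℝ); linarith
    calc ((2 : ℝ) / 3) ^ N ≤ (Real.exp (-(1 / 3))) ^ N := by gcongr
      _ = _ := by rw [← Real.exp_nat_mul]; congr 1; ring
  have e5 : (Z * Real.exp (W * S')) ^ D ≤ Real.exp (2 * D * a) := by
    calc (Z * Real.exp (W * S')) ^ D ≤ (Real.exp a * Real.exp a) ^ D := by gcongr
      _ = _ := by rw [← Real.exp_add, ← Real.exp_nat_mul]; congr 1; ring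
  have t1 : (2 / 3) ^ N * (Z * Real.exp (W * (4 * S'))) ≤ Real.exp (-(N / 3)) * (Real.exp a * Real.exp a) := by
    gcongr
  have t2 : 2 * (c ^ T * (Z * (δ * S * Real.exp (W * S))) * R) ≤
      2 * ((Real.exp b) * (Real.exp a * (Real.exp (-g) * Real.exp a))) := by
    calc 2 * (c ^ T * (Z * (δ * S * Real.exp (W * S))) * R)
        = 2 * ((c ^ T * S * R) * (Z * (δ * Real.exp (W * S)))) := by ring
      _ ≤ _ := by gcongr
  have t3 : Z * (δ * S' * Real.exp (W * S')) ≤ Real.exp a * (Real.exp (-g) * Real.exp b * Real.exp a) := by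
    gcongr
  have main : Real.exp (W * S') * ((2 / 3) ^ N * (Z * Real.exp (W * (4 * S')))
        + 2 * (c ^ T * (Z * (δ * S * Real.exp (W * S))) * R)
        + Z * (δ * S' * Real.exp (W * S'))) * (Z * Real.exp (W * S')) ^ D ≤
      Real.exp a * (Real.exp (-(N / 3)) * (Real.exp a * Real.exp a) +
        2 * ((Real.exp b) * (Real.exp a * (Real.exp (-g) * Real.exp a))) +
        Real.exp a * (Real.exp (-g) * Real.exp b * Real.exp a)) * Real.exp (2 * D * a) := by
    gcongr
  have eq : Real.exp a * (Real.exp (-(N / 3)) * (Real.exp a * Real.exp a) +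
        2 * ((Real.exp b) * (Real.exp a * (Real.exp (-g) * Real.exp a))) +
        Real.exp a * (Real.exp (-g) * Real.exp b * Real.exp a)) * Real.exp (2 * D * a) =
      Real.exp ((3 + 2 * D) * a - N / 3) + 3 * Real.exp ((3 + 2 * D) * a + b - g) := by
    have q1 : Real.exp ((3 + 2 * D) * a - N / 3) =
        Real.exp a * (Real.exp (-(N / 3)) * (Real.exp a * Real.exp a)) * Real.exp (2 * D * a) := by
      simp only [← Real.exp_add]; congr 1; ring
    have q2 : Real.exp ((3 + 2 * D) * a + b - g) =
        Real.exp a * (Real.exp a * (Real.exp (-g) * Real.exp b * Real.exp a)) * Real.exp (2 * D * a) := by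
      simp only [← Real.exp_add]; congr 1; ring
    rw [q1, q2]; ring
  rw [eq] at main
  have f1 : Real.exp ((3 + 2 * D) * a - N / 3) ≤ Real.exp (-2) := by
    apply Real.exp_le_exp.2; nlinarith
  have f2 : Real.exp ((3 + 2 * D) * a + b - g) ≤ Real.exp (-2) := by
    apply Real.exp_le_exp.2; nlinarith
  have f3 : Real.exp (-2) < 1 / 4 := by
    have h := Real.exp_one_gt_d9
    have : Real.exp (2 : ℝ) = Real.exp 1 * Real.exp 1 := by rw [← Real.exp_add]; norm_num
    rw [Real.exp_neg, this, ← one_div]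
    apply one_div_lt_one_div_of_lt (by norm_num); nlinarith
  linarith

lemma pow_le_exp_aux (x : ℝ) (hx : 0 ≤ x) (n : ℕ) : x ^ n ≤ Real.exp (n * x) := by
  rw [Real.exp_nat_mul]
  gcongr
  linarith [Real.add_one_le_exp x]

set_option maxHeartbeats 1600000 in
lemma step_numeric (D : ℕ) (w0 C1 c : ℝ) (hw0 : 1 ≤ w0) (hC1 : 1 ≤ C1) (hc : 1 ≤ c) :
    ∃ V0 : ℕ, 1 ≤ V0 ∧ ∀ V : ℕ, V0 ≤ V → ∀ k < 38, ∀ (S T S' : ℕ) (W P X δ Z : ℝ),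
      S = V ^ (10 + k) → T = 2 ^ (37 - k) * V ^ 18 → S' = V ^ (11 + k) → W = w0 * (V : ℝ) ^ 16 →
      P = Real.exp (C1 * (V : ℝ) ^ 26) → X = (V : ℝ) ^ 220 → 0 ≤ δ →
      δ ≤ (V : ℝ) ^ 16 * Real.exp (-(V : ℝ) ^ 199) →
      Z = (V : ℝ) ^ 48 * (P * X ^ (4 * T)) →
      Real.exp (W * S') * ((2 / 3) ^ (S * T) * (Z * Real.exp (W * (4 * S')))
        + 2 * (c ^ T * (Z * (δ * S * Real.exp (W * S))) *
            (((S * T : ℕ) : ℝ) ^ (5 * (S * T) ^ 2) * (4 * S' : ℝ) ^ (S * T)))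
        + Z * (δ * S' * Real.exp (W * S'))) * (Z * Real.exp (W * S')) ^ D < 1 := by
  set C : ℝ := C1 + 48 + 880 * 2 ^ 37 + 4 * w0 with hC
  set C' : ℝ := 5 * 2 ^ 111 + 4 * 2 ^ 37 + c * 2 ^ 37 + 1 with hC'
  obtain ⟨V0, hV0⟩ := exists_nat_ge (3 * ((4 + 2 * D) * C + 2) + C' + 1 + 1)
  have hDC : 0 ≤ (4 + 2 * (D : ℝ)) * C := by positivity
  have hC'0 : 0 ≤ C' := by positivity
  have hV01 : (1 : ℝ) ≤ V0 := by linarith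
  refine ⟨V0, by exact_mod_cast hV01, ?_⟩
  intro V hV k hk S T S' W P X δ Z hS hT hS' hW hP hX hδ0 hδ hZ
  have hVr : (V0 : ℝ) ≤ V := by exact_mod_cast hV
  have hV1 : (1 : ℝ) ≤ V := hV01.trans hVr
  have hVpos : 1 ≤ V := by exact_mod_cast hV1
  have hpw : ∀ {m n : ℕ}, m ≤ n → (V : ℝ) ^ m ≤ (V : ℝ) ^ n := fun h => pow_le_pow_right₀ hV1 h
  have hSr : (S : ℝ) = (V : ℝ) ^ (10 + k) := by rw [hS]; push_cast; rfl
  have hSr' : (S' : ℝ) = (V : ℝ) ^ (11 + k) := by rw [hS']; push_cast; rfl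
  have hTr : (T : ℝ) = 2 ^ (37 - k) * (V : ℝ) ^ 18 := by rw [hT]; push_cast; rfl
  have h2k : (2 : ℝ) ^ (37 - k) ≤ 2 ^ 37 := pow_le_pow_right₀ (by norm_num) (by omega)
  have h2k1 : (1 : ℝ) ≤ (2 : ℝ) ^ (37 - k) := one_le_pow₀ (by norm_num)
  have hTle : (T : ℝ) ≤ 2 ^ 37 * (V : ℝ) ^ 18 := by rw [hTr]; gcongr
  have hNr : ((S * T : ℕ) : ℝ) = 2 ^ (37 - k) * (V : ℝ) ^ (28 + k) := by
    push_cast; rw [hSr, hTr]; ring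
  have hNle : ((S * T : ℕ) : ℝ) ≤ 2 ^ 37 * (V : ℝ) ^ 65 := by
    rw [hNr]; exact mul_le_mul h2k (hpw (by omega)) (by positivity) (by positivity)
  have hNge : (V : ℝ) ^ (28 + k) ≤ ((S * T : ℕ) : ℝ) := by
    rw [hNr]; nlinarith [pow_pos (show (0:ℝ) < V by linarith) (28 + k)]
  have hZle : Z ≤ Real.exp (48 * V + (C1 * (V : ℝ) ^ 26 + 880 * 2 ^ 37 * (V : ℝ) ^ 19)) := by
    rw [hZ, hP, hX, Real.exp_add, Real.exp_add, ← pow_mul]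
    have q1 := pow_le_exp_aux V (by positivity) 48
    have q2 := pow_le_exp_aux V (by positivity) (220 * (4 * T))
    have q3 : Real.exp (((220 * (4 * T) : ℕ) : ℝ) * V) ≤ Real.exp (880 * 2 ^ 37 * (V : ℝ) ^ 19) := by
      apply Real.exp_le_exp.2
      push_cast
      calc 220 * (4 * (T : ℝ)) * V ≤ 220 * (4 * (2 ^ 37 * (V : ℝ) ^ 18)) * V := by gcongr
        _ = _ := by ring
    push_cast at q1
    gcongr
    exact q2.trans q3
  set a := C * (V : ℝ) ^ (27 + k) with ha
  have ha0 : 0 ≤ a := by positivity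
  have hZa : Z ≤ Real.exp a := by
    refine hZle.trans (Real.exp_le_exp.2 ?_)
    have r1 : (V : ℝ) ≤ (V : ℝ) ^ (27 + k) := by simpa using hpw (m := 1) (n := 27 + k) (by omega)
    have r2 : (V : ℝ) ^ 26 ≤ (V : ℝ) ^ (27 + k) := hpw (by omega)
    have r3 : (V : ℝ) ^ 19 ≤ (V : ℝ) ^ (27 + k) := hpw (by omega)
    calc 48 * (V : ℝ) + (C1 * (V : ℝ) ^ 26 + 880 * 2 ^ 37 * (V : ℝ) ^ 19)
        ≤ 48 * (V : ℝ) ^ (27 + k) + (C1 * (V : ℝ) ^ (27 + k) + 880 * 2 ^ 37 * (V : ℝ) ^ (27 + k)) := by gcongr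
      _ = (C - 4 * w0) * (V : ℝ) ^ (27 + k) := by rw [hC]; ring
      _ ≤ _ := by rw [ha]; gcongr; linarith
  have hWa : W * (4 * S') ≤ a := by
    rw [hW, hSr', ha]
    calc w0 * (V : ℝ) ^ 16 * (4 * (V : ℝ) ^ (11 + k)) = (4 * w0) * (V : ℝ) ^ (27 + k) := by ring
      _ ≤ _ := by gcongr; rw [hC]; linarith
  set b := C' * (V : ℝ) ^ 195 with hb
  have hSle : (S : ℝ) ≤ Real.exp ((V : ℝ) ^ 195) := by
    have : (S : ℝ) ≤ (V : ℝ) ^ 195 := by rw [hSr]; exact hpw (by omega)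
    linarith [Real.add_one_le_exp ((V : ℝ) ^ 195)]
  have hS'le : (S' : ℝ) ≤ Real.exp ((V : ℝ) ^ 195) := by
    have : (S' : ℝ) ≤ (V : ℝ) ^ 195 := by rw [hSr']; exact hpw (by omega)
    linarith [Real.add_one_le_exp ((V : ℝ) ^ 195)]
  have hcT : c ^ T ≤ Real.exp (c * 2 ^ 37 * (V : ℝ) ^ 195) := by
    refine (pow_le_exp_aux c (by linarith) T).trans (Real.exp_le_exp.2 ?_)
    calc (T : ℝ) * c ≤ (2 ^ 37 * (V : ℝ) ^ 18) * c := by gcongr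
      _ ≤ (2 ^ 37 * (V : ℝ) ^ 195) * c := by gcongr <;> first | exact hV1 | norm_num
      _ = _ := by ring
  have hR1 : ((S * T : ℕ) : ℝ) ^ (5 * (S * T) ^ 2) ≤ Real.exp (5 * 2 ^ 111 * (V : ℝ) ^ 195) := by
    refine (pow_le_exp_aux _ (by positivity) _).trans (Real.exp_le_exp.2 ?_)
    calc ((5 * (S * T) ^ 2 : ℕ) : ℝ) * ((S * T : ℕ) : ℝ) = 5 * ((S * T : ℕ) : ℝ) ^ 3 := by
          push_cast; ring
      _ ≤ 5 * (2 ^ 37 * (V : ℝ) ^ 65) ^ 3 := by gcongr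
      _ = _ := by ring
  have hR2 : (4 * S' : ℝ) ^ (S * T) ≤ Real.exp (4 * 2 ^ 37 * (V : ℝ) ^ 195) := by
    refine (pow_le_exp_aux _ (by positivity) _).trans (Real.exp_le_exp.2 ?_)
    calc ((S * T : ℕ) : ℝ) * (4 * S') ≤ (2 ^ 37 * (V : ℝ) ^ 65) * (4 * (V : ℝ) ^ 130) := by
          rw [hSr']
          gcongr ?_ * (4 * ?_)
          exact hpw (by omega)
      _ = _ := by ring
  have hbb : c ^ T * S * (((S * T : ℕ) : ℝ) ^ (5 * (S * T) ^ 2) * (4 * S' : ℝ) ^ (S * T)) ≤ Real.exp b := by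
    have : b = c * 2 ^ 37 * (V : ℝ) ^ 195 + (V : ℝ) ^ 195 + (5 * 2 ^ 111 * (V : ℝ) ^ 195 +
        4 * 2 ^ 37 * (V : ℝ) ^ 195) := by rw [hb, hC']; ring
    rw [this, Real.exp_add, Real.exp_add, Real.exp_add]
    gcongr
  have hC'1 : 1 ≤ C' := by rw [hC']; nlinarith
  have hVV : 3 * ((4 + 2 * D) * C + 2) + C' + 1 + 1 ≤ (V : ℝ) := hV0.trans hVr
  refine hnum_aux D (S * T) S S' T W Z δ c a b ((V : ℝ) ^ 199 - (V : ℝ) ^ 16) _ ha0 hδ0 ?_ ?_ (by linarith)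
    (by positivity) ?_ hWa hZa ?_ hbb ?_ ?_ ?_
  · rw [hZ, hP, hX]; positivity
  · rw [hW]; positivity
  · rw [hS, hS']; exact Nat.pow_le_pow_right hVpos (by omega)
  · refine hδ.trans ?_
    rw [neg_sub, sub_eq_add_neg, Real.exp_add]
    gcongr
    linarith [Real.add_one_le_exp ((V : ℝ) ^ 16)]
  · refine hS'le.trans (Real.exp_le_exp.2 ?_)
    rw [hb]; nlinarith [pow_pos (show (0:ℝ) < V by linarith) 195]
  · have r0 : (1 : ℝ) ≤ (V : ℝ) ^ (27 + k) := one_le_pow₀ hV1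
    have : 3 * ((4 + 2 * D) * a + 2) ≤ (V : ℝ) ^ (28 + k) := by
      calc 3 * ((4 + 2 * D) * a + 2) ≤ 3 * ((4 + 2 * D) * a + 2 * (V : ℝ) ^ (27 + k)) := by gcongr; linarith
        _ = (3 * ((4 + 2 * D) * C + 2)) * (V : ℝ) ^ (27 + k) := by rw [ha]; ring
        _ ≤ V * (V : ℝ) ^ (27 + k) := by gcongr; linarith
        _ = _ := by ring
    linarith
  · have r0 : (1 : ℝ) ≤ (V : ℝ) ^ 195 := one_le_pow₀ hV1
    have r1 : (V : ℝ) ^ (27 + k) ≤ (V : ℝ) ^ 195 := hpw (by omega)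
    have r2 : (V : ℝ) ^ 16 ≤ (V : ℝ) ^ 195 := hpw (by omega)
    have r3 : (V : ℝ) ^ 196 ≤ (V : ℝ) ^ 199 := hpw (by omega)
    have r4 : (4 + 2 * D) * a ≤ (4 + 2 * D) * C * (V : ℝ) ^ 195 := by
      rw [ha, mul_assoc]; gcongr
    have : ((4 + 2 * D) * C + C' + 2 + 1) * (V : ℝ) ^ 195 ≤ V * (V : ℝ) ^ 195 := by
      gcongr; linarith
    have e : V * (V : ℝ) ^ 195 = (V : ℝ) ^ 196 := (pow_succ' _ _).symm
    rw [hb]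
    have e2 : ((4 + 2 * D) * C + C' + 2 + 1) * (V : ℝ) ^ 195 = (4 + 2 * D) * C * (V : ℝ) ^ 195 + C' * (V : ℝ) ^ 195 + 2 * (V : ℝ) ^ 195 + (V : ℝ) ^ 195 := by ring
    linarith

lemma vandermonde_fintype {R : Type} [CommRing R] [IsDomain R] {ι : Type} [Fintype ι] (f v : ι → R)
    (hf : Function.Injective f)
    (h : ∀ s < Fintype.card ι, ∑ i, v i * f i ^ s = 0) : v = 0 := by
  let e := Fintype.equivFin ι
  have h0 : (fun j => v (e.symm j)) = 0 := by
    apply Matrix.eq_zero_of_forall_pow_sum_mul_pow_eq_zero (f := fun j => f (e.symm j))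
      (hf.comp e.symm.injective)
    intro i
    have := h i i.2
    rw [← this]
    exact Equiv.sum_comp e.symm (fun j => v j * f j ^ (i : ℕ))
  funext i
  have := congrFun h0 (e i)
  simpa using this

set_option maxHeartbeats 1600000 in
open NumberField in
theorem baker_core (K : Type) [Field K] [NumberField K] (ψ : K →+* ℂ) (l0 l1 l2 : ℝ) (a : ℕ) (ha : 1 ≤ a)
    (β0 β1 β2 : 𝓞 K)
    (hβ0 : ψ (algebraMap (𝓞 K) K β0) = ((a * Real.exp l0 : ℝ) : ℂ))
    (hβ1 : ψ (algebraMap (𝓞 K) K β1) = ((a * Real.exp l1 : ℝ) : ℂ))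
    (hβ2 : ψ (algebraMap (𝓞 K) K β2) = ((a * Real.exp l2 : ℝ) : ℂ))
    (hind : ∀ z0 z1 z2 : ℤ, z0 * l0 + z1 * l1 + z2 * l2 = 0 → z0 = 0 ∧ z1 = 0 ∧ z2 = 0) :
    ∃ V0 : ℕ, ∀ V : ℕ, V0 ≤ V → ∀ b0 b1 b2 : ℤ, b0 ≠ 0 → |(b0 : ℝ)| ≤ (V : ℝ) ^ 200 →
      |(b1 : ℝ)| ≤ (V : ℝ) ^ 200 → |(b2 : ℝ)| ≤ (V : ℝ) ^ 200 →
      Real.exp (-(V : ℝ) ^ 199) ≤ |b0 * l0 + b1 * l1 + b2 * l2| := by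
  obtain ⟨cs, hcs1, hcs⟩ := siegel_const K
  set n0 := house (algebraMap (𝓞 K) K β0) with hn0
  set n1 := house (algebraMap (𝓞 K) K β1) with hn1
  set n2 := house (algebraMap (𝓞 K) K β2) with hn2
  have n0n : 0 ≤ n0 := house_nonneg _
  have n1n : 0 ≤ n1 := house_nonneg _
  have n2n : 0 ≤ n2 := house_nonneg _
  obtain ⟨H, hH⟩ : ∃ H, H = 1 + n0 + n1 + n2 := ⟨_, rfl⟩
  obtain ⟨lam, hlam⟩ : ∃ lam, lam = |l0| + |l1| + |l2| := ⟨_, rfl⟩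
  have hlam0 : 0 ≤ lam := by rw [hlam]; positivity
  have ha1 : (1 : ℝ) ≤ a := by exact_mod_cast ha
  have hH1 : 1 ≤ H := by linarith
  obtain ⟨w0, hw0⟩ : ∃ w0, w0 = lam + 1 + 3 * a + 3 * H := ⟨_, rfl⟩
  obtain ⟨C1, hC1⟩ : ∃ C1, C1 = cs + 48 + 440 * 2 ^ 38 + w0 := ⟨_, rfl⟩
  have hw01 : 1 ≤ w0 := by rw [hw0]; linarith
  have hC11 : 1 ≤ C1 := by rw [hC1]; linarith
  obtain ⟨V0, hV01, hstep⟩ := step_numeric (Module.finrank ℚ K) w0 C1 (lam + 1) hw01 hC11 (by linarith)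
  refine ⟨V0 + 2 ^ 40, ?_⟩
  intro V hV b0 b1 b2 hb0 hB0 hB1 hB2
  by_contra hcon
  push Not at hcon
  obtain ⟨Λ, hΛ⟩ : ∃ Λ : ℝ, Λ = b0 * l0 + b1 * l1 + b2 * l2 := ⟨_, rfl⟩
  rw [← hΛ] at hcon
  have hV40 : 2 ^ 40 ≤ V := by omega
  have hV2 : (2 : ℝ) ≤ V := by
    have : 2 ≤ V := le_trans (by norm_num) hV40
    exact_mod_cast this
  have hV1 : (1 : ℝ) ≤ V := by linarith
  have hVn : 1 ≤ V := by exact_mod_cast hV1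
  have hpw : ∀ {m n : ℕ}, m ≤ n → (V : ℝ) ^ m ≤ (V : ℝ) ^ n := fun h => pow_le_pow_right₀ hV1 h
  obtain ⟨L, hL⟩ : ∃ L, L = V ^ 16 := ⟨_, rfl⟩
  have hLr : (L : ℝ) = (V : ℝ) ^ 16 := by rw [hL]; push_cast; rfl
  have hL1 : (1 : ℝ) ≤ L := by rw [hLr]; exact one_le_pow₀ hV1
  let ι := Fin L × Fin L × Fin L
  have hcard : Fintype.card ι = V ^ 48 := by
    simp only [ι, Fintype.card_prod, Fintype.card_fin, hL]; ring
  let h : ι → ℝ := fun i => (i.1 : ℕ) * l0 + (i.2.1 : ℕ) * l1 + (i.2.2 : ℕ) * l2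
  let x : ι → ℤ := fun i => b0 * (i.2.1 : ℕ) - b1 * (i.1 : ℕ)
  let y : ι → ℤ := fun i => b0 * (i.2.2 : ℕ) - b2 * (i.1 : ℕ)
  let w : ι → ℝ := fun i => (x i * l1 + y i * l2) / b0
  let γ : ι → 𝓞 K := fun i => (a : 𝓞 K) ^ ((L - i.1) + (L - i.2.1) + (L - i.2.2)) *
    (β0 ^ (i.1 : ℕ) * β1 ^ (i.2.1 : ℕ) * β2 ^ (i.2.2 : ℕ))
  obtain ⟨G, hG⟩ : ∃ G : ℝ, G = (a : ℝ) ^ (3 * L) := ⟨_, rfl⟩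
  obtain ⟨W, hW⟩ : ∃ W : ℝ, W = w0 * (V : ℝ) ^ 16 := ⟨_, rfl⟩
  have hWL : W = w0 * L := by rw [hW, hLr]
  obtain ⟨δ, hδ⟩ : ∃ δ : ℝ, δ = (V : ℝ) ^ 16 * |Λ| := ⟨_, rfl⟩
  obtain ⟨P, hP⟩ : ∃ P : ℝ, P = Real.exp (C1 * (V : ℝ) ^ 26) := ⟨_, rfl⟩
  obtain ⟨X, hX⟩ : ∃ X : ℝ, X = (V : ℝ) ^ 220 := ⟨_, rfl⟩
  have hi : ∀ i : Fin L, ((i : ℕ) : ℝ) ≤ L := fun i => by exact_mod_cast i.2.le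
  have hb0r : (1 : ℝ) ≤ |(b0 : ℝ)| := by exact_mod_cast Int.one_le_abs hb0
  have hb0ne : (b0 : ℝ) ≠ 0 := by exact_mod_cast hb0
  have hG1 : 1 ≤ G := by rw [hG]; exact one_le_pow₀ ha1
  have hGW : G ≤ Real.exp W := by
    rw [hG]
    refine (pow_le_exp_aux _ (by linarith) _).trans (Real.exp_le_exp.2 ?_)
    rw [hWL, hw0]; push_cast; nlinarith
  have hδ0 : 0 ≤ δ := by rw [hδ]; positivity
  have hδle : δ ≤ (V : ℝ) ^ 16 * Real.exp (-(V : ℝ) ^ 199) := by rw [hδ]; gcongr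
  have hΛ1 : |Λ| ≤ 1 := by
    refine hcon.le.trans ?_
    rw [Real.exp_le_one_iff]; simp
  have hX1 : 1 ≤ X := by rw [hX]; exact one_le_pow₀ hV1
  have hP1 : 1 ≤ P := by rw [hP]; apply Real.one_le_exp; positivity
  have hγ : ∀ i, ψ (algebraMap (𝓞 K) K (γ i)) = ((G * Real.exp (h i) : ℝ) : ℂ) := by
    rintro ⟨i0, i1, i2⟩
    simp only [γ, h, map_mul, map_pow, map_natCast, hβ0, hβ1, hβ2]
    rw [hG, Real.exp_add, Real.exp_add, Real.exp_nat_mul, Real.exp_nat_mul, Real.exp_nat_mul]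
    have e : (a : ℂ) ^ (3 * L) = (a : ℂ) ^ ((L - i0) + (L - i1) + (L - i2)) *
        ((a : ℂ) ^ (i0 : ℕ) * (a : ℂ) ^ (i1 : ℕ) * (a : ℂ) ^ (i2 : ℕ)) := by
      rw [← pow_add, ← pow_add, ← pow_add]; congr 1
      have := i0.2; have := i1.2; have := i2.2; omega
    push_cast
    rw [e]; ring
  have hhL : ∀ i, |h i| ≤ lam * L := by
    rintro ⟨i0, i1, i2⟩
    simp only [h]
    refine (abs_add_three _ _ _).trans ?_
    simp only [abs_mul, Nat.abs_cast]
    have := hi i0; have := hi i1; have := hi i2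
    calc _ ≤ (L : ℝ) * |l0| + L * |l1| + L * |l2| := by gcongr
      _ = _ := by rw [hlam]; ring
  have hdiff : ∀ i, h i - w i = (i.1 : ℕ) * Λ / b0 := by
    rintro ⟨i0, i1, i2⟩
    simp only [h, w, x, y, hΛ]
    push_cast
    field_simp
    ring
  have hhw : ∀ i, |h i - w i| ≤ δ := by
    intro i
    rw [hdiff, abs_div, abs_mul, Nat.abs_cast, hδ, ← hLr]
    have := hi i.1
    refine (div_le_self (by positivity) hb0r).trans ?_
    gcongr
  have hδL : δ ≤ L := by rw [hδ, ← hLr]; nlinarith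
  have hhW : ∀ i, |h i| ≤ W := by
    intro i; refine (hhL i).trans ?_
    rw [hWL]; gcongr; rw [hw0]; linarith
  have hwW : ∀ i, |w i| ≤ W := by
    intro i
    have h1 := hhL i
    have h2 := (hhw i).trans hδL
    have h3 : |w i| ≤ |h i| + |h i - w i| := by
      have := abs_sub (h i) (h i - w i)
      simpa using this
    have : (lam + 1) * L ≤ W := by
      rw [hWL]; gcongr; rw [hw0]; linarith
    linarith
  have hpowH : ∀ (t : 𝓞 K), house (algebraMap (𝓞 K) K t) ≤ H → ∀ j : ℕ, j ≤ L →
      house (algebraMap (𝓞 K) K t ^ j) ≤ H ^ L := by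
    intro t ht j hj
    refine (house_pow_le _ _).trans ?_
    have := house_nonneg (algebraMap (𝓞 K) K t)
    calc _ ≤ H ^ j := by gcongr
      _ ≤ _ := pow_le_pow_right₀ hH1 hj
  have hγh : ∀ i, house (algebraMap (𝓞 K) K (γ i)) ≤ Real.exp W := by
    rintro ⟨i0, i1, i2⟩
    simp only [γ, map_mul, map_pow, map_natCast]
    have q0 := hpowH β0 (by rw [hH]; linarith) i0 i0.2.le
    have q1 := hpowH β1 (by rw [hH]; linarith) i1 i1.2.le
    have q2 := hpowH β2 (by rw [hH]; linarith) i2 i2.2.le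
    have q3 : house ((a : K) ^ ((L - i0) + (L - i1) + (L - i2))) ≤ (a : ℝ) ^ (3 * L) := by
      refine (house_pow_le _ _).trans ?_
      have hna : house (a : K) = a := by simpa using house_intCast (K := K) (a : ℤ)
      rw [hna]
      exact pow_le_pow_right₀ ha1 (by omega)
    have r0 := house_nonneg (algebraMap (𝓞 K) K β0 ^ (i0 : ℕ))
    have r1 := house_nonneg (algebraMap (𝓞 K) K β1 ^ (i1 : ℕ))
    have r2 := house_nonneg (algebraMap (𝓞 K) K β2 ^ (i2 : ℕ))
    have r3 := house_nonneg ((a : K) ^ ((L - i0) + (L - i1) + (L - i2)))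
    have s1 : house (algebraMap (𝓞 K) K β0 ^ (i0 : ℕ) * algebraMap (𝓞 K) K β1 ^ (i1 : ℕ)) ≤ H ^ L * H ^ L :=
      (house_mul_le _ _).trans (mul_le_mul q0 q1 r1 (by positivity))
    have s2 : house (algebraMap (𝓞 K) K β0 ^ (i0 : ℕ) * algebraMap (𝓞 K) K β1 ^ (i1 : ℕ) *
        algebraMap (𝓞 K) K β2 ^ (i2 : ℕ)) ≤ H ^ L * H ^ L * H ^ L :=
      (house_mul_le _ _).trans (mul_le_mul s1 q2 r2 (by positivity))
    refine (house_mul_le _ _).trans ((mul_le_mul q3 s2 (house_nonneg _) (by positivity)).trans ?_)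
    have t1 := pow_le_exp_aux (a : ℝ) (by linarith) (3 * L)
    have t2 := pow_le_exp_aux H (by linarith) (3 * L)
    calc (a : ℝ) ^ (3 * L) * (H ^ L * H ^ L * H ^ L) = (a : ℝ) ^ (3 * L) * H ^ (3 * L) := by ring
      _ ≤ Real.exp ((3 * L : ℕ) * a) * Real.exp ((3 * L : ℕ) * H) := by gcongr
      _ = Real.exp ((3 * a + 3 * H) * L) := by rw [← Real.exp_add]; congr 1; push_cast; ring
      _ ≤ _ := by
        apply Real.exp_le_exp.2; rw [hWL]; gcongr; rw [hw0]; linarith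
  have hxy : ∀ b : ℤ, |(b : ℝ)| ≤ (V : ℝ) ^ 200 → ∀ i j : Fin L,
      |((b0 * (i : ℕ) - b * (j : ℕ) : ℤ) : ℝ)| ≤ X := by
    intro b hb i j
    push_cast
    refine (abs_sub _ _).trans ?_
    simp only [abs_mul, Nat.abs_cast]
    have := hi i; have := hi j
    calc _ ≤ (V : ℝ) ^ 200 * L + (V : ℝ) ^ 200 * L := by gcongr
      _ = 2 * (V : ℝ) ^ 216 := by rw [hLr]; ring
      _ ≤ V * (V : ℝ) ^ 216 := by gcongr
      _ = (V : ℝ) ^ 217 := by ring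
      _ ≤ X := by rw [hX]; exact hpw (by norm_num)
  have hx : ∀ i, |(x i : ℝ)| ≤ X := fun i => hxy b1 hB1 _ _
  have hy : ∀ i, |(y i : ℝ)| ≤ X := fun i => hxy b2 hB2 _ _
  obtain ⟨M0, hM0⟩ : ∃ M0, M0 = 2 ^ 38 * V ^ 18 := ⟨_, rfl⟩
  obtain ⟨S0, hS0⟩ : ∃ S0, S0 = V ^ 10 := ⟨_, rfl⟩
  obtain ⟨A, hA⟩ : ∃ A : ℝ, A = Real.exp ((440 * 2 ^ 38 + w0) * (V : ℝ) ^ 26) := ⟨_, rfl⟩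
  have hA1 : 1 ≤ A := by rw [hA]; apply Real.one_le_exp; positivity
  let mat : Matrix (Fin M0 × Fin M0 × Fin S0) ι (𝓞 K) := fun r i =>
    (x i : 𝓞 K) ^ (r.1 : ℕ) * (y i : 𝓞 K) ^ (r.2.1 : ℕ) * γ i ^ (r.2.2 : ℕ)
  have hmat : ∀ r i, house (algebraMap (𝓞 K) K (mat r i)) ≤ A := by
    rintro ⟨m1, m2, s⟩ i
    simp only [mat, map_mul, map_pow, map_intCast]
    have e1 : house ((x i : K) ^ (m1 : ℕ)) ≤ X ^ M0 :=
      (house_pow_le _ _).trans (by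
        rw [house_intCast]
        calc _ ≤ X ^ (m1 : ℕ) := by gcongr; exact_mod_cast hx i
          _ ≤ _ := pow_le_pow_right₀ hX1 m1.2.le)
    have e2 : house ((y i : K) ^ (m2 : ℕ)) ≤ X ^ M0 :=
      (house_pow_le _ _).trans (by
        rw [house_intCast]
        calc _ ≤ X ^ (m2 : ℕ) := by gcongr; exact_mod_cast hy i
          _ ≤ _ := pow_le_pow_right₀ hX1 m2.2.le)
    have e3 : house ((algebraMap (𝓞 K) K (γ i)) ^ (s : ℕ)) ≤ Real.exp (S0 * W) := by
      refine (house_pow_le _ _).trans ?_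
      have := house_nonneg (algebraMap (𝓞 K) K (γ i))
      have := hγh i
      rw [Real.exp_nat_mul]
      calc _ ≤ Real.exp W ^ (s : ℕ) := by gcongr
        _ ≤ _ := pow_le_pow_right₀ (hG1.trans hGW) s.2.le
    have s1 := (house_mul_le ((x i : K) ^ (m1 : ℕ)) ((y i : K) ^ (m2 : ℕ))).trans
      (mul_le_mul e1 e2 (house_nonneg _) (by positivity))
    refine (house_mul_le _ _).trans ((mul_le_mul s1 e3 (house_nonneg _) (by positivity)).trans ?_)
    have t1 := pow_le_exp_aux V (by linarith) (440 * M0)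
    calc X ^ M0 * X ^ M0 * Real.exp (S0 * W) = (V : ℝ) ^ (440 * M0) * Real.exp (S0 * W) := by
          rw [hX, ← pow_mul, ← pow_add]; congr 2; ring
      _ ≤ Real.exp ((440 * M0 : ℕ) * V) * Real.exp (S0 * W) := by gcongr
      _ = Real.exp (440 * 2 ^ 38 * (V : ℝ) ^ 19 + w0 * (V : ℝ) ^ 26) := by
          rw [← Real.exp_add, hM0, hS0, hW]; congr 1; push_cast; ring
      _ ≤ A := by
        rw [hA]; apply Real.exp_le_exp.2
        have : (V : ℝ) ^ 19 ≤ (V : ℝ) ^ 26 := hpw (by norm_num)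
        rw [add_mul]
        gcongr ?_ + _
        gcongr _ * ?_
  have hcα : Fintype.card (Fin M0 × Fin M0 × Fin S0) = M0 * (M0 * S0) := by simp
  obtain ⟨p, hp0, hpv, hph⟩ := hcs (Fin M0 × Fin M0 × Fin S0) ι mat A hA1
    (by rw [hcα, hM0, hS0]; positivity)
    (by
      rw [hcα, hcard, hM0, hS0]
      have h40 : 2 ^ 40 * 2 ^ 40 ≤ V * V := Nat.mul_le_mul hV40 hV40
      calc 2 * (2 ^ 38 * V ^ 18 * (2 ^ 38 * V ^ 18 * V ^ 10)) = 2 ^ 77 * V ^ 46 := by ring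
        _ ≤ (V * V) * V ^ 46 := by
          apply Nat.mul_le_mul_right
          exact le_trans (by norm_num) h40
        _ = V ^ 48 := by ring) hmat
  have hp : ∀ i, house (algebraMap (𝓞 K) K (p i)) ≤ P := by
    intro i
    refine (hph i).trans ?_
    rw [hcard, hA, hP]
    have t1 := pow_le_exp_aux V (by linarith) 48
    have t2 : cs ≤ Real.exp cs := by linarith [Real.add_one_le_exp cs]
    push_cast at t1 ⊢
    calc cs * ((V : ℝ) ^ 48 * Real.exp ((440 * 2 ^ 38 + w0) * (V : ℝ) ^ 26))
        ≤ Real.exp cs * (Real.exp (48 * V) * Real.exp ((440 * 2 ^ 38 + w0) * (V : ℝ) ^ 26)) := by gcongr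
      _ = Real.exp (cs + (48 * V + (440 * 2 ^ 38 + w0) * (V : ℝ) ^ 26)) := by
        rw [Real.exp_add, Real.exp_add]
      _ ≤ _ := by
        apply Real.exp_le_exp.2
        have r1 : (V : ℝ) ≤ (V : ℝ) ^ 26 := by simpa using hpw (m := 1) (n := 26) (by norm_num)
        have r2 : (1 : ℝ) ≤ (V : ℝ) ^ 26 := one_le_pow₀ hV1
        have r3 : cs * 1 ≤ cs * (V : ℝ) ^ 26 := by gcongr
        rw [hC1]
        linarith
  have hmain : ∀ k ≤ 38, ∀ m1 < 2 ^ (38 - k) * V ^ 18, ∀ m2 < 2 ^ (38 - k) * V ^ 18,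
      ∀ s < V ^ (10 + k), ∑ i, p i * (x i : 𝓞 K) ^ m1 * (y i : 𝓞 K) ^ m2 * γ i ^ s = 0 := by
    intro k
    induction k with
    | zero =>
      intro _ m1 h1 m2 h2 s hs
      have := congrFun hpv (⟨m1, by rw [hM0]; exact h1⟩, ⟨m2, by rw [hM0]; exact h2⟩,
        ⟨s, by rw [hS0]; exact hs⟩)
      simp only [Matrix.mulVec, dotProduct, mat, Pi.zero_apply] at this
      rw [← this]
      exact Finset.sum_congr rfl fun i _ => by ring
    | succ k ih =>
      intro hk
      have ih' := ih (by omega)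
      have e1 : 38 - k = (37 - k) + 1 := by omega
      have e2 : 38 - (k + 1) = 37 - k := by omega
      have e3 : 10 + (k + 1) = 11 + k := by omega
      rw [e2, e3]
      have e4 : 2 ^ (38 - k) * V ^ 18 = 2 * (2 ^ (37 - k) * V ^ 18) := by rw [e1]; ring
      rw [e4] at ih'
      refine baker_step K ψ p γ x y h w b0 hb0 l1 l2 (fun i => rfl) G W δ P X (lam + 1) hG1 hGW hδ0 hX1
        (by linarith) (by rw [hlam]; linarith [abs_nonneg l0]) hP1 hγ hhW hwW hhw hγh hp hx hy
        (V ^ (10 + k)) (2 ^ (37 - k) * V ^ 18) (V ^ (11 + k)) (Nat.one_le_pow _ _ hVn)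
        (Nat.mul_pos (by positivity) (Nat.one_le_pow _ _ hVn)) (Nat.pow_le_pow_right hVn (by omega))
        _ rfl ?_ ih'
      refine hstep V (by omega) k (by omega) _ _ _ W P X δ _ rfl rfl rfl hW hP hX hδ0 hδle ?_
      rw [hcard]; push_cast; rfl
  have hinj : Function.Injective γ := by
    intro i j hij
    have h1 := hγ i
    rw [hij, hγ j] at h1
    have h2 : G * Real.exp (h j) = G * Real.exp (h i) := by exact_mod_cast h1
    have h3 : h j = h i := Real.exp_injective (mul_left_cancel₀ (by linarith) h2)
    obtain ⟨i0, i1, i2⟩ := i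
    obtain ⟨j0, j1, j2⟩ := j
    simp only [h] at h3
    obtain ⟨q0, q1, q2⟩ := hind ((j0 : ℕ) - (i0 : ℕ) : ℤ) ((j1 : ℕ) - (i1 : ℕ) : ℤ) ((j2 : ℕ) - (i2 : ℕ) : ℤ)
      (by push_cast; linarith)
    have : i0 = j0 := Fin.ext (by omega)
    have : i1 = j1 := Fin.ext (by omega)
    have : i2 = j2 := Fin.ext (by omega)
    simp_all
  apply hp0
  apply vandermonde_fintype γ p hinj
  intro s hs
  rw [hcard] at hs
  have := hmain 38 le_rfl 0 (by positivity) 0 (by positivity) s (by simpa using hs)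
  simpa using this

open NumberField in
theorem baker_core_real (α0 α1 α2 : ℝ) (h0 : 0 < α0) (h1 : 0 < α1) (h2 : 0 < α2)
    (ha0 : IsAlgebraic ℚ α0) (ha1 : IsAlgebraic ℚ α1) (ha2 : IsAlgebraic ℚ α2)
    (hind : ∀ z0 z1 z2 : ℤ, z0 * Real.log α0 + z1 * Real.log α1 + z2 * Real.log α2 = 0 →
      z0 = 0 ∧ z1 = 0 ∧ z2 = 0) :
    ∃ V0 : ℕ, ∀ V : ℕ, V0 ≤ V → ∀ b0 b1 b2 : ℤ, b0 ≠ 0 → |(b0 : ℝ)| ≤ (V : ℝ) ^ 200 →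
      |(b1 : ℝ)| ≤ (V : ℝ) ^ 200 → |(b2 : ℝ)| ≤ (V : ℝ) ^ 200 →
      Real.exp (-(V : ℝ) ^ 199) ≤ |b0 * Real.log α0 + b1 * Real.log α1 + b2 * Real.log α2| := by
  let F := IntermediateField.adjoin ℚ ({α0, α1, α2} : Set ℝ)
  have hfd : FiniteDimensional ℚ F := by
    apply IntermediateField.finiteDimensional_adjoin
    intro x hx
    simp only [Set.mem_insert_iff, Set.mem_singleton_iff] at hx
    rcases hx with rfl | rfl | rfl
    · exact ha0.isIntegral
    · exact ha1.isIntegral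
    · exact ha2.isIntegral
  have hnf : NumberField F := { to_charZero := inferInstance, to_finiteDimensional := hfd }
  have hmem : ∀ x ∈ ({α0, α1, α2} : Set ℝ), x ∈ F := fun x hx => IntermediateField.subset_adjoin ℚ _ hx
  have hintg : ∀ x : ℝ, x ∈ F → ∃ y : ℤ, y ≠ 0 ∧ ∃ t : 𝓞 F, ((algebraMap (𝓞 F) F t : F) : ℝ) = y * x := by
    intro x hx
    have halg : IsAlgebraic ℤ (⟨x, hx⟩ : F) :=
      (IsFractionRing.isAlgebraic_iff ℤ ℚ F).2 (IsAlgebraic.of_finite ℚ _)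
    obtain ⟨y, hy, hyi⟩ := halg.exists_integral_multiple
    refine ⟨y, hy, ⟨_, hyi⟩, ?_⟩
    simp
  obtain ⟨y0, hy0, t0, ht0⟩ := hintg α0 (hmem _ (by simp))
  obtain ⟨y1, hy1, t1, ht1⟩ := hintg α1 (hmem _ (by simp))
  obtain ⟨y2, hy2, t2, ht2⟩ := hintg α2 (hmem _ (by simp))
  let A : ℤ := (y0 * y1 * y2) ^ 2
  have hA : 0 < A := by positivity
  obtain ⟨a, ha⟩ : ∃ a : ℕ, (a : ℤ) = A := ⟨A.toNat, Int.toNat_of_nonneg hA.le⟩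
  have har : (a : ℝ) = ((y0 : ℝ) * y1 * y2) ^ 2 := by
    have : ((a : ℤ) : ℝ) = (A : ℝ) := by rw [ha]
    simpa [A] using this
  let ψ : F →+* ℂ := (algebraMap ℝ ℂ).comp (algebraMap F ℝ)
  have hψ : ∀ t : F, ψ t = ((t : ℝ) : ℂ) := fun t => rfl
  refine baker_core F ψ (Real.log α0) (Real.log α1) (Real.log α2) a (by omega)
    (((y1 * y2) * (y0 * y1 * y2) : ℤ) * t0) (((y0 * y2) * (y0 * y1 * y2) : ℤ) * t1)
    (((y0 * y1) * (y0 * y1 * y2) : ℤ) * t2) ?_ ?_ ?_ hind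
  · rw [hψ, Real.exp_log h0]
    congr 1
    rw [har, map_mul]; push_cast [map_intCast]; rw [ht0]; ring
  · rw [hψ, Real.exp_log h1]
    congr 1
    rw [har, map_mul]; push_cast [map_intCast]; rw [ht1]; ring
  · rw [hψ, Real.exp_log h2]
    congr 1
    rw [har, map_mul]; push_cast [map_intCast]; rw [ht2]; ring

theorem baker_three (α0 α1 α2 : ℝ) (h0 : 0 < α0) (h1 : 0 < α1) (h2 : 0 < α2)
    (ha0 : IsAlgebraic ℚ α0) (ha1 : IsAlgebraic ℚ α1) (ha2 : IsAlgebraic ℚ α2)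
    (hind : ∀ z0 z1 z2 : ℤ, z0 * Real.log α0 + z1 * Real.log α1 + z2 * Real.log α2 = 0 →
      z0 = 0 ∧ z1 = 0 ∧ z2 = 0) (ε : ℝ) (hε : 0 < ε) :
    ∃ B0 : ℝ, ∀ B : ℝ, B0 ≤ B → ∀ b0 b1 b2 : ℤ, b0 ≠ 0 → |(b0 : ℝ)| ≤ B →
      |(b1 : ℝ)| ≤ B → |(b2 : ℝ)| ≤ B →
      Real.exp (-(ε * B)) ≤ |b0 * Real.log α0 + b1 * Real.log α1 + b2 * Real.log α2| := by
  obtain ⟨V0, hV0⟩ := baker_core_real α0 α1 α2 h0 h1 h2 ha0 ha1 ha2 hind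
  obtain ⟨V1, hV1⟩ := exists_nat_ge (2 ^ 199 / ε + 2 + V0)
  refine ⟨(V1 : ℝ) ^ 200 + 1, ?_⟩
  intro B hB b0 b1 b2 hb0 c0 c1 c2
  have hex : ∃ V : ℕ, B ≤ (V : ℝ) ^ 200 := by
    obtain ⟨n, hn⟩ := exists_nat_ge (max B 1)
    refine ⟨n, ?_⟩
    have hn1 : (1 : ℝ) ≤ n := (le_max_right _ _).trans hn
    exact ((le_max_left _ _).trans hn).trans (le_self_pow₀ hn1 (by norm_num))
  classical
  let V := Nat.find hex
  have hVB : B ≤ (V : ℝ) ^ 200 := Nat.find_spec hex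
  have hVgt : V1 < V := by
    by_contra hcon
    push Not at hcon
    have : (V : ℝ) ^ 200 ≤ (V1 : ℝ) ^ 200 := by gcongr
    linarith
  have hmin : ((V - 1 : ℕ) : ℝ) ^ 200 < B := by
    have := Nat.find_min hex (m := V - 1) (by change V - 1 < V; omega)
    push Not at this
    exact this
  obtain ⟨U, hU⟩ : ∃ U : ℕ, V = U + 1 := ⟨V - 1, by omega⟩
  have hq : 0 < 2 ^ 199 / ε := by positivity
  have hVV0 : V0 ≤ V := by
    have : (V0 : ℝ) ≤ V1 := by linarith
    have : V0 ≤ V1 := by exact_mod_cast this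
    omega
  have hUV1 : (V1 : ℝ) ≤ U := by
    have : V1 ≤ U := by omega
    exact_mod_cast this
  rw [hU] at hmin
  simp only [Nat.add_sub_cancel] at hmin
  refine le_trans (Real.exp_le_exp.2 ?_) (hV0 V hVV0 b0 b1 b2 hb0 (c0.trans hVB) (c1.trans hVB) (c2.trans hVB))
  apply neg_le_neg
  have hVr : (V : ℝ) = U + 1 := by rw [hU]; push_cast; rfl
  have hV0nn : (0 : ℝ) ≤ V0 := Nat.cast_nonneg _
  have hU1 : (1 : ℝ) ≤ U := by linarith
  have hUe : 2 ^ 199 ≤ ε * U := by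
    have : 2 ^ 199 / ε ≤ U := by linarith
    rw [div_le_iff₀ hε] at this
    linarith
  calc (V : ℝ) ^ 199 ≤ (2 * U) ^ 199 := by rw [hVr]; gcongr; linarith
    _ = 2 ^ 199 * (U : ℝ) ^ 199 := by rw [mul_pow]
    _ ≤ ε * U * (U : ℝ) ^ 199 := by gcongr
    _ = ε * (U : ℝ) ^ 200 := by rw [mul_assoc, ← pow_succ']
    _ ≤ ε * B := by gcongr

lemma log235_indep (a b c : ℤ) (h : a * Real.log 2 + b * Real.log 3 + c * Real.log 5 = 0) :
    a = 0 ∧ b = 0 ∧ c = 0 := by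
  have h1 : ((2 : ℝ) ^ a * 3 ^ b * 5 ^ c) = 1 := by
    apply Real.log_injOn_pos (Set.mem_Ioi.2 (by positivity)) (Set.mem_Ioi.2 one_pos)
    rw [Real.log_mul (by positivity) (by positivity), Real.log_mul (by positivity) (by positivity),
      Real.log_zpow, Real.log_zpow, Real.log_zpow, Real.log_one, h]
  have h2 : ((2 : ℚ) ^ a * 3 ^ b * 5 ^ c) = 1 := by
    apply (Rat.cast_injective (α := ℝ))
    push_cast
    exact h1
  have key : ∀ p : ℕ, [Fact p.Prime] → a * padicValRat p 2 + b * padicValRat p 3 + c * padicValRat p 5 = 0 := by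
    intro p hp
    have h3 := congrArg (padicValRat p) h2
    rw [padicValRat.mul (by positivity) (by positivity), padicValRat.mul (by positivity) (by positivity),
      padicValRat.zpow, padicValRat.zpow, padicValRat.zpow, padicValRat.one] at h3
    exact h3
  have : Fact (Nat.Prime 5) := ⟨by norm_num⟩
  have e : ∀ p q : ℕ, [Fact p.Prime] → [Fact q.Prime] → p ≠ q → padicValRat p (q : ℚ) = 0 := by
    intro p q _ _ hpq
    rw [padicValRat.of_nat, padicValNat_primes hpq]; rfl
  have s : ∀ p : ℕ, [Fact p.Prime] → padicValRat p (p : ℚ) = 1 := by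
    intro p hp
    exact padicValRat.self hp.1.one_lt
  have k2 := key 2
  have k3 := key 3
  have k5 := key 5
  have e23 := e 2 3 (by norm_num)
  have e25 := e 2 5 (by norm_num)
  have e32 := e 3 2 (by norm_num)
  have e35 := e 3 5 (by norm_num)
  have e52 := e 5 2 (by norm_num)
  have e53 := e 5 3 (by norm_num)
  have s2 := s 2
  have s3 := s 3
  have s5 := s 5
  push_cast at *
  rw [s2, e23, e25] at k2
  rw [e32, s3, e35] at k3
  rw [e52, e53, s5] at k5
  omega

lemma third_log (l1 l2 : ℝ) (hind : ∀ x y : ℤ, x * l1 + y * l2 = 0 → x = 0 ∧ y = 0) :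
    ∃ q : ℕ, 0 < q ∧ ∀ x y z : ℤ, x * l1 + y * l2 + z * Real.log q = 0 → x = 0 ∧ y = 0 ∧ z = 0 := by
  by_contra hcon
  push Not at hcon
  have step : ∀ q : ℕ, 0 < q → ∃ x y z : ℤ, x * l1 + y * l2 + z * Real.log q = 0 ∧ z ≠ 0 := by
    intro q hq
    obtain ⟨x, y, z, h, hne⟩ := hcon q hq
    refine ⟨x, y, z, h, ?_⟩
    rintro rfl
    obtain ⟨h1, h2⟩ := hind x y (by simpa using h)
    exact hne h1 h2 rfl
  obtain ⟨x2, y2, z2, h2, n2⟩ := step 2 (by norm_num)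
  obtain ⟨x3, y3, z3, h3, n3⟩ := step 3 (by norm_num)
  obtain ⟨x5, y5, z5, h5, n5⟩ := step 5 (by norm_num)
  push_cast at h2 h3 h5
  obtain ⟨u2, u3, u5⟩ := log235_indep ((x3 * y5 - x5 * y3) * z2) ((x5 * y2 - x2 * y5) * z3)
    ((x2 * y3 - x3 * y2) * z5) (by
      push_cast
      linear_combination (x3 * y5 - x5 * y3 : ℝ) * h2 + (x5 * y2 - x2 * y5 : ℝ) * h3 + (x2 * y3 - x3 * y2 : ℝ) * h5)
  have m5 : x2 * y3 - x3 * y2 = 0 := by simpa [n5] using u5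
  have m5r : (x2 * y3 - x3 * y2 : ℝ) = 0 := by exact_mod_cast m5
  obtain ⟨a1, a2, -⟩ := log235_indep (x3 * z2) (-x2 * z3) 0 (by
    push_cast
    linear_combination (x3 : ℝ) * h2 - (x2 : ℝ) * h3 + l2 * m5r)
  obtain ⟨b1, b2, -⟩ := log235_indep (y3 * z2) (-y2 * z3) 0 (by
    push_cast
    linear_combination (y3 : ℝ) * h2 - (y2 : ℝ) * h3 - l1 * m5r)
  have hx : x2 = 0 := by simpa [n3] using a2
  have hy : y2 = 0 := by simpa [n3] using b2
  subst hx hy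
  obtain ⟨c1, -⟩ := log235_indep z2 0 0 (by push_cast; push_cast at h2; linarith)
  exact n2 c1

lemma int_add_gap (r : ℝ) : ∃ c : ℝ, 0 < c ∧ ∀ t : ℤ, (t : ℝ) + r ≠ 0 → c ≤ |t + r| := by
  have hf := Int.fract_nonneg r
  have hf1 := Int.fract_lt_one r
  have hr := Int.floor_add_fract r
  by_cases h0 : Int.fract r = 0
  · refine ⟨1, one_pos, fun t ht => ?_⟩
    have e : (t : ℝ) + r = ((t + ⌊r⌋ : ℤ) : ℝ) := by push_cast; linarith
    rw [e] at ht ⊢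
    have : t + ⌊r⌋ ≠ 0 := by exact_mod_cast ht
    exact_mod_cast Int.one_le_abs this
  · have hpos : 0 < Int.fract r := lt_of_le_of_ne hf (Ne.symm h0)
    refine ⟨min (Int.fract r) (1 - Int.fract r), lt_min hpos (by linarith), fun t _ => ?_⟩
    have e : (t : ℝ) + r = ((t + ⌊r⌋ : ℤ) : ℝ) + Int.fract r := by push_cast; linarith
    rw [e]
    rcases le_or_gt 0 (t + ⌊r⌋) with h | h
    · have : (0 : ℝ) ≤ ((t + ⌊r⌋ : ℤ) : ℝ) := by exact_mod_cast h
      rw [abs_of_nonneg (by linarith)]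
      exact (min_le_left _ _).trans (by linarith)
    · have h' : t + ⌊r⌋ ≤ -1 := by omega
      have : ((t + ⌊r⌋ : ℤ) : ℝ) ≤ -1 := by exact_mod_cast h'
      rw [abs_of_nonpos (by linarith)]
      exact (min_le_right _ _).trans (by linarith)

lemma exp_small (ε κ : ℝ) (hε : 0 < ε) (hκ : 0 < κ) : ∃ N0 : ℝ, 1 ≤ N0 ∧ ∀ M : ℝ, N0 ≤ M → Real.exp (-(ε * M)) ≤ κ := by
  refine ⟨max 1 (1 / (κ * ε)), le_max_left _ _, fun M hM => ?_⟩
  have h1 : 1 / (κ * ε) ≤ M := (le_max_right _ _).trans hM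
  rw [div_le_iff₀ (by positivity)] at h1
  rw [Real.exp_neg, inv_le_comm₀ (Real.exp_pos _) hκ, ← one_div, div_le_iff₀ hκ]
  have := Real.add_one_le_exp (ε * M)
  nlinarith


theorem baker_two (ρ1 ρ2 : ℝ) (h1 : 0 < ρ1) (h2 : 0 < ρ2) (a1 : IsAlgebraic ℚ ρ1)
    (a2 : IsAlgebraic ℚ ρ2)
    (hind : ∀ x y : ℤ, x * Real.log ρ1 + y * Real.log ρ2 = 0 → x = 0 ∧ y = 0) (ε : ℝ) (hε : 0 < ε) :
    ∃ B0 : ℝ, ∀ B : ℝ, B0 ≤ B → ∀ b1 b2 : ℤ, (b1 : ℝ) * Real.log ρ1 + b2 * Real.log ρ2 ≠ 0 →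
      |(b1 : ℝ)| ≤ B → |(b2 : ℝ)| ≤ B →
      Real.exp (-(ε * B)) ≤ |b1 * Real.log ρ1 + b2 * Real.log ρ2| := by
  obtain ⟨q, hq, hqi⟩ := third_log _ _ hind
  have hq0 : (0 : ℝ) < q := by exact_mod_cast hq
  have aq : IsAlgebraic ℚ (q : ℝ) := isAlgebraic_natCast q
  obtain ⟨B1, hB1⟩ := baker_three ρ1 ρ2 q h1 h2 hq0 a1 a2 aq hqi ε hε
  obtain ⟨B2, hB2⟩ := baker_three ρ2 ρ1 q h2 h1 hq0 a2 a1 aq (by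
    intro z0 z1 z2 h
    obtain ⟨q1, q2, q3⟩ := hqi z1 z0 z2 (by linarith)
    exact ⟨q2, q1, q3⟩) ε hε
  refine ⟨max B1 B2, fun B hB b1 b2 hne hb1 hb2 => ?_⟩
  have hBnn : 0 ≤ B := (abs_nonneg _).trans hb1
  by_cases hb : b1 = 0
  · have hb' : b2 ≠ 0 := by
      rintro rfl
      simp [hb] at hne
    have := hB2 B ((le_max_right _ _).trans hB) b2 b1 0 hb' hb2 hb1 (by simpa using hBnn)
    simpa [add_comm] using this
  · have := hB1 B ((le_max_left _ _).trans hB) b1 b2 0 hb hb1 hb2 (by simpa using hBnn)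
    simpa using this

theorem two_seq_lower (ρ1 ρ2 κ : ℝ) (h1 : 1 < ρ1) (h2 : 1 < ρ2) (hκ : 0 < κ) (a1 : IsAlgebraic ℚ ρ1)
    (a2 : IsAlgebraic ℚ ρ2) (aκ : IsAlgebraic ℚ κ) (ε : ℝ) (hε : 0 < ε) :
    ∃ N0 : ℝ, ∀ n m : ℕ, ∀ M : ℝ, N0 ≤ M → (n : ℝ) ≤ M → (m : ℝ) ≤ M →
      n * Real.log ρ1 - m * Real.log ρ2 + Real.log κ ≠ 0 →
      Real.exp (-(ε * M)) ≤ |n * Real.log ρ1 - m * Real.log ρ2 + Real.log κ| := by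
  have p1 : 0 < Real.log ρ1 := Real.log_pos h1
  have p2 : 0 < Real.log ρ2 := Real.log_pos h2
  by_cases hA : ∀ x y : ℤ, x * Real.log ρ1 + y * Real.log ρ2 = 0 → x = 0 ∧ y = 0
  · by_cases hB : ∀ z0 z1 z2 : ℤ, z0 * Real.log κ + z1 * Real.log ρ1 + z2 * Real.log ρ2 = 0 →
      z0 = 0 ∧ z1 = 0 ∧ z2 = 0
    · obtain ⟨B0, hB0⟩ := baker_three κ ρ1 ρ2 hκ (by linarith) (by linarith) aκ a1 a2 hB ε hε
      refine ⟨max B0 1, fun n m M hM hn hm _ => ?_⟩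
      have := hB0 M ((le_max_left _ _).trans hM) 1 n (-m) one_ne_zero
        (by simpa using (le_max_right _ _).trans hM) (by simpa using hn) (by simpa using hm)
      push_cast at this
      rw [show (n : ℝ) * Real.log ρ1 - m * Real.log ρ2 + Real.log κ =
        1 * Real.log κ + n * Real.log ρ1 + -(m : ℝ) * Real.log ρ2 by ring]
      exact this
    · push Not at hB
      obtain ⟨z, x, y, hrel, hne⟩ := hB
      have hz : z ≠ 0 := by
        rintro rfl
        obtain ⟨q1, q2⟩ := hA x y (by simpa using hrel)
        exact hne rfl q1 q2
      have hz1 : (1 : ℝ) ≤ |(z : ℝ)| := by exact_mod_cast Int.one_le_abs hz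
      obtain ⟨R, hR⟩ : ∃ R : ℝ, R = |(z : ℝ)| + |(x : ℝ)| + |(y : ℝ)| := ⟨_, rfl⟩
      have hx0 := abs_nonneg (x : ℝ)
      have hy0 := abs_nonneg (y : ℝ)
      have hR1 : 1 ≤ R := by linarith
      obtain ⟨B0, hB0⟩ := baker_two ρ1 ρ2 (by linarith) (by linarith) a1 a2 hA (ε / 2 / R) (by positivity)
      obtain ⟨N1, hN1, hsm⟩ := exp_small (ε / 2) (1 / R) (by positivity) (by positivity)
      refine ⟨max (max B0 0) N1, fun n m M hM hn hm hL => ?_⟩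
      have hMB : B0 ≤ M := (le_max_left _ _).trans ((le_max_left _ _).trans hM)
      have hMN : N1 ≤ M := (le_max_right _ _).trans hM
      have hM1 : 1 ≤ M := hN1.trans hMN
      set Λ := (n : ℝ) * Real.log ρ1 - m * Real.log ρ2 + Real.log κ with hΛ
      have hzL : z * Λ = ((n * z - x : ℤ) : ℝ) * Real.log ρ1 + ((-(m * z) - y : ℤ) : ℝ) * Real.log ρ2 := by
        rw [hΛ]; push_cast; linear_combination hrel
      have hzr : (z : ℝ) ≠ 0 := by exact_mod_cast hz
      have hn' : |((n * z - x : ℤ) : ℝ)| ≤ R * M := by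
        push_cast
        refine (abs_sub _ _).trans ?_
        rw [abs_mul, Nat.abs_cast, hR]
        nlinarith
      have hm' : |((-(m * z) - y : ℤ) : ℝ)| ≤ R * M := by
        push_cast
        refine (abs_sub _ _).trans ?_
        rw [abs_neg, abs_mul, Nat.abs_cast, hR]
        nlinarith
      have key := hB0 (R * M) (by nlinarith) _ _ (by rw [← hzL]; exact mul_ne_zero hzr hL) hn' hm'
      rw [← hzL, abs_mul] at key
      have e1 : ε / 2 / R * (R * M) = ε / 2 * M := by field_simp
      rw [e1] at key
      have e2 := hsm M hMN
      have e3 : Real.exp (-(ε * M)) = Real.exp (-(ε / 2 * M)) * Real.exp (-(ε / 2 * M)) := by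
        rw [← Real.exp_add]; congr 1; ring
      rw [e3]
      calc _ ≤ 1 / R * (|(z : ℝ)| * |Λ|) := by gcongr
        _ ≤ 1 / R * (R * |Λ|) := by gcongr; linarith
        _ = |Λ| := by field_simp
  · push Not at hA
    obtain ⟨x, y, hrel, hne⟩ := hA
    have hy : y ≠ 0 := by
      rintro rfl
      have : (x : ℝ) = 0 := by simpa [p1.ne'] using hrel
      exact hne (by exact_mod_cast this) rfl
    have hyr : (y : ℝ) ≠ 0 := by exact_mod_cast hy
    obtain ⟨g, hg, hgap⟩ := int_add_gap (y * Real.log κ / Real.log ρ1)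
    have hyp : 0 < |(y : ℝ)| := abs_pos.2 hyr
    obtain ⟨N1, hN1, hsm⟩ := exp_small ε (g * Real.log ρ1 / |(y : ℝ)|) hε (by positivity)
    refine ⟨N1, fun n m M hM hn hm hL => (hsm M hM).trans ?_⟩
    set Λ := (n : ℝ) * Real.log ρ1 - m * Real.log ρ2 + Real.log κ with hΛ
    have hyL : y * Λ = Real.log ρ1 * (((n * y + m * x : ℤ) : ℝ) + y * Real.log κ / Real.log ρ1) := by
      rw [hΛ]; push_cast; field_simp; linear_combination (-(m : ℝ)) * hrel
    have h3 := hgap (n * y + m * x) (by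
      intro h0
      rw [h0, mul_zero] at hyL
      exact (mul_ne_zero hyr hL) hyL)
    rw [div_le_iff₀ hyp, mul_comm |Λ|, ← abs_mul, hyL, abs_mul, abs_of_pos p1, mul_comm]
    gcongr

lemma err_bound (C₀ θ ρ c : ℝ) (hC : 0 ≤ C₀) (hθ0 : 0 ≤ θ) (hθ : θ < ρ) (hρ : 1 < ρ) (hc : 0 < c) :
    ∃ K σ : ℝ, 1 ≤ K ∧ 0 < σ ∧ ∀ n : ℕ, C₀ * θ ^ n ≤ K * Real.exp (-(σ * n)) * (c * ρ ^ n) := by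
  obtain ⟨τ, hτ⟩ : ∃ τ, τ = max θ 1 := ⟨_, rfl⟩
  have hτ1 : 1 ≤ τ := by rw [hτ]; exact le_max_right _ _
  have hτθ : θ ≤ τ := by rw [hτ]; exact le_max_left _ _
  have hτρ : τ < ρ := by rw [hτ]; exact max_lt hθ hρ
  refine ⟨C₀ / c + 1, Real.log ρ - Real.log τ, by have : 0 ≤ C₀ / c := by positivity
                                                  linarith, ?_, ?_⟩
  · have := Real.log_lt_log (by linarith) hτρ
    linarith
  · intro n
    have e : Real.exp (-((Real.log ρ - Real.log τ) * n)) * ρ ^ n = τ ^ n := by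
      have h1 : ρ ^ n = Real.exp (n * Real.log ρ) := by
        rw [Real.exp_nat_mul, Real.exp_log (by linarith)]
      have h2 : τ ^ n = Real.exp (n * Real.log τ) := by
        rw [Real.exp_nat_mul, Real.exp_log (by linarith)]
      rw [h1, h2, ← Real.exp_add]; congr 1; ring
    calc C₀ * θ ^ n ≤ C₀ * τ ^ n := by gcongr
      _ ≤ (C₀ + c) * τ ^ n := by gcongr; linarith
      _ = (C₀ / c + 1) * c * (Real.exp (-((Real.log ρ - Real.log τ) * n)) * ρ ^ n) := by
        rw [e]; field_simp
      _ = _ := by ring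

lemma pow_large (c ρ K : ℝ) (hc : 0 < c) (hρ : 1 < ρ) : ∀ᶠ n : ℕ in Filter.atTop, K ≤ c * ρ ^ n := by
  have := (tendsto_pow_atTop_atTop_of_one_lt hρ).const_mul_atTop hc
  exact this.eventually_ge_atTop K

lemma exp_small_nat (σ κ : ℝ) (hσ : 0 < σ) (hκ : 0 < κ) :
    ∀ᶠ n : ℕ in Filter.atTop, Real.exp (-(σ * n)) ≤ κ := by
  obtain ⟨N0, -, h⟩ := exp_small σ κ hσ hκ
  filter_upwards [(tendsto_natCast_atTop_atTop (R := ℝ)).eventually_ge_atTop N0] with n hn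
  exact h n hn

lemma abs_log_sub_le (a b : ℝ) (ha : 0 < a) (hb : 0 < b) (h1 : a / 2 ≤ b) :
    a / 2 * |Real.log a - Real.log b| ≤ |a - b| := by
  rcases le_total b a with h | h
  · have h0 := Real.log_le_log hb h
    rw [abs_of_nonneg (by linarith), abs_of_nonneg (by linarith), ← Real.log_div ha.ne' hb.ne']
    have h2 := Real.log_le_sub_one_of_pos (div_pos ha hb)
    have h3 : a / b - 1 = (a - b) / b := by field_simp
    have h4 : 0 ≤ (a - b) / b := div_nonneg (by linarith) hb.le
    calc a / 2 * Real.log (a / b) ≤ a / 2 * ((a - b) / b) := by gcongr; linarith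
      _ ≤ b * ((a - b) / b) := by gcongr
      _ = a - b := by field_simp
  · have h0 := Real.log_le_log ha h
    rw [abs_of_nonpos (by linarith), abs_of_nonpos (by linarith), neg_sub, neg_sub,
      ← Real.log_div hb.ne' ha.ne']
    have h2 := Real.log_le_sub_one_of_pos (div_pos hb ha)
    have h3 : b / a - 1 = (b - a) / a := by field_simp
    have h4 : 0 ≤ (b - a) / a := div_nonneg (by linarith) ha.le
    calc a / 2 * Real.log (b / a) ≤ a / 2 * ((b - a) / a) := by gcongr; linarith
      _ ≤ a * ((b - a) / a) := by gcongr; linarith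
      _ = b - a := by field_simp

set_option maxHeartbeats 1600000 in
theorem pair_sep (c1 c2 ρ1 ρ2 θ1 θ2 C₀ : ℝ) (hC : 0 ≤ C₀) (ac1 : IsAlgebraic ℚ c1)
    (ac2 : IsAlgebraic ℚ c2) (a1 : IsAlgebraic ℚ ρ1) (a2 : IsAlgebraic ℚ ρ2) (hc1 : 0 < c1)
    (hc2 : 0 < c2) (h1 : 1 < ρ1) (h2 : 1 < ρ2) (hθ1 : 0 ≤ θ1) (hθ2 : 0 ≤ θ2) (ht1 : θ1 < ρ1)
    (ht2 : θ2 < ρ2) (hfin : {p : ℕ × ℕ | c1 * ρ1 ^ p.1 = c2 * ρ2 ^ p.2}.Finite) :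
    ∀ᶠ n : ℕ in Filter.atTop, ∀ m : ℕ,
      C₀ * θ1 ^ n + C₀ * θ2 ^ m < |c1 * ρ1 ^ n - c2 * ρ2 ^ m| := by
  obtain ⟨K1, σ1, hK1, hσ1, he1⟩ := err_bound C₀ θ1 ρ1 c1 hC hθ1 ht1 h1 hc1
  obtain ⟨K2, σ2, hK2, hσ2, he2⟩ := err_bound C₀ θ2 ρ2 c2 hC hθ2 ht2 h2 hc2
  have p1 : 0 < Real.log ρ1 := Real.log_pos h1
  have p2 : 0 < Real.log ρ2 := Real.log_pos h2
  obtain ⟨l1, hl1⟩ : ∃ l, l = Real.log ρ1 := ⟨_, rfl⟩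
  obtain ⟨l2, hl2⟩ : ∃ l, l = Real.log ρ2 := ⟨_, rfl⟩
  obtain ⟨Q, hQ⟩ : ∃ Q, Q = |Real.log c1| + |Real.log c2| + 1 := ⟨_, rfl⟩
  have hQ1 : 1 ≤ Q := by rw [hQ]; linarith [abs_nonneg (Real.log c1), abs_nonneg (Real.log c2)]
  rw [← hl1] at p1
  rw [← hl2] at p2
  obtain ⟨R, hR⟩ : ∃ R, R = 1 + (l1 + Q) / l2 + 2 * l2 / l1 := ⟨_, rfl⟩
  have hR1 : 1 ≤ R := by
    have : 0 ≤ (l1 + Q) / l2 := by positivity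
    have : 0 ≤ 2 * l2 / l1 := by positivity
    linarith
  obtain ⟨σ, hσ⟩ : ∃ σ, σ = min σ1 (σ2 / R) := ⟨_, rfl⟩
  have hσ0 : 0 < σ := by rw [hσ]; exact lt_min hσ1 (by positivity)
  have hσσ1 : σ ≤ σ1 := by rw [hσ]; exact min_le_left _ _
  have hσσ2 : σ * R ≤ σ2 := by
    have : σ ≤ σ2 / R := by rw [hσ]; exact min_le_right _ _
    rwa [le_div_iff₀ (by linarith)] at this
  obtain ⟨N0, hN0⟩ := two_seq_lower ρ1 ρ2 (c1 / c2) h1 h2 (by positivity) a1 a2 (by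
    rw [div_eq_mul_inv]; exact ac1.mul ac2.inv) (σ / (2 * R)) (by positivity)
  obtain ⟨N2, hN2⟩ := Filter.eventually_atTop.1 (exp_small_nat σ2 (1 / (8 * K2)) hσ2 (by positivity))
  have he2' : ∀ m : ℕ, C₀ * θ2 ^ m ≤ c2 * ρ2 ^ m / 8 + K2 * (c2 * ρ2 ^ N2) := by
    intro m
    rcases le_total N2 m with h | h
    · have hp : 0 < K2 * (c2 * ρ2 ^ N2) := by positivity
      refine (he2 m).trans ?_
      have : K2 * Real.exp (-(σ2 * m)) * (c2 * ρ2 ^ m) ≤ K2 * (1 / (8 * K2)) * (c2 * ρ2 ^ m) := by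
        gcongr; exact hN2 m h
      have e : K2 * (1 / (8 * K2)) * (c2 * ρ2 ^ m) = c2 * ρ2 ^ m / 8 := by field_simp
      linarith
    · have hp : 0 < c2 * ρ2 ^ m := by positivity
      have : K2 * Real.exp (-(σ2 * m)) * (c2 * ρ2 ^ m) ≤ K2 * 1 * (c2 * ρ2 ^ N2) := by
        gcongr
        · rw [Real.exp_le_one_iff]; have : 0 ≤ σ2 * m := by positivity
          linarith
        · exact h2.le
      have := he2 m
      linarith
  have ev1 := pow_large c1 ρ1 (16 * (K2 * (c2 * ρ2 ^ N2))) hc1 h1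
  have ev2 := exp_small_nat σ1 (1 / (8 * K1)) hσ1 (by positivity)
  have ev3 := (tendsto_natCast_atTop_atTop (R := ℝ)).eventually_ge_atTop (max N0 (max 1 (2 * Q / l1)))
  have ev4 := exp_small_nat (σ / 2) (1 / (4 * (K1 + 2 * K2))) (by positivity) (by positivity)
  have ev5 : ∀ᶠ n : ℕ in Filter.atTop, ∀ m : ℕ, c1 * ρ1 ^ n ≠ c2 * ρ2 ^ m := by
    have hf := (hfin.image Prod.fst)
    obtain ⟨N, hN⟩ := hf.bddAbove
    filter_upwards [Filter.eventually_gt_atTop N] with n hn m heq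
    have := hN (Set.mem_image_of_mem Prod.fst (show (n, m) ∈ {p : ℕ × ℕ | c1 * ρ1 ^ p.1 = c2 * ρ2 ^ p.2} from heq))
    simp only at this
    omega
  filter_upwards [ev1, ev2, ev3, ev4, ev5] with n g1 g2 g3 g4 g5 m
  have gN0 : N0 ≤ n := (le_max_left _ _).trans g3
  have gn1 : (1 : ℝ) ≤ n := (le_max_left _ _).trans ((le_max_right _ _).trans g3)
  have gnQ : 2 * Q / l1 ≤ n := (le_max_right _ _).trans ((le_max_right _ _).trans g3)
  obtain ⟨a, ha⟩ : ∃ a, a = c1 * ρ1 ^ n := ⟨_, rfl⟩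
  obtain ⟨b, hb⟩ : ∃ b, b = c2 * ρ2 ^ m := ⟨_, rfl⟩
  have ha0 : 0 < a := by rw [ha]; positivity
  have hb0 : 0 < b := by rw [hb]; positivity
  have f1 := he1 n
  have f2 := he2' m
  have f2' := he2 m
  have hne := g5 m
  rw [← ha] at f1 g1 hne
  rw [← hb] at f2 f2' hne
  rw [← ha, ← hb]
  have f1' : C₀ * θ1 ^ n ≤ a / 8 := by
    refine f1.trans ?_
    have : K1 * Real.exp (-(σ1 * n)) * a ≤ K1 * (1 / (8 * K1)) * a := by gcongr
    have e : K1 * (1 / (8 * K1)) * a = a / 8 := by field_simp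
    linarith
  rcases le_or_gt b (a / 2) with hba | hba
  · rw [abs_of_nonneg (by linarith)]; linarith
  rcases le_or_gt (2 * a) b with hab | hab
  · rw [abs_of_nonpos (by linarith)]; linarith
  have loga : Real.log a = Real.log c1 + n * l1 := by
    rw [ha, Real.log_mul hc1.ne' (by positivity), Real.log_pow, hl1]
  have logb : Real.log b = Real.log c2 + m * l2 := by
    rw [hb, Real.log_mul hc2.ne' (by positivity), Real.log_pow, hl2]
  have hL : (n : ℝ) * Real.log ρ1 - m * Real.log ρ2 + Real.log (c1 / c2) = Real.log a - Real.log b := by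
    rw [loga, logb, Real.log_div hc1.ne' hc2.ne', hl1, hl2]; ring
  have hlog2 : Real.log 2 ≤ 1 := by linarith [Real.log_two_lt_d9]
  have hlab : Real.log b ≤ Real.log a + 1 := by
    have := Real.log_le_log hb0 hab.le
    rw [Real.log_mul (by norm_num) ha0.ne'] at this
    linarith
  have hlba : Real.log a ≤ Real.log b + 1 := by
    have := Real.log_le_log ha0 (by linarith : a ≤ 2 * b)
    rw [Real.log_mul (by norm_num) hb0.ne'] at this
    linarith
  have q1 := abs_le.1 (le_refl |Real.log c1|)
  have q2 := abs_le.1 (le_refl |Real.log c2|)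
  have hm1 : m * l2 ≤ n * l1 + Q := by rw [hQ]; linarith [q1.1, q1.2, q2.1, q2.2]
  have hm2 : n * l1 ≤ m * l2 + Q := by rw [hQ]; linarith [q1.1, q1.2, q2.1, q2.2]
  have hmR : (m : ℝ) ≤ R * n := by
    have h3 : (m : ℝ) ≤ (l1 + Q) / l2 * n := by
      rw [div_mul_eq_mul_div, le_div_iff₀ p2]; nlinarith
    have : 0 ≤ (1 + 2 * l2 / l1) * n := by positivity
    rw [hR]; linarith
  have hnR : (n : ℝ) ≤ R * m := by
    have h3 : (n : ℝ) ≤ 2 * l2 / l1 * m := by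
      rw [div_le_iff₀ p1] at gnQ
      rw [div_mul_eq_mul_div, le_div_iff₀ p1]; nlinarith
    have : 0 ≤ (1 + (l1 + Q) / l2) * m := by positivity
    rw [hR]; linarith
  have hlne : Real.log a - Real.log b ≠ 0 := by
    intro h0
    exact hne (Real.log_injOn_pos (Set.mem_Ioi.2 ha0) (Set.mem_Ioi.2 hb0) (by linarith))
  have key := hN0 n m (R * n) (by nlinarith) (by nlinarith) hmR (by rw [hL]; exact hlne)
  rw [hL] at key
  have e1 : σ / (2 * R) * (R * n) = σ / 2 * n := by field_simp
  rw [e1] at key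
  obtain ⟨E, hE⟩ : ∃ E, E = Real.exp (-(σ / 2 * n)) := ⟨_, rfl⟩
  rw [← hE] at key g4
  have hE0 : 0 < E := by rw [hE]; exact Real.exp_pos _
  have hEE : Real.exp (-(σ * n)) = E * E := by
    rw [hE, ← Real.exp_add]; congr 1; ring
  have hlow := abs_log_sub_le a b ha0 hb0 hba.le
  have x1 : Real.exp (-(σ1 * n)) ≤ E * E := by
    rw [← hEE]; apply Real.exp_le_exp.2; nlinarith
  have x2 : Real.exp (-(σ2 * m)) ≤ E * E := by
    rw [← hEE]; apply Real.exp_le_exp.2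
    have : σ * n ≤ σ * (R * m) := by gcongr
    have : σ * R * m ≤ σ2 * m := by gcongr
    linarith
  have y1 : C₀ * θ1 ^ n ≤ K1 * (E * E) * a := f1.trans (by gcongr)
  have y2 : C₀ * θ2 ^ m ≤ K2 * (E * E) * (2 * a) := f2'.trans (by gcongr)
  have y3 : (K1 + 2 * K2) * E ≤ 1 / 4 := by
    rw [le_div_iff₀ (by positivity)] at g4
    linarith
  calc C₀ * θ1 ^ n + C₀ * θ2 ^ m ≤ K1 * (E * E) * a + K2 * (E * E) * (2 * a) := by linarith
    _ = ((K1 + 2 * K2) * E) * (a * E) := by ring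
    _ ≤ 1 / 4 * (a * E) := by gcongr
    _ < a / 2 * E := by nlinarith [mul_pos ha0 hE0]
    _ ≤ a / 2 * |Real.log a - Real.log b| := by gcongr
    _ ≤ _ := hlow

lemma seq_mono (u : ℕ → ℤ) (c ρ θ C₀ : ℝ) (hC : 0 ≤ C₀) (hc : 0 < c) (hρ : 1 < ρ) (hθ0 : 0 ≤ θ) (hθ : θ < ρ)
    (hb : ∀ n : ℕ, |(u n : ℝ) - c * ρ ^ n| ≤ C₀ * θ ^ n) :
    ∀ᶠ n : ℕ in Filter.atTop, u n < u (n + 1) := by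
  obtain ⟨K, σ, hK, hσ, he⟩ := err_bound C₀ θ ρ c hC hθ0 hθ hρ hc
  have hκ : 0 < (ρ - 1) / (2 * (K * (1 + ρ))) := by
    have : 0 < ρ - 1 := by linarith
    positivity
  filter_upwards [exp_small_nat σ _ hσ hκ] with n hn
  have h1 := abs_le.1 ((hb n).trans (he n))
  have h2 := abs_le.1 ((hb (n + 1)).trans (he (n + 1)))
  obtain ⟨a, ha⟩ : ∃ a, a = c * ρ ^ n := ⟨_, rfl⟩
  have ha' : c * ρ ^ (n + 1) = ρ * a := by rw [ha]; ring
  have ha0 : 0 < a := by rw [ha]; positivity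
  rw [ha'] at h2
  rw [← ha] at h1
  have h3 : Real.exp (-(σ * ((n + 1 : ℕ) : ℝ))) ≤ Real.exp (-(σ * n)) := by
    apply Real.exp_le_exp.2; push_cast; nlinarith
  have h4 : K * Real.exp (-(σ * ((n + 1 : ℕ) : ℝ))) * (ρ * a) ≤ K * Real.exp (-(σ * n)) * (ρ * a) := by
    gcongr
  have h5 : K * (1 + ρ) * Real.exp (-(σ * n)) ≤ (ρ - 1) / 2 := by
    rw [le_div_iff₀ (by positivity)] at hn
    linarith
  have h6 : K * (1 + ρ) * Real.exp (-(σ * n)) * a ≤ (ρ - 1) / 2 * a := by gcongr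
  have h7 : 0 < (ρ - 1) / 2 * a := by
    have : 0 < ρ - 1 := by linarith
    positivity
  have : (u n : ℝ) < u (n + 1) := by
    nlinarith [h1.1, h1.2, h2.1, h2.2]
  exact_mod_cast this

theorem dominant_root_sequences_threshold
    (d : ℕ) (hd : 1 ≤ d)
    (u : Fin d → ℕ → ℤ) (c ρ θ : Fin d → ℝ) (C₀ : ℝ) (hC₀ : 0 ≤ C₀)
    (hcalg : ∀ i, IsAlgebraic ℚ (c i)) (hρalg : ∀ i, IsAlgebraic ℚ (ρ i))
    (hc : ∀ i, 0 < c i) (hρ : ∀ i, 1 < ρ i)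
    (hθ0 : ∀ i, 0 ≤ θ i) (hθ : ∀ i, θ i < ρ i)
    (hbound : ∀ i, ∀ n : ℕ, |(u i n : ℝ) - c i * ρ i ^ n| ≤ C₀ * θ i ^ n)
    (hfin : ∀ i j, i ≠ j →
      {p : ℕ × ℕ | c i * ρ i ^ p.1 = c j * ρ j ^ p.2}.Finite) :
    ∃ N : ℤ, ∃ m : Fin d → ℕ,
      (∀ i, IsLeast {k : ℕ | N ≤ u i k} (m i)) ∧
      (∀ i, StrictMono (fun n : ℕ => u i (m i + n))) ∧
      (∀ i j, i ≠ j → ∀ n, m i ≤ n → ∀ k : ℕ,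
        c i * ρ i ^ n ≠ c j * ρ j ^ k ∧
        u i n ≠ u j k ∧
        (u j k < u i n ↔ c j * ρ j ^ k < c i * ρ i ^ n)) ∧
      (∀ i j, i ≠ j → ∀ n, m i ≤ n → ∃ k, m j ≤ k ∧
        c i * ρ i ^ n ≤ c j * ρ j ^ k ∧
        c j * ρ j ^ k < ρ j * (c i * ρ i ^ n)) := by
  have ev1 : ∀ᶠ n : ℕ in Filter.atTop, ∀ i, u i n < u i (n + 1) :=
    Filter.eventually_all.2 fun i => seq_mono (u i) (c i) (ρ i) (θ i) C₀ hC₀ (hc i) (hρ i) (hθ0 i)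
      (hθ i) (hbound i)
  have ev2 : ∀ᶠ n : ℕ in Filter.atTop, ∀ i j, i ≠ j → ∀ k : ℕ,
      C₀ * θ i ^ n + C₀ * θ j ^ k < |c i * ρ i ^ n - c j * ρ j ^ k| := by
    refine Filter.eventually_all.2 fun i => Filter.eventually_all.2 fun j => ?_
    by_cases hij : i = j
    · exact Filter.Eventually.of_forall fun n h => absurd hij h
    · filter_upwards [pair_sep (c i) (c j) (ρ i) (ρ j) (θ i) (θ j) C₀ hC₀ (hcalg i) (hcalg j)
        (hρalg i) (hρalg j) (hc i) (hc j) (hρ i) (hρ j) (hθ0 i) (hθ0 j) (hθ i) (hθ j)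
        (hfin i j hij)] with n hn _
      exact hn
  have ev3 : ∀ᶠ n : ℕ in Filter.atTop, ∀ i j, c j ≤ c i * ρ i ^ n :=
    Filter.eventually_all.2 fun i => Filter.eventually_all.2 fun j =>
      pow_large (c i) (ρ i) (c j) (hc i) (hρ i)
  obtain ⟨N1, hN1⟩ := Filter.eventually_atTop.1 (ev1.and (ev2.and ev3))
  have hmono : ∀ i, ∀ s, N1 ≤ s → StrictMono (fun n : ℕ => u i (s + n)) := by
    intro i s hs
    refine strictMono_nat_of_lt_succ fun n => ?_
    exact (hN1 (s + n) (by omega)).1 i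
  obtain ⟨N, hN⟩ : ∃ N : ℤ, ∀ i, ∀ k < N1, u i k < N := by
    refine ⟨1 + ∑ i, ∑ k ∈ Finset.range N1, |u i k|, fun i k hk => ?_⟩
    have s1 : |u i k| ≤ ∑ k ∈ Finset.range N1, |u i k| :=
      Finset.single_le_sum (f := fun k => |u i k|) (fun _ _ => abs_nonneg _) (Finset.mem_range.2 hk)
    have s2 : ∑ k ∈ Finset.range N1, |u i k| ≤ ∑ i, ∑ k ∈ Finset.range N1, |u i k| :=
      Finset.single_le_sum (f := fun i => ∑ k ∈ Finset.range N1, |u i k|)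
        (fun _ _ => Finset.sum_nonneg fun _ _ => abs_nonneg _) (Finset.mem_univ i)
    have := le_abs_self (u i k)
    linarith
  have hex : ∀ i, ∃ k, N ≤ u i k := by
    intro i
    have hgrow : ∀ t : ℕ, u i N1 + t ≤ u i (N1 + t) := by
      intro t
      induction t with
      | zero => simp
      | succ t ih =>
        have := (hN1 (N1 + t) (by omega)).1 i
        push_cast
        rw [← add_assoc N1 t 1]
        linarith
    refine ⟨N1 + (N - u i N1).toNat, ?_⟩
    have h1 := hgrow (N - u i N1).toNat
    have h2 := Int.self_le_toNat (N - u i N1)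
    linarith
  classical
  have hleast : ∀ i, IsLeast {k : ℕ | N ≤ u i k} (Nat.find (hex i)) := fun i =>
    ⟨Nat.find_spec (hex i), fun k hk => Nat.find_min' (hex i) hk⟩
  have hge : ∀ i, N1 ≤ Nat.find (hex i) := by
    intro i
    by_contra hlt
    push Not at hlt
    have h1 := hN i _ hlt
    have h2 := Nat.find_spec (hex i)
    linarith
  have hb : ∀ i j, i ≠ j → ∀ n, Nat.find (hex i) ≤ n → ∀ k : ℕ,
        c i * ρ i ^ n ≠ c j * ρ j ^ k ∧
        u i n ≠ u j k ∧
        (u j k < u i n ↔ c j * ρ j ^ k < c i * ρ i ^ n) := by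
    intro i j hij n hn k
    have hsep := (hN1 n ((hge i).trans hn)).2.1 i j hij k
    have b1 := abs_le.1 (hbound i n)
    have b2 := abs_le.1 (hbound j k)
    have n1 : 0 ≤ C₀ * θ i ^ n := mul_nonneg hC₀ (pow_nonneg (hθ0 i) n)
    have n2 : 0 ≤ C₀ * θ j ^ k := mul_nonneg hC₀ (pow_nonneg (hθ0 j) k)
    rcases lt_abs.1 hsep with h | h
    · have h1 : (u j k : ℝ) < u i n := by linarith [b1.1, b2.2]
      have h1' : u j k < u i n := by exact_mod_cast h1
      have h2 : c j * ρ j ^ k < c i * ρ i ^ n := by linarith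
      exact ⟨h2.ne', h1'.ne', ⟨fun _ => h2, fun _ => h1'⟩⟩
    · have h1 : (u i n : ℝ) < u j k := by linarith [b1.2, b2.1]
      have h1' : u i n < u j k := by exact_mod_cast h1
      have h2 : c i * ρ i ^ n < c j * ρ j ^ k := by linarith
      exact ⟨h2.ne, h1'.ne, ⟨fun h => absurd h h1'.asymm, fun h => absurd h h2.asymm⟩⟩
  refine ⟨N, fun i => Nat.find (hex i), hleast, fun i => hmono i _ (hge i), hb, ?_⟩
  intro i j hij n hn
  have hexk : ∃ k : ℕ, c i * ρ i ^ n ≤ c j * ρ j ^ k :=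
    (pow_large (c j) (ρ j) (c i * ρ i ^ n) (hc j) (hρ j)).exists
  obtain ⟨k, hk1, hk2⟩ : ∃ k : ℕ, c i * ρ i ^ n ≤ c j * ρ j ^ k ∧
      c j * ρ j ^ k < ρ j * (c i * ρ i ^ n) := by
    refine ⟨Nat.find hexk, Nat.find_spec hexk, ?_⟩
    have hρ0 : 0 < ρ j := by linarith [hρ j]
    have hpos : 0 < c i * ρ i ^ n := mul_pos (hc i) (pow_pos (by linarith [hρ i]) n)
    rcases Nat.eq_zero_or_pos (Nat.find hexk) with h0 | h0
    · rw [h0, pow_zero, mul_one]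
      have h3 := (hN1 n ((hge i).trans hn)).2.2 i j
      nlinarith [hρ j]
    · obtain ⟨t, ht⟩ : ∃ t, Nat.find hexk = t + 1 := ⟨Nat.find hexk - 1, by omega⟩
      have h4 := Nat.find_min hexk (m := t) (by omega)
      push Not at h4
      rw [ht, pow_succ]
      calc c j * (ρ j ^ t * ρ j) = ρ j * (c j * ρ j ^ t) := by ring
        _ < _ := by gcongr
  refine ⟨k, ?_, hk1, hk2⟩
  obtain ⟨e1, e2, e3⟩ := hb i j hij n hn k
  have hlt : u i n < u j k := by
    rcases lt_trichotomy (u i n) (u j k) with h | h | h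
    · exact h
    · exact absurd h e2
    · exact absurd (e3.1 h) (not_lt.2 hk1)
  apply (hleast j).2
  have hin : N ≤ u i n := by
    have h1 := (hmono i _ (hge i)).monotone (Nat.zero_le (n - Nat.find (hex i)))
    simp only [add_zero] at h1
    rw [Nat.add_sub_cancel' hn] at h1
    exact (Nat.find_spec (hex i)).trans h1
  exact (hin.trans hlt.le)
end
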